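/- Let k be a division ring, let A and B be locally indicable groups, let C be a group equipped with injective group homomorphisms C → A and C → B, and let G = A ∗_C B be the corresponding amalgamated free product (the pushout of A ← C → B in the category of groups). If both kA and kB admit Hughes-free embeddings into division rings, then there exist a division ring D and an injective ring homomorphism kG → D. -/

import Mathlib

/-- A subring `S` of a ring `R` is a *division subring* if every nonzero element of `S`
has a two-sided inverse lying in `S`. -/
def IsDivisionSubring {R : Type*} [Ring R] (S : Subring R) : Prop :=
  ∀ x ∈ S, x ≠ 0 → ∃ y ∈ S, x * y = 1 ∧ y * x = 1

/-- The *division closure* of a subset `s` of a ring `R`: the smallest division subring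
of `R` containing `s` (realized as the infimum of all division subrings containing `s`). -/
def divisionClosure {R : Type*} [Ring R] (s : Set R) : Subring R :=
  sInf {S : Subring R | IsDivisionSubring S ∧ s ⊆ S}

lemma subset_divisionClosure {R : Type*} [Ring R] (s : Set R) :
    s ⊆ (divisionClosure s : Set R) := fun _x hx =>
  Subring.mem_sInf.2 fun _S hS => hS.2 hx

/-- Integer powers of an element of a ring, using `Ring.inverse` for negative exponents.
When the ambient ring is a division ring this agrees with the usual `zpow`. -/
noncomputable def ringZPow {R : Type*} [Ring R] (x : R) (i : ℤ) : R :=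
  if 0 ≤ i then x ^ i.toNat else (Ring.inverse x) ^ (-i).toNat

/-- A group is *locally indicable* if every nontrivial finitely generated subgroup
admits a surjective homomorphism onto `ℤ`. -/
def LocallyIndicable (G : Type*) [Group G] : Prop :=
  ∀ H : Subgroup G, H ≠ ⊥ → H.FG →
    ∃ f : H →* Multiplicative ℤ, Function.Surjective f

/-- `φ : kG →+* D` is a *Hughes-free embedding* if it is injective, the division closure
of its image is all of `D`, and whenever `H ≤ G` is finitely generated, `K ⊴ H` and
`t ∈ H` are such that `H/K` is infinite cyclic generated by `tK`, the integer powers of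
`φ t` are left linearly independent over the division closure of `φ (kK)` in `D`. -/
def IsHughesFreeEmbedding {k : Type*} [DivisionRing k] {G : Type*} [Group G]
    {D : Type*} [Ring D] (φ : MonoidAlgebra k G →+* D) : Prop :=
  Function.Injective φ ∧
  divisionClosure (Set.range φ) = ⊤ ∧
  ∀ (H : Subgroup G), H.FG → ∀ (K : Subgroup H) (t : H),
    (∃ f : H →* Multiplicative ℤ,
        Function.Surjective f ∧ f.ker = K ∧ f t = Multiplicative.ofAdd 1) →
    ∀ c : ℤ →₀ D,
      (∀ i : ℤ, c i ∈ divisionClosure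
          (Set.range (φ.comp (MonoidAlgebra.mapDomainRingHom k (H.subtype.comp K.subtype))))) →
      (c.sum fun i a => a * ringZPow (φ (MonoidAlgebra.of k G (H.subtype t))) i) = 0 →
      c = 0

/-- A topological space is a *3-manifold* if it is nonempty, connected, Hausdorff,
second countable, and every point has an open neighbourhood homeomorphic to `ℝ³`. -/
def Is3Manifold (M : Type*) [TopologicalSpace M] : Prop :=
  Nonempty M ∧ ConnectedSpace M ∧ T2Space M ∧ SecondCountableTopology M ∧
    ∀ x : M, ∃ U : Set M, IsOpen U ∧ x ∈ U ∧ Nonempty (U ≃ₜ (Fin 3 → ℝ))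

namespace HughesFree

section

section Laurent

variable {D : Type*} [DivisionRing D]

lemma laurent_exists_mul_eq_one (x : HahnSeries ℤ D) (hx : x ≠ 0) :
    ∃ y, x * y = 1 := by
  have h0 : x.coeff x.order ≠ 0 := by
    rwa [Ne, HahnSeries.coeff_order_eq_zero]
  have h1 : PowerSeries.constantCoeff (LaurentSeries.powerSeriesPart x) = (Units.mk0 _ h0 : D) := by
    rw [← PowerSeries.coeff_zero_eq_constantCoeff_apply]
    simp [LaurentSeries.powerSeriesPart_coeff]
  refine ⟨HahnSeries.ofPowerSeries ℤ D (PowerSeries.invOfUnit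
    (LaurentSeries.powerSeriesPart x) (Units.mk0 _ h0)) *
    HahnSeries.single (-x.order) 1, ?_⟩
  have h2 := LaurentSeries.single_order_mul_powerSeriesPart x
  calc _ = (HahnSeries.single x.order 1 * HahnSeries.ofPowerSeries ℤ D
          (LaurentSeries.powerSeriesPart x)) * (HahnSeries.ofPowerSeries ℤ D
          (PowerSeries.invOfUnit
    (LaurentSeries.powerSeriesPart x) (Units.mk0 _ h0)) *
          HahnSeries.single (-x.order) 1) := by rw [h2]
    _ = HahnSeries.single x.order 1 * HahnSeries.ofPowerSeries ℤ D
          (LaurentSeries.powerSeriesPart x * PowerSeries.invOfUnit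
            (LaurentSeries.powerSeriesPart x) (Units.mk0 _ h0)) *
          HahnSeries.single (-x.order) 1 := by rw [map_mul]; simp only [mul_assoc]
    _ = 1 := by
      rw [PowerSeries.mul_invOfUnit _ _ h1]
      simp [HahnSeries.single_mul_single]

lemma laurent_isUnit_or_eq_zero (x : HahnSeries ℤ D) : IsUnit x ∨ x = 0 := by
  by_cases hx : x = 0
  · exact Or.inr hx
  · obtain ⟨y, hy⟩ := laurent_exists_mul_eq_one x hx
    have hy0 : y ≠ 0 := by rintro rfl; simp at hy
    obtain ⟨z, hz⟩ := laurent_exists_mul_eq_one y hy0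
    have hxz : x = z := left_inv_eq_right_inv hy hz
    exact Or.inl ⟨⟨x, y, hy, by rw [hxz, hz]⟩, rfl⟩

lemma coeff_mul_eq_sum_Icc (x y : HahnSeries ℤ D) (p q n : ℤ)
    (hx : ∀ i < p, x.coeff i = 0) (hy : ∀ i < q, y.coeff i = 0) :
    (x * y).coeff n = ∑ i ∈ Finset.Icc p (n - q), x.coeff i * y.coeff (n - i) := by
  rw [HahnSeries.coeff_mul]
  refine Finset.sum_bij_ne_zero (fun ij _ _ => ij.1) ?_ ?_ ?_ ?_
  · intro a ha hne
    have h1 := left_ne_zero_of_mul hne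
    have h2 := right_ne_zero_of_mul hne
    simp only [Finset.mem_antidiagonal] at ha
    rw [Finset.mem_Icc]
    constructor
    · by_contra! h; exact h1 (hx _ h)
    · by_contra! h; exact h2 (hy _ (by lia))
  · intro a ha _ b hb _ hab
    simp only [Finset.mem_antidiagonal] at ha hb
    ext
    · exact hab
    · lia
  · intro b hb hne
    refine ⟨(b, n - b), ?_, hne, rfl⟩
    simp only [Finset.mem_antidiagonal, HahnSeries.mem_support]
    exact ⟨left_ne_zero_of_mul hne, right_ne_zero_of_mul hne, by ring⟩
  · intro a ha hne
    simp only [Finset.mem_antidiagonal] at ha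
    rw [show n - a.1 = a.2 by lia]

end Laurent

end

end HughesFree

namespace HughesFree

section

open Ordinal in
/-- Complexity of a sum of expressions of complexities `a` and `b`. -/
noncomputable def addCplx (a b : Ordinal.{0}) : Ordinal.{0} :=
  ω ^ max a b + ω ^ min a b

lemma addCplx_comm (a b : Ordinal.{0}) : addCplx a b = addCplx b a := by
  simp [addCplx, max_comm, min_comm]

open Ordinal in
lemma lt_addCplx_left (a b : Ordinal.{0}) : a < addCplx a b := by
  have h1 : max a b ≤ ω ^ max a b := right_le_opow _ one_lt_omega0
  have h2 : (0 : Ordinal) < ω ^ min a b := opow_pos _ omega0_pos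
  exact (le_max_left a b).trans_lt (h1.trans_lt (lt_add_of_pos_right _ h2))

lemma lt_addCplx_right (a b : Ordinal.{0}) : b < addCplx a b := by
  rw [addCplx_comm]; exact lt_addCplx_left b a

open Ordinal in
lemma addCplx_lt_left {a a' : Ordinal.{0}} (b : Ordinal.{0}) (h : a < a') :
    addCplx a b < addCplx a' b := by
  unfold addCplx
  rcases le_or_gt a' b with hb | hb
  · rw [max_eq_right hb, max_eq_right (h.le.trans hb), min_eq_left hb,
      min_eq_left (h.le.trans hb)]
    gcongr
    exact (opow_lt_opow_iff_right one_lt_omega0).2 h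
  · rw [max_eq_left hb.le (a := a')]
    refine lt_of_lt_of_le ?_ le_self_add
    have hm : max a b < a' := max_lt h hb
    refine isPrincipal_add_omega0_opow a' ?_ ?_
    · exact (opow_lt_opow_iff_right one_lt_omega0).2 hm
    · exact (opow_lt_opow_iff_right one_lt_omega0).2 (min_le_max.trans_lt hm)

lemma addCplx_lt_right (a : Ordinal.{0}) {b b' : Ordinal.{0}} (h : b < b') :
    addCplx a b < addCplx a b' := by
  rw [addCplx_comm a, addCplx_comm a]; exact addCplx_lt_left a h

/-- Complexity of a product of expressions of complexities `a` and `b`. -/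
noncomputable def mulCplx (a b : Ordinal.{0}) : Ordinal.{0} :=
  Ordinal.enumOrd {o | Ordinal.IsPrincipal addCplx o} (addCplx a b)

lemma isPrincipal_add_mulCplx (a b : Ordinal.{0}) :
    Ordinal.IsPrincipal addCplx (mulCplx a b) :=
  Ordinal.enumOrd_mem (Ordinal.not_bddAbove_setOfPred_isPrincipal addCplx) _

lemma addCplx_le_mulCplx (a b : Ordinal.{0}) : addCplx a b ≤ mulCplx a b :=
  Ordinal.le_enumOrd_self (Ordinal.not_bddAbove_setOfPred_isPrincipal addCplx)

lemma lt_mulCplx_left (a b : Ordinal.{0}) : a < mulCplx a b :=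
  (lt_addCplx_left a b).trans_le (addCplx_le_mulCplx a b)

lemma lt_mulCplx_right (a b : Ordinal.{0}) : b < mulCplx a b :=
  (lt_addCplx_right a b).trans_le (addCplx_le_mulCplx a b)

lemma mulCplx_lt_left {a a' : Ordinal.{0}} (b : Ordinal.{0}) (h : a < a') :
    mulCplx a b < mulCplx a' b :=
  Ordinal.enumOrd_strictMono (Ordinal.not_bddAbove_setOfPred_isPrincipal addCplx)
    (addCplx_lt_left b h)

lemma mulCplx_lt_right (a : Ordinal.{0}) {b b' : Ordinal.{0}} (h : b < b') :
    mulCplx a b < mulCplx a b' :=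
  Ordinal.enumOrd_strictMono (Ordinal.not_bddAbove_setOfPred_isPrincipal addCplx)
    (addCplx_lt_right a h)

lemma mulCplx_mono {a a' b b' : Ordinal.{0}} (h : a ≤ a') (h' : b ≤ b') :
    mulCplx a b ≤ mulCplx a' b' :=
  le_trans ((show StrictMono (mulCplx · b) from fun _ _ h => mulCplx_lt_left b h).monotone h)
    ((show StrictMono (mulCplx a') from fun _ _ h => mulCplx_lt_right a' h).monotone h')

/-- Complexity of the inverse of an expression of complexity `a`. -/
noncomputable def invCplx (a : Ordinal.{0}) : Ordinal.{0} :=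
  Ordinal.enumOrd {o | Ordinal.IsPrincipal mulCplx o} (Order.succ a)

lemma isPrincipal_mul_invCplx (a : Ordinal.{0}) : Ordinal.IsPrincipal mulCplx (invCplx a) :=
  Ordinal.enumOrd_mem (Ordinal.not_bddAbove_setOfPred_isPrincipal mulCplx) _

lemma isPrincipal_add_invCplx (a : Ordinal.{0}) : Ordinal.IsPrincipal addCplx (invCplx a) :=
  fun _ _ hx hy => (addCplx_le_mulCplx _ _).trans_lt (isPrincipal_mul_invCplx a hx hy)

lemma lt_invCplx (a : Ordinal.{0}) : a < invCplx a :=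
  (Order.lt_succ a).trans_le
    (Ordinal.le_enumOrd_self (Ordinal.not_bddAbove_setOfPred_isPrincipal mulCplx))

lemma invCplx_strictMono : StrictMono invCplx := fun _ _ h =>
  Ordinal.enumOrd_strictMono (Ordinal.not_bddAbove_setOfPred_isPrincipal mulCplx)
    (Order.succ_lt_succ h)

end

end HughesFree

namespace HughesFree

section

/-- Rational expressions over a coefficient type `k` and a type `G` of group elements. -/
inductive RExpr (k G : Type*) where
  | atom (c : k) (g : G) : RExpr k G
  | add (e e' : RExpr k G) : RExpr k G
  | mul (e e' : RExpr k G) : RExpr k G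
  | inv (e : RExpr k G) : RExpr k G

namespace RExpr

variable {k G : Type*}

/-- The value of a rational expression, with atoms interpreted by `v`; the inverse of a non-unit
is `0`. -/
noncomputable def eval {R : Type*} [Ring R] (v : k → G → R) : RExpr k G → R
  | atom c g => v c g
  | add e e' => eval v e + eval v e'
  | mul e e' => eval v e * eval v e'
  | inv e => Ring.inverse (eval v e)

/-- The ordinal complexity of a rational expression. -/
noncomputable def cplx : RExpr k G → Ordinal.{0}
  | atom _ _ => 1
  | add e e' => addCplx (cplx e) (cplx e')
  | mul e e' => mulCplx (cplx e) (cplx e')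
  | inv e => invCplx (cplx e)

/-- Syntactic homogeneity with respect to a degree function on atoms. -/
def Homog (τ : G → ℤ) : RExpr k G → ℤ → Prop
  | atom _ g, n => τ g = n
  | add e e', n => Homog τ e n ∧ Homog τ e' n
  | mul e e', n => ∃ i j, i + j = n ∧ Homog τ e i ∧ Homog τ e' j
  | inv e, n => Homog τ e (-n)

lemma Homog.unique {τ : G → ℤ} {e : RExpr k G} {m n : ℤ} (h : Homog τ e m) (h' : Homog τ e n) :
    m = n := by
  induction e generalizing m n with
  | atom c g => exact h.symm.trans h'
  | add e e' ih ih' => exact ih h.1 h'.1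
  | mul e e' ih ih' =>
    obtain ⟨i, j, rfl, hi, hj⟩ := h
    obtain ⟨i', j', rfl, hi', hj'⟩ := h'
    rw [ih hi hi', ih' hj hj']
  | inv e ih => exact neg_injective (ih h h')

lemma one_le_cplx (e : RExpr k G) : 1 ≤ cplx e := by
  induction e with
  | atom c g => exact le_rfl
  | add e e' ih ih' => exact ih.trans (lt_addCplx_left _ _).le
  | mul e e' ih ih' => exact ih.trans (lt_mulCplx_left _ _).le
  | inv e ih => exact ih.trans (lt_invCplx _).le

/-- Evaluation in Laurent series, an atom with group element `g` being placed in degree `τ g`. -/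
noncomputable def leval {R : Type*} [Ring R] (v : k → G → R) (τ : G → ℤ) (e : RExpr k G) :
    HahnSeries ℤ R :=
  eval (fun c g => HahnSeries.single (τ g) (v c g)) e

end RExpr

open RExpr

section Pair

variable {k G D₁ D₂ : Type*} [DivisionRing D₁] [DivisionRing D₂]
  (v₁ : k → G → D₁) (v₂ : k → G → D₂)

/-- The pairs which are zero or the values of an expression of complexity less than `θ`. -/
def InK (θ : Ordinal.{0}) (x : D₁ × D₂) : Prop :=
  x = 0 ∨ ∃ e : RExpr k G, cplx e < θ ∧ (eval v₁ e, eval v₂ e) = x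

variable {v₁ v₂} {θ a b : Ordinal.{0}} {x y : D₁ × D₂}

lemma InK.mono (h : InK v₁ v₂ a x) (hab : a ≤ b) : InK v₁ v₂ b x :=
  h.imp_right fun ⟨e, he, hx⟩ => ⟨e, he.trans_le hab, hx⟩

lemma InK.iff (h : InK v₁ v₂ θ x)
    (H : ∀ e : RExpr k G, cplx e < θ → (eval v₁ e = 0 ↔ eval v₂ e = 0)) :
    x.1 = 0 ↔ x.2 = 0 := by
  rcases h with rfl | ⟨e, he, rfl⟩
  · simp
  · exact H e he

lemma InK.add (hθ : Ordinal.IsPrincipal addCplx θ) (hx : InK v₁ v₂ θ x) (hy : InK v₁ v₂ θ y) :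
    InK v₁ v₂ θ (x + y) := by
  rcases hx with rfl | ⟨e, he, rfl⟩
  · simpa using hy
  rcases hy with rfl | ⟨e', he', rfl⟩
  · rw [add_zero]; exact Or.inr ⟨e, he, rfl⟩
  exact Or.inr ⟨e.add e', hθ he he', rfl⟩

lemma InK.sum (hθ : Ordinal.IsPrincipal addCplx θ) {ι : Type*} (s : Finset ι) (x : ι → D₁ × D₂)
    (hx : ∀ i ∈ s, InK v₁ v₂ θ (x i)) : InK v₁ v₂ θ (∑ i ∈ s, x i) :=
  Finset.sum_induction x (InK v₁ v₂ θ) (fun _ _ => InK.add hθ) (Or.inl rfl) hx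

lemma InK.add_le (hx : InK v₁ v₂ (Order.succ a) x) (hy : InK v₁ v₂ (Order.succ b) y) :
    InK v₁ v₂ (Order.succ (addCplx a b)) (x + y) := by
  rcases hx with rfl | ⟨e, he, rfl⟩
  · rw [zero_add]; exact hy.mono (Order.succ_le_succ (lt_addCplx_right _ _).le)
  rcases hy with rfl | ⟨e', he', rfl⟩
  · rw [add_zero]
    exact Or.inr ⟨e, he.trans_le (Order.succ_le_succ (lt_addCplx_left _ _).le), rfl⟩
  refine Or.inr ⟨e.add e', ?_, rfl⟩
  rw [Order.lt_succ_iff] at *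
  exact (StrictMono.monotone (fun _ _ => addCplx_lt_left (cplx e')) he).trans
    (StrictMono.monotone (fun _ _ => addCplx_lt_right a) he')

lemma InK.add_lt_left (hx : InK v₁ v₂ a x) (hy : InK v₁ v₂ (Order.succ b) y) :
    InK v₁ v₂ (addCplx a b) (x + y) := by
  rcases hx with rfl | ⟨e, he, rfl⟩
  · rw [zero_add]; exact hy.mono (Order.succ_le_of_lt (lt_addCplx_right _ _))
  rcases hy with rfl | ⟨e', he', rfl⟩
  · rw [add_zero]
    exact Or.inr ⟨e, he.trans (lt_addCplx_left _ _), rfl⟩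
  refine Or.inr ⟨e.add e', ?_, rfl⟩
  rw [Order.lt_succ_iff] at he'
  exact (addCplx_lt_left _ he).trans_le (StrictMono.monotone (fun _ _ => addCplx_lt_right a) he')

lemma InK.add_lt_right (hx : InK v₁ v₂ (Order.succ a) x) (hy : InK v₁ v₂ b y) :
    InK v₁ v₂ (addCplx a b) (x + y) := by
  rw [add_comm, addCplx_comm]; exact InK.add_lt_left hy hx

lemma InK.mul (hθ : Ordinal.IsPrincipal mulCplx θ) (hx : InK v₁ v₂ θ x) (hy : InK v₁ v₂ θ y) :
    InK v₁ v₂ θ (x * y) := by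
  rcases hx with rfl | ⟨e, he, rfl⟩
  · exact Or.inl (by simp)
  rcases hy with rfl | ⟨e', he', rfl⟩
  · exact Or.inl (by simp)
  exact Or.inr ⟨e.mul e', hθ he he', rfl⟩

lemma InK.mul_le (hx : InK v₁ v₂ (Order.succ a) x) (hy : InK v₁ v₂ (Order.succ b) y) :
    InK v₁ v₂ (Order.succ (mulCplx a b)) (x * y) := by
  rcases hx with rfl | ⟨e, he, rfl⟩
  · exact Or.inl (by simp)
  rcases hy with rfl | ⟨e', he', rfl⟩
  · exact Or.inl (by simp)
  refine Or.inr ⟨e.mul e', ?_, rfl⟩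
  rw [Order.lt_succ_iff] at *
  exact mulCplx_mono he he'

lemma InK.mul_lt_left (hx : InK v₁ v₂ a x) (hy : InK v₁ v₂ (Order.succ b) y) :
    InK v₁ v₂ (mulCplx a b) (x * y) := by
  rcases hx with rfl | ⟨e, he, rfl⟩
  · exact Or.inl (by simp)
  rcases hy with rfl | ⟨e', he', rfl⟩
  · exact Or.inl (by simp)
  refine Or.inr ⟨e.mul e', ?_, rfl⟩
  rw [Order.lt_succ_iff] at *
  exact (mulCplx_lt_left _ he).trans_le (mulCplx_mono le_rfl he')

lemma InK.mul_lt_right (hx : InK v₁ v₂ (Order.succ a) x) (hy : InK v₁ v₂ b y) :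
    InK v₁ v₂ (mulCplx a b) (x * y) := by
  rcases hx with rfl | ⟨e, he, rfl⟩
  · exact Or.inl (by simp)
  rcases hy with rfl | ⟨e', he', rfl⟩
  · exact Or.inl (by simp)
  refine Or.inr ⟨e.mul e', ?_, rfl⟩
  rw [Order.lt_succ_iff] at *
  exact (mulCplx_lt_right _ he').trans_le (mulCplx_mono he le_rfl)

lemma InK.inv_le (hx : InK v₁ v₂ (Order.succ a) x) :
    InK v₁ v₂ (Order.succ (invCplx a)) (x.1⁻¹, x.2⁻¹) := by
  rcases hx with rfl | ⟨e, he, rfl⟩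
  · exact Or.inl (by simp)
  refine Or.inr ⟨e.inv, ?_, by simp [eval]⟩
  rw [Order.lt_succ_iff] at *
  exact invCplx_strictMono.monotone he

lemma InK.inv_lt (hx : InK v₁ v₂ a x) : InK v₁ v₂ (invCplx a) (x.1⁻¹, x.2⁻¹) := by
  rcases hx with rfl | ⟨e, he, rfl⟩
  · exact Or.inl (by simp)
  exact Or.inr ⟨e.inv, invCplx_strictMono he, by simp [eval]⟩

end Pair

section Decomposition

variable {D : Type*} [DivisionRing D]

lemma laurent_mul_ringInverse {x : HahnSeries ℤ D} (hx : x ≠ 0) : x * Ring.inverse x = 1 :=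
  Ring.mul_inverse_cancel _ ((laurent_isUnit_or_eq_zero x).resolve_right hx)

lemma laurent_order_ringInverse {x : HahnSeries ℤ D} (hx : x ≠ 0) :
    (Ring.inverse x).order = -x.order := by
  have h := laurent_mul_ringInverse hx
  have hy : Ring.inverse x ≠ 0 := by intro h'; simp [h'] at h
  have := HahnSeries.order_mul hx hy
  rw [h, HahnSeries.order_one] at this
  lia

lemma laurent_coeff_ringInverse_of_lt {x : HahnSeries ℤ D} (hx : x ≠ 0) {n : ℤ}
    (hn : n < -x.order) : (Ring.inverse x).coeff n = 0 :=
  HahnSeries.coeff_eq_zero_of_lt_order (by rwa [laurent_order_ringInverse hx])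

lemma laurent_coeff_ringInverse {x : HahnSeries ℤ D} (hx : x ≠ 0) (n : ℤ) (hn : -x.order ≤ n) :
    (Ring.inverse x).coeff n = (x.coeff x.order)⁻¹ * ((if n = -x.order then 1 else 0) -
      ∑ i ∈ Finset.Ioc x.order (n + 2 * x.order),
        x.coeff i * (Ring.inverse x).coeff (x.order + n - i)) := by
  have h0 : x.coeff x.order ≠ 0 := by rwa [Ne, HahnSeries.coeff_order_eq_zero]
  have h : (x * Ring.inverse x).coeff (x.order + n) =
      (1 : HahnSeries ℤ D).coeff (x.order + n) := by rw [laurent_mul_ringInverse hx]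
  rw [coeff_mul_eq_sum_Icc _ _ x.order (-x.order) _
    (fun i hi => HahnSeries.coeff_eq_zero_of_lt_order hi)
    (fun i hi => laurent_coeff_ringInverse_of_lt hx hi),
    show x.order + n - -x.order = n + 2 * x.order by ring,
    ← Finset.add_sum_Ioc_eq_sum_Icc (by lia)] at h
  rw [HahnSeries.coeff_one] at h
  rw [eq_inv_mul_iff_mul_eq₀ h0, eq_sub_iff_add_eq]
  rw [show x.order + n - x.order = n by ring] at h
  rw [h]
  congr 1
  exact propext ⟨fun h => by lia, fun h => by lia⟩

lemma laurent_ringInverse_single (m : ℤ) (a : D) :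
    Ring.inverse (HahnSeries.single m a) = HahnSeries.single (-m) a⁻¹ := by
  by_cases ha : a = 0
  · simp [ha]
  · refine left_inv_eq_right_inv (Ring.inverse_mul_cancel _ ?_) ?_
    · exact (laurent_isUnit_or_eq_zero _).resolve_right (by simpa using ha)
    · simp [HahnSeries.single_mul_single, ha]

variable {k G D₁ D₂ : Type*} [DivisionRing D₁] [DivisionRing D₂]
  {v₁ : k → G → D₁} {v₂ : k → G → D₂}

/-- The pair of coefficients of degree `n` of the Laurent values of `e`. -/
noncomputable def coeffPair (v₁ : k → G → D₁) (v₂ : k → G → D₂) (τ : G → ℤ) (e : RExpr k G)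
    (n : ℤ) : D₁ × D₂ :=
  ((leval v₁ τ e).coeff n, (leval v₂ τ e).coeff n)

lemma eq_single_of_coeff_eq_zero {x : HahnSeries ℤ D} {m : ℤ}
    (h : ∀ n, n ≠ m → x.coeff n = 0) : x = HahnSeries.single m (x.coeff m) := by
  ext n
  by_cases hn : n = m
  · simp [hn]
  · simp [hn, h n hn]

lemma leval_inv_of_homog {τ : G → ℤ} {v : k → G → D} {e : RExpr k G}
    {m : ℤ} (h : ∀ n, n ≠ m → (leval v τ e).coeff n = 0) :
    leval v τ e.inv = HahnSeries.single (-m) ((leval v τ e).coeff m)⁻¹ := by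
  rw [← laurent_ringInverse_single]
  exact congrArg Ring.inverse (eq_single_of_coeff_eq_zero h)

lemma leval_mul_of_homog {τ : G → ℤ} {v : k → G → D} {e e' : RExpr k G} {i j : ℤ} (n : ℤ)
    (hi : ∀ n, n ≠ i → (leval v τ e).coeff n = 0)
    (hj : ∀ n, n ≠ j → (leval v τ e').coeff n = 0) :
    (leval v τ (e.mul e')).coeff n =
      if n = i + j then (leval v τ e).coeff i * (leval v τ e').coeff j else 0 := by
  show (leval v τ e * leval v τ e').coeff n = _
  rw [eq_single_of_coeff_eq_zero hi, eq_single_of_coeff_eq_zero hj,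
    HahnSeries.single_mul_single, HahnSeries.coeff_single]
  simp

lemma InK.inverse_coeff {θ : Ordinal.{0}} (hθ : Ordinal.IsPrincipal mulCplx θ)
    (hθ' : Ordinal.IsPrincipal addCplx θ) (hneg : InK v₁ v₂ θ (-1))
    {x₁ : HahnSeries ℤ D₁} {x₂ : HahnSeries ℤ D₂} (h₁ : x₁ ≠ 0) (h₂ : x₂ ≠ 0)
    (ho : x₁.order = x₂.order) (hx : ∀ n, InK v₁ v₂ θ (x₁.coeff n, x₂.coeff n))
    (hi : InK v₁ v₂ θ ((x₁.coeff x₁.order)⁻¹, (x₂.coeff x₂.order)⁻¹)) (n : ℤ) :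
    InK v₁ v₂ θ ((Ring.inverse x₁).coeff n, (Ring.inverse x₂).coeff n) := by
  suffices H : ∀ N : ℕ, ∀ n, n < -x₁.order + N →
      InK v₁ v₂ θ ((Ring.inverse x₁).coeff n, (Ring.inverse x₂).coeff n) from
    H (n + x₁.order + 1).toNat n (by lia)
  intro N
  induction N with
  | zero =>
    intro n hn
    left
    rw [laurent_coeff_ringInverse_of_lt h₁ (by lia),
      laurent_coeff_ringInverse_of_lt h₂ (by lia)]
    rfl
  | succ N ih =>
    intro n hn
    by_cases hn' : n < -x₁.order + N
    · exact ih n hn'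
    rw [laurent_coeff_ringInverse h₁ n (by lia), laurent_coeff_ringInverse h₂ n (by lia), ← ho]
    rw [← ho] at hi
    by_cases hn0 : n = -x₁.order
    · simpa [hn0, show -x₁.order + 2 * x₁.order = x₁.order by ring] using hi
    have hS : InK v₁ v₂ θ (∑ i ∈ Finset.Ioc x₁.order (n + 2 * x₁.order),
        (x₁.coeff i, x₂.coeff i) * ((Ring.inverse x₁).coeff (x₁.order + n - i),
          (Ring.inverse x₂).coeff (x₁.order + n - i))) :=
      InK.sum hθ' _ _ fun i hi => (hx i).mul hθ (ih _ (by rw [Finset.mem_Ioc] at hi; lia))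
    convert hi.mul hθ (hneg.mul hθ hS) using 1
    ext <;> simp [hn0, Prod.fst_sum, Prod.snd_sum]

lemma order_eq_of_coeff_iff {x₁ : HahnSeries ℤ D₁} {x₂ : HahnSeries ℤ D₂}
    (h₁ : x₁ ≠ 0) (h₂ : x₂ ≠ 0) (h : ∀ n, x₁.coeff n = 0 ↔ x₂.coeff n = 0) :
    x₁.order = x₂.order := by
  apply le_antisymm
  · apply HahnSeries.order_le_of_coeff_ne_zero
    rwa [Ne, h, HahnSeries.coeff_order_eq_zero]
  · apply HahnSeries.order_le_of_coeff_ne_zero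
    rwa [Ne, ← h, HahnSeries.coeff_order_eq_zero]

lemma eq_zero_iff_of_coeff_iff {x₁ : HahnSeries ℤ D₁} {x₂ : HahnSeries ℤ D₂}
    (h : ∀ n, x₁.coeff n = 0 ↔ x₂.coeff n = 0) : x₁ = 0 ↔ x₂ = 0 := by
  simp only [HahnSeries.ext_iff, funext_iff, HahnSeries.coeff_zero, h]

lemma leval_mul_coeffPair (τ : G → ℤ) (e e' : RExpr k G) : ∃ p q : ℤ, ∀ n,
    coeffPair v₁ v₂ τ (e.mul e') n = ∑ i ∈ Finset.Icc p (n - q),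
      coeffPair v₁ v₂ τ e i * coeffPair v₁ v₂ τ e' (n - i) := by
  refine ⟨min (leval v₁ τ e).order (leval v₂ τ e).order,
    min (leval v₁ τ e').order (leval v₂ τ e').order, fun n => ?_⟩
  have h₁ := coeff_mul_eq_sum_Icc (leval v₁ τ e) (leval v₁ τ e')
    (min (leval v₁ τ e).order (leval v₂ τ e).order)
    (min (leval v₁ τ e').order (leval v₂ τ e').order) n
    (fun i hi => HahnSeries.coeff_eq_zero_of_lt_order (hi.trans_le (min_le_left _ _)))
    (fun i hi => HahnSeries.coeff_eq_zero_of_lt_order (hi.trans_le (min_le_left _ _)))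
  have h₂ := coeff_mul_eq_sum_Icc (leval v₂ τ e) (leval v₂ τ e')
    (min (leval v₁ τ e).order (leval v₂ τ e).order)
    (min (leval v₁ τ e').order (leval v₂ τ e').order) n
    (fun i hi => HahnSeries.coeff_eq_zero_of_lt_order (hi.trans_le (min_le_right _ _)))
    (fun i hi => HahnSeries.coeff_eq_zero_of_lt_order (hi.trans_le (min_le_right _ _)))
  ext
  · rw [Prod.fst_sum]; exact h₁
  · rw [Prod.snd_sum]; exact h₂

variable [One G] [Ring k]

theorem coeffPair_decomposition (hv₁ : v₁ (-1) 1 = -1) (hv₂ : v₂ (-1) 1 = -1) (τ : G → ℤ)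
    (e : RExpr k G)
    (IH : ∀ e' : RExpr k G, cplx e' < cplx e → (eval v₁ e' = 0 ↔ eval v₂ e' = 0)) :
    (∀ n, InK v₁ v₂ (Order.succ (cplx e)) (coeffPair v₁ v₂ τ e n)) ∧
    ((∀ m, ¬ Homog τ e m) → ∀ n, InK v₁ v₂ (cplx e) (coeffPair v₁ v₂ τ e n)) ∧
    (∀ m, Homog τ e m → ∀ n, n ≠ m → coeffPair v₁ v₂ τ e n = 0) := by
  induction e with
  | atom c g =>
    refine ⟨fun n => ?_, fun h => (h _ rfl).elim, fun m hm n hn => ?_⟩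
    · by_cases hn : n = τ g
      · refine Or.inr ⟨atom c g, Order.lt_succ _, ?_⟩
        simp [coeffPair, leval, eval, hn]
      · left; simp [coeffPair, leval, eval, hn]
    · have hm : τ g = m := hm
      simp [coeffPair, leval, eval, hm, hn]
  | add e e' ih ih' =>
    obtain ⟨h1, h2, h3⟩ := ih fun e'' h => IH e'' (h.trans (lt_addCplx_left _ _))
    obtain ⟨h1', h2', h3'⟩ := ih' fun e'' h => IH e'' (h.trans (lt_addCplx_right _ _))
    have hadd : ∀ n, coeffPair v₁ v₂ τ (e.add e') n =
      coeffPair v₁ v₂ τ e n + coeffPair v₁ v₂ τ e' n := fun n => rfl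
    simp only [hadd]
    refine ⟨fun n => (h1 n).add_le (h1' n), fun H n => ?_, fun m hm n hn => ?_⟩
    · by_cases hh : ∃ m, Homog τ e m
      · obtain ⟨m, hm⟩ := hh
        by_cases hh' : ∃ m, Homog τ e' m
        · obtain ⟨m', hm'⟩ := hh'
          have hmm : m ≠ m' := by rintro rfl; exact H m ⟨hm, hm'⟩
          by_cases hn : n = m
          · rw [h3' m' hm' n (by rwa [hn]), add_zero]
            exact (h1 n).mono (Order.succ_le_of_lt (lt_addCplx_left _ _))
          · rw [h3 m hm n hn, zero_add]
            exact (h1' n).mono (Order.succ_le_of_lt (lt_addCplx_right _ _))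
        · push Not at hh'
          exact (h1 n).add_lt_right (h2' hh' n)
      · push Not at hh
        exact (h2 hh n).add_lt_left (h1' n)
    · rw [h3 m hm.1 n hn, h3' m hm.2 n hn, add_zero]
  | mul e e' ih ih' =>
    obtain ⟨h1, h2, h3⟩ := ih fun e'' h => IH e'' (h.trans (lt_mulCplx_left _ _))
    obtain ⟨h1', h2', h3'⟩ := ih' fun e'' h => IH e'' (h.trans (lt_mulCplx_right _ _))
    obtain ⟨p, q, hmul⟩ := leval_mul_coeffPair (v₁ := v₁) (v₂ := v₂) τ e e'
    have key : (∀ m, ¬ Homog τ (e.mul e') m) →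
        ∀ n, InK v₁ v₂ (cplx (e.mul e')) (coeffPair v₁ v₂ τ (e.mul e') n) := by
      intro H n
      rw [hmul]
      refine InK.sum (isPrincipal_add_mulCplx _ _) _ _ fun i _ => ?_
      by_cases hh : ∃ m, Homog τ e m
      · obtain ⟨m, hm⟩ := hh
        exact (h1 i).mul_lt_right (h2' (fun m' hm' => H _ ⟨m, m', rfl, hm, hm'⟩) _)
      · push Not at hh
        exact (h2 hh i).mul_lt_left (h1' _)
    have key' : ∀ m, Homog τ (e.mul e') m → ∃ i j, i + j = m ∧ ∀ n,
        coeffPair v₁ v₂ τ (e.mul e') n = if n = m then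
          coeffPair v₁ v₂ τ e i * coeffPair v₁ v₂ τ e' j else 0 := by
      rintro m ⟨i, j, rfl, hi, hj⟩
      refine ⟨i, j, rfl, fun n => ?_⟩
      have e1 := leval_mul_of_homog (v := v₁) n (fun n hn => congrArg Prod.fst (h3 i hi n hn))
        (fun n hn => congrArg Prod.fst (h3' j hj n hn))
      have e2 := leval_mul_of_homog (v := v₂) n (fun n hn => congrArg Prod.snd (h3 i hi n hn))
        (fun n hn => congrArg Prod.snd (h3' j hj n hn))
      ext
      · rw [show (coeffPair v₁ v₂ τ (e.mul e') n).1 = _ from e1]; split_ifs <;> rfl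
      · rw [show (coeffPair v₁ v₂ τ (e.mul e') n).2 = _ from e2]; split_ifs <;> rfl
    refine ⟨fun n => ?_, key, fun m hm n hn => ?_⟩
    · by_cases hh : ∃ m, Homog τ (e.mul e') m
      · obtain ⟨m, hm⟩ := hh
        obtain ⟨i, j, -, h⟩ := key' m hm
        rw [h n]
        split_ifs
        · exact (h1 i).mul_le (h1' j)
        · exact Or.inl rfl
      · push Not at hh
        exact (key hh n).mono (Order.le_succ _)
    · obtain ⟨i, j, -, h⟩ := key' m hm
      rw [h n, if_neg hn]
  | inv e ih =>
    have IH' : ∀ e' : RExpr k G, cplx e' < Order.succ (cplx e) →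
        (eval v₁ e' = 0 ↔ eval v₂ e' = 0) := fun e' h =>
      IH e' ((Order.lt_succ_iff.1 h).trans_lt (lt_invCplx _))
    obtain ⟨h1, h2, h3⟩ := ih fun e'' h => IH' e'' (h.trans (Order.lt_succ _))
    have hhom : ∀ m, Homog τ e.inv m → ∀ n, coeffPair v₁ v₂ τ e.inv n =
        if n = m then ((coeffPair v₁ v₂ τ e (-m)).1⁻¹, (coeffPair v₁ v₂ τ e (-m)).2⁻¹)
        else 0 := by
      intro m hm n
      have h3m := h3 _ hm
      have e1 := leval_inv_of_homog (v := v₁) (τ := τ) (e := e) (m := -m)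
        fun n hn => congrArg Prod.fst (h3m n hn)
      have e2 := leval_inv_of_homog (v := v₂) (τ := τ) (e := e) (m := -m)
        fun n hn => congrArg Prod.snd (h3m n hn)
      rw [coeffPair, e1, e2, HahnSeries.coeff_single, HahnSeries.coeff_single, neg_neg]
      split_ifs <;> rfl
    have key : (∀ m, ¬ Homog τ e.inv m) →
        ∀ n, InK v₁ v₂ (cplx e.inv) (coeffPair v₁ v₂ τ e.inv n) := by
      intro H n
      have H' : ∀ m, ¬ Homog τ e m := fun m hm => H (-m) (by rwa [Homog, neg_neg])
      have hiff : ∀ n, (leval v₁ τ e).coeff n = 0 ↔ (leval v₂ τ e).coeff n = 0 :=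
        fun n => (h1 n).iff IH'
      by_cases hz : leval v₁ τ e = 0
      · have hz2 := (eq_zero_iff_of_coeff_iff hiff).1 hz
        left
        have e1 : leval v₁ τ e.inv = Ring.inverse (leval v₁ τ e) := rfl
        have e2 : leval v₂ τ e.inv = Ring.inverse (leval v₂ τ e) := rfl
        simp [coeffPair, e1, e2, hz, hz2]
      · have hz2 := mt (eq_zero_iff_of_coeff_iff hiff).2 hz
        have ho := order_eq_of_coeff_iff hz hz2 hiff
        refine InK.inverse_coeff (isPrincipal_mul_invCplx _) (isPrincipal_add_invCplx _)
          (Or.inr ⟨atom (-1) 1, (one_le_cplx e).trans_lt (lt_invCplx _), ?_⟩)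
          hz hz2 ho (fun n => (h1 n).mono (Order.succ_le_of_lt (lt_invCplx _))) ?_ n
        · simp only [eval, hv₁, hv₂]; rfl
        · rw [← ho]; exact (h2 H' _).inv_lt
    refine ⟨fun n => ?_, key, fun m hm n hn => by rw [hhom m hm n, if_neg hn]⟩
    by_cases hh : ∃ m, Homog τ e.inv m
    · obtain ⟨m, hm⟩ := hh
      rw [hhom m hm n]
      split_ifs
      · exact (h1 _).inv_le
      · exact Or.inl rfl
    · push Not at hh
      exact (key hh n).mono (Order.le_succ _)

end Decomposition

end

end HughesFree

namespace HughesFree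

section

namespace RExpr

variable {k G G' : Type*}

/-- Apply a map to the group elements occurring in a rational expression. -/
def map (σ : G → G') : RExpr k G → RExpr k G'
  | atom c g => atom c (σ g)
  | add e e' => add (map σ e) (map σ e')
  | mul e e' => mul (map σ e) (map σ e')
  | inv e => inv (map σ e)

lemma eval_map {R : Type*} [Ring R] (v : k → G' → R) (σ : G → G') (e : RExpr k G) :
    eval v (map σ e) = eval (fun c g => v c (σ g)) e := by
  induction e with
  | atom c g => rfl
  | add e e' ih ih' => simp only [map, eval, ih, ih']
  | mul e e' ih ih' => simp only [map, eval, ih, ih']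
  | inv e ih => simp only [map, eval, ih]

lemma cplx_map (σ : G → G') (e : RExpr k G) : cplx (map σ e) = cplx e := by
  induction e with
  | atom c g => rfl
  | add e e' ih ih' => simp only [map, cplx, ih, ih']
  | mul e e' ih ih' => simp only [map, cplx, ih, ih']
  | inv e ih => simp only [map, cplx, ih]

lemma homog_map (τ : G' → ℤ) (σ : G → G') (e : RExpr k G) (n : ℤ) :
    Homog τ (map σ e) n ↔ Homog (τ ∘ σ) e n := by
  induction e generalizing n with
  | atom c g => rfl
  | add e e' ih ih' => simp only [map, Homog, ih, ih']
  | mul e e' ih ih' => simp only [map, Homog, ih, ih']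
  | inv e ih => simp only [map, Homog, ih]

/-- All group elements occurring in the expression lie in the set `S`. -/
def AtomsIn (S : Set G) : RExpr k G → Prop
  | atom _ g => g ∈ S
  | add e e' => AtomsIn S e ∧ AtomsIn S e'
  | mul e e' => AtomsIn S e ∧ AtomsIn S e'
  | inv e => AtomsIn S e

lemma AtomsIn.mono {S T : Set G} (h : S ⊆ T) {e : RExpr k G} (he : AtomsIn S e) :
    AtomsIn T e := by
  induction e with
  | atom c g => exact h he
  | add e e' ih ih' => exact ⟨ih he.1, ih' he.2⟩
  | mul e e' ih ih' => exact ⟨ih he.1, ih' he.2⟩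
  | inv e ih => exact ih he

lemma AtomsIn.map {S : Set G} {T : Set G'} {σ : G → G'} (h : ∀ x ∈ S, σ x ∈ T) {e : RExpr k G}
    (he : AtomsIn S e) : AtomsIn T (map σ e) := by
  induction e with
  | atom c g => exact h _ he
  | add e e' ih ih' => exact ⟨ih he.1, ih' he.2⟩
  | mul e e' ih ih' => exact ⟨ih he.1, ih' he.2⟩
  | inv e ih => exact ih he

variable [Group G]

/-- The expression for the value of `e` multiplied by `g` on the left and by `h` on the right. -/
def biTrans : G → G → RExpr k G → RExpr k G
  | g, h, atom c x => atom c (g * x * h)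
  | g, h, add e e' => add (biTrans g h e) (biTrans g h e')
  | g, h, mul e e' => mul (biTrans g 1 e) (biTrans 1 h e')
  | g, h, inv e => inv (biTrans h⁻¹ g⁻¹ e)

lemma cplx_biTrans (g h : G) (e : RExpr k G) : cplx (biTrans g h e) = cplx e := by
  induction e generalizing g h with
  | atom c g => rfl
  | add e e' ih ih' => simp only [biTrans, cplx, ih, ih']
  | mul e e' ih ih' => simp only [biTrans, cplx, ih, ih']
  | inv e ih => simp only [biTrans, cplx, ih]

lemma AtomsIn.biTrans {H : Subgroup G} {g h : G} (hg : g ∈ H) (hh : h ∈ H) {e : RExpr k G}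
    (he : AtomsIn H e) : AtomsIn H (biTrans g h e) := by
  induction e generalizing g h with
  | atom c x => exact H.mul_mem (H.mul_mem hg he) hh
  | add e e' ih ih' => exact ⟨ih hg hh he.1, ih' hg hh he.2⟩
  | mul e e' ih ih' => exact ⟨ih hg H.one_mem he.1, ih' H.one_mem hh he.2⟩
  | inv e ih => exact ih (H.inv_mem hh) (H.inv_mem hg) he

/-- Additivity of a degree function on a subgroup. -/
def AddOn (τ : G → ℤ) (H : Subgroup G) : Prop :=
  ∀ x ∈ H, ∀ y ∈ H, τ (x * y) = τ x + τ y

lemma AddOn.one {τ : G → ℤ} {H : Subgroup G} (h : AddOn τ H) : τ 1 = 0 := by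
  have := h 1 H.one_mem 1 H.one_mem
  rw [mul_one] at this
  lia

lemma AddOn.inv {τ : G → ℤ} {H : Subgroup G} (h : AddOn τ H) {x : G} (hx : x ∈ H) :
    τ x⁻¹ = -τ x := by
  have := h x hx x⁻¹ (H.inv_mem hx)
  rw [mul_inv_cancel, h.one] at this
  lia

lemma Homog.of_biTrans {τ : G → ℤ} {H : Subgroup G} (hτ : AddOn τ H) {g h : G} (hg : g ∈ H)
    (hh : h ∈ H) {e : RExpr k G} (he : AtomsIn H e) {n : ℤ}
    (hom : Homog τ (RExpr.biTrans g h e) n) :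
    Homog τ e (n - τ g - τ h) := by
  induction e generalizing g h n with
  | atom c x =>
    have : τ (g * x * h) = n := hom
    rw [hτ _ (H.mul_mem hg he) _ hh, hτ _ hg _ he] at this
    show τ x = _
    lia
  | add e e' ih ih' => exact ⟨ih hg hh he.1 hom.1, ih' hg hh he.2 hom.2⟩
  | mul e e' ih ih' =>
    obtain ⟨i, j, rfl, hi, hj⟩ := hom
    refine ⟨_, _, ?_, ih hg H.one_mem he.1 hi, ih' H.one_mem hh he.2 hj⟩
    rw [hτ.one]; ring
  | inv e ih =>
    have := ih (H.inv_mem hh) (H.inv_mem hg) he hom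
    rw [hτ.inv hh, hτ.inv hg] at this
    show Homog τ e _
    convert this using 1
    ring

end RExpr

open RExpr

section Values

variable {k G D : Type*} [DivisionRing k] [Group G] [DivisionRing D]

/-- A pair of compatible representations of the scalars `k` and of the group `G` in a ring. -/
structure CoeffRep (k G D : Type*) [DivisionRing k] [Group G] [Ring D] where
  /-- the action of the scalars -/
  scalar : k →+* D
  /-- the action of the group -/
  grp : G →* D
  comm : ∀ c g, scalar c * grp g = grp g * scalar c

/-- The value of an atom. -/
def CoeffRep.val {D : Type*} [Ring D] (ρ : CoeffRep k G D) (c : k) (g : G) : D :=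
  ρ.scalar c * ρ.grp g

variable (ρ : CoeffRep k G D)

lemma CoeffRep.grp_ne_zero (g : G) : ρ.grp g ≠ 0 := (IsUnit.map ρ.grp (Group.isUnit g)).ne_zero

lemma CoeffRep.grp_inv (g : G) : ρ.grp g⁻¹ = (ρ.grp g)⁻¹ := by
  exact eq_inv_of_mul_eq_one_left (by rw [← map_mul]; simp)

lemma CoeffRep.val_neg_one {D : Type*} [Ring D] (ρ : CoeffRep k G D) : ρ.val (-1) 1 = -1 := by
  simp [CoeffRep.val]

lemma eval_biTrans (g h : G) (e : RExpr k G) :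
    eval ρ.val (biTrans g h e) = ρ.grp g * eval ρ.val e * ρ.grp h := by
  induction e generalizing g h with
  | atom c x =>
    simp only [biTrans, eval, CoeffRep.val, map_mul]
    rw [← mul_assoc, ← mul_assoc, ρ.comm, mul_assoc (ρ.grp g), mul_assoc (ρ.grp g)]
  | add e e' ih ih' => simp only [biTrans, eval, ih, ih', mul_add, add_mul]
  | mul e e' ih ih' => simp only [biTrans, eval, ih, ih', map_one, one_mul, mul_one, mul_assoc]
  | inv e ih =>
    simp only [biTrans, eval, ih, Ring.inverse_eq_inv', mul_inv_rev, ρ.grp_inv, inv_inv, mul_assoc]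

lemma eval_conj (d : G) (e : RExpr k G) :
    eval ρ.val (map (fun x => d * x * d⁻¹) e) =
      ρ.grp d * eval ρ.val e * (ρ.grp d)⁻¹ := by
  have hd := ρ.grp_ne_zero d
  induction e with
  | atom c x =>
    simp only [map, eval, CoeffRep.val, map_mul, ρ.grp_inv]
    rw [← mul_assoc, ← mul_assoc, ρ.comm, mul_assoc (ρ.grp d), mul_assoc (ρ.grp d), mul_assoc]
  | add e e' ih ih' => simp only [map, eval, ih, ih', mul_add, add_mul]
  | mul e e' ih ih' =>
    simp only [map, eval, ih, ih']
    simp only [mul_assoc]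
    rw [inv_mul_cancel_left₀ hd]
  | inv e ih =>
    simp only [map, eval, ih, Ring.inverse_eq_inv', mul_inv_rev, inv_inv]
    simp only [mul_assoc]

end Values

open scoped Pointwise in
lemma conj_mem_closure {G : Type*} [Group G] (d : G) (F : Set G) {x : G}
    (hx : x ∈ Subgroup.closure F) :
    d * x * d⁻¹ ∈ Subgroup.closure ((fun x => d * x * d⁻¹) '' F) := by
  have : (MulAut.conj d).toMonoidHom x ∈ Subgroup.closure ((MulAut.conj d).toMonoidHom '' F) := by
    rw [← MonoidHom.map_closure]
    exact Subgroup.mem_map_of_mem _ hx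
  exact this

open scoped Classical in
theorem exists_normalForm.{w, u₁, u₂} {k : Type u₁} {G : Type u₂} [DivisionRing k] [Group G]
    (e : RExpr k G) :
    ∃ (d : G) (e' : RExpr k G) (F : Finset G), cplx e' = cplx e ∧
      AtomsIn (Subgroup.closure (F : Set G) : Set G) e' ∧
      (∀ (D : Type w) [DivisionRing D] (ρ : CoeffRep k G D),
        eval ρ.val e = eval ρ.val e' * ρ.grp d) ∧
      ∀ τ : G → ℤ, AddOn τ (Subgroup.closure (F : Set G)) → ∀ n, Homog τ e' n →
        n = 0 ∧ ∀ x ∈ F, τ x = 0 := by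
  induction e with
  | atom c g =>
    refine ⟨g, atom c 1, ∅, rfl, Subgroup.one_mem _, ?_, ?_⟩
    · intro D _ ρ
      simp [eval, CoeffRep.val]
    · intro τ hτ n hn
      have : τ 1 = n := hn
      exact ⟨by rw [← this, hτ.one], by simp⟩
  | add e e' ih ih' =>
    obtain ⟨d, f, F, hc, ha, hv, hh⟩ := ih
    obtain ⟨d', f', F', hc', ha', hv', hh'⟩ := ih'
    set h := d' * d⁻¹ with h_def
    have s1 : (F : Set G) ⊆ (F ∪ F' ∪ {h} : Finset G) := by intro x; simp; tauto
    have s2 : (F' : Set G) ⊆ (F ∪ F' ∪ {h} : Finset G) := by intro x; simp; tauto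
    have s3 : h ∈ Subgroup.closure ((F ∪ F' ∪ {h} : Finset G) : Set G) :=
      Subgroup.subset_closure (by simp)
    refine ⟨d, f.add (biTrans 1 h f'), F ∪ F' ∪ {h}, ?_, ⟨?_, ?_⟩, ?_, ?_⟩
    · simp only [cplx, hc, hc', cplx_biTrans]
    · exact ha.mono (Subgroup.closure_mono s1)
    · exact (ha'.mono (Subgroup.closure_mono s2)).biTrans (Subgroup.one_mem _) s3
    · intro D _ ρ
      simp only [eval, eval_biTrans, hv D ρ, hv' D ρ, h_def, map_mul, map_one, one_mul, ρ.grp_inv,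
        add_mul, mul_assoc]
      rw [inv_mul_cancel₀ (ρ.grp_ne_zero d), mul_one]
    · intro τ hτ n hn
      have t1 := hh τ (fun x hx y hy => hτ x (Subgroup.closure_mono s1 hx) y
        (Subgroup.closure_mono s1 hy)) n hn.1
      have t2 := hh' τ (fun x hx y hy => hτ x (Subgroup.closure_mono s2 hx) y
        (Subgroup.closure_mono s2 hy)) _ (Homog.of_biTrans hτ (Subgroup.one_mem _) s3
          (ha'.mono (Subgroup.closure_mono s2)) hn.2)
      refine ⟨t1.1, fun x hx => ?_⟩
      have t3 := t2.1
      rw [t1.1, hτ.one] at t3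
      simp only [Finset.mem_union, Finset.mem_singleton] at hx
      rcases hx with (hx | hx) | rfl
      · exact t1.2 x hx
      · exact t2.2 x hx
      · lia
  | mul e e' ih ih' =>
    obtain ⟨d, f, F, hc, ha, hv, hh⟩ := ih
    obtain ⟨d', f', F', hc', ha', hv', hh'⟩ := ih'
    set σ : G → G := fun x => d * x * d⁻¹ with σ_def
    have s1 : (F : Set G) ⊆ (F ∪ F'.image σ : Finset G) := by intro x; simp; tauto
    have s2 : σ '' (F' : Set G) ⊆ (F ∪ F'.image σ : Finset G) := by
      rw [Finset.coe_union, Finset.coe_image]; exact Set.subset_union_right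
    have s3 : ∀ x ∈ Subgroup.closure (F' : Set G),
        σ x ∈ Subgroup.closure ((F ∪ F'.image σ : Finset G) : Set G) := fun x hx =>
      Subgroup.closure_mono s2 (conj_mem_closure d _ hx)
    refine ⟨d * d', f.mul (f'.map σ), F ∪ F'.image σ, ?_, ⟨?_, ?_⟩, ?_, ?_⟩
    · simp only [cplx, hc, hc', cplx_map]
    · exact ha.mono (Subgroup.closure_mono s1)
    · exact ha'.map s3
    · intro D _ ρ
      simp only [eval, hv D ρ, hv' D ρ, σ_def, eval_conj, map_mul]
      simp only [mul_assoc]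
      rw [inv_mul_cancel_left₀ (ρ.grp_ne_zero d)]
    · rintro τ hτ n ⟨i, j, rfl, hi, hj⟩
      have t1 := hh τ (fun x hx y hy => hτ x (Subgroup.closure_mono s1 hx) y
        (Subgroup.closure_mono s1 hy)) i hi
      have t2 := hh' (τ ∘ σ) (fun x hx y hy => by
        rw [Function.comp, Function.comp, Function.comp, ← hτ _ (s3 x hx) _ (s3 y hy)]
        congr 1
        simp [σ_def, mul_assoc]) j ((homog_map _ _ _ _).1 hj)
      refine ⟨by rw [t1.1, t2.1, add_zero], fun x hx => ?_⟩
      simp only [Finset.mem_union, Finset.mem_image] at hx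
      rcases hx with hx | ⟨y, hy, rfl⟩
      · exact t1.2 x hx
      · exact t2.2 y hy
  | inv e ih =>
    obtain ⟨d, f, F, hc, ha, hv, hh⟩ := ih
    set σ : G → G := fun x => d⁻¹ * x * d⁻¹⁻¹ with σ_def
    have s3 : ∀ x ∈ Subgroup.closure (F : Set G),
        σ x ∈ Subgroup.closure ((F.image σ : Finset G) : Set G) := fun x hx => by
      rw [Finset.coe_image]; exact conj_mem_closure d⁻¹ _ hx
    refine ⟨d⁻¹, (f.map σ).inv, F.image σ, ?_, ha.map s3, ?_, ?_⟩
    · simp only [cplx, hc, cplx_map]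
    · intro D _ ρ
      simp only [eval, hv D ρ, σ_def, eval_conj]
      simp only [Ring.inverse_eq_inv', mul_inv_rev, ρ.grp_inv, inv_inv]
      simp only [mul_assoc]
      rw [mul_inv_cancel₀ (ρ.grp_ne_zero d), mul_one]
    · intro τ hτ n hn
      have t2 := hh (τ ∘ σ) (fun x hx y hy => by
        rw [Function.comp, Function.comp, Function.comp, ← hτ _ (s3 x hx) _ (s3 y hy)]
        congr 1
        simp [σ_def, mul_assoc]) (-n) ((homog_map _ _ _ _).1 hn)
      refine ⟨by lia, fun x hx => ?_⟩
      obtain ⟨y, hy, rfl⟩ := Finset.mem_image.1 hx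
      exact t2.2 y hy

end

end HughesFree

namespace HughesFree

section

open RExpr

lemma coeff_single_ite {R : Type*} [Zero R] (i j : ℤ) (a : R) :
    (HahnSeries.single i a).coeff j = if j = i then a else 0 := by
  split_ifs with h
  · rw [h, HahnSeries.coeff_single_same]
  · rw [HahnSeries.coeff_single_of_ne h]

section Ore

variable {D : Type*} [DivisionRing D] (L : Subring D) (T : D)

/-- The monomials `a T ^ i`, together with the corresponding Laurent monomials. -/
noncomputable def monomialPairs (hT : T ≠ 0) (hc : ∀ i : ℤ, ∀ a ∈ L, T ^ i * a * T ^ (-i) ∈ L) :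
    Submonoid (D × HahnSeries ℤ D) where
  carrier := {p | ∃ i : ℤ, ∃ a ∈ L, p = (a * T ^ i, HahnSeries.single i (a * T ^ i))}
  one_mem' := ⟨0, 1, L.one_mem, by simp; rfl⟩
  mul_mem' := by
    rintro _ _ ⟨i, a, ha, rfl⟩ ⟨j, b, hb, rfl⟩
    have key : a * (T ^ i * b * T ^ (-i)) * T ^ (i + j) = a * T ^ i * (b * T ^ j) := by
      rw [zpow_add₀ hT, zpow_neg]
      simp only [mul_assoc]
      rw [inv_mul_cancel_left₀ (zpow_ne_zero i hT)]
    refine ⟨i + j, a * (T ^ i * b * T ^ (-i)), L.mul_mem ha (hc i b hb), ?_⟩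
    rw [Prod.mk_mul_mk, HahnSeries.single_mul_single, key]

variable {L T} (hT : T ≠ 0) (hc : ∀ i : ℤ, ∀ a ∈ L, T ^ i * a * T ^ (-i) ∈ L)

/-- The skew Laurent polynomials, evaluated in `D` and in Laurent series. -/
noncomputable def polyPairs : Subring (D × HahnSeries ℤ D) :=
  Subring.closure (monomialPairs L T hT hc)

lemma monomial_mem_polyPairs (i : ℤ) {a : D} (ha : a ∈ L) :
    (a * T ^ i, HahnSeries.single i (a * T ^ i)) ∈ polyPairs hT hc :=
  Subring.subset_closure ⟨i, a, ha, rfl⟩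

lemma exists_finsupp_of_mem_polyPairs {p : D × HahnSeries ℤ D}
    (hp : p ∈ polyPairs hT hc) :
    ∃ c : ℤ →₀ D, (∀ i, c i ∈ L) ∧ p.1 = c.sum (fun i a => a * T ^ i) ∧
      ∀ i, p.2.coeff i = c i * T ^ i := by
  classical
  rw [polyPairs, Subring.mem_closure_iff, Submonoid.closure_eq] at hp
  induction hp using AddSubgroup.closure_induction with
  | mem x hx =>
    obtain ⟨i, a, ha, rfl⟩ := hx
    refine ⟨Finsupp.single i a, fun j => ?_, by simp, fun j => ?_⟩
    · rw [Finsupp.single_apply]; split_ifs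
      exacts [ha, L.zero_mem]
    · rw [Finsupp.single_apply, coeff_single_ite]
      rcases eq_or_ne i j with rfl | h
      · simp
      · simp [h, Ne.symm h]
  | zero => exact ⟨0, fun _ => L.zero_mem, by simp, by simp⟩
  | add x y _ _ hx hy =>
    obtain ⟨c, h1, h2, h3⟩ := hx
    obtain ⟨c', h1', h2', h3'⟩ := hy
    refine ⟨c + c', fun i => L.add_mem (h1 i) (h1' i), ?_, fun i => ?_⟩
    · rw [Finsupp.sum_add_index' (by simp) (by intros; rw [add_mul]), Prod.fst_add, h2, h2']
    · simp [h3, h3', add_mul]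
  | neg x _ hx =>
    obtain ⟨c, h1, h2, h3⟩ := hx
    refine ⟨-c, fun i => L.neg_mem (h1 i), ?_, fun i => by simp [h3]⟩
    rw [Finsupp.sum_neg_index (by simp), Prod.fst_neg, h2, Finsupp.sum, Finsupp.sum,
      ← Finset.sum_neg_distrib]
    simp

/-- Left independence of the powers of `T` over `L`. -/
def PowIndep (L : Subring D) (T : D) : Prop :=
  ∀ c : ℤ →₀ D, (∀ i, c i ∈ L) → c.sum (fun i a => a * T ^ i) = 0 → c = 0

variable (hind : PowIndep L T)
include hind

lemma polyPairs_fst_ne_zero {p : D × HahnSeries ℤ D} (hp : p ∈ polyPairs hT hc) (h0 : p ≠ 0) :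
    p.1 ≠ 0 := by
  obtain ⟨c, h1, h2, h3⟩ := exists_finsupp_of_mem_polyPairs hT hc hp
  intro h
  have : c = 0 := hind c h1 (by rw [← h2, h])
  apply h0
  refine Prod.ext h ?_
  ext i
  simp [h3, this]

lemma polyPairs_snd_ne_zero {p : D × HahnSeries ℤ D} (hp : p ∈ polyPairs hT hc) (h0 : p ≠ 0) :
    p.2 ≠ 0 := by
  obtain ⟨c, h1, h2, h3⟩ := exists_finsupp_of_mem_polyPairs hT hc hp
  intro h
  have : c = 0 := by
    ext i
    have := h3 i
    rw [h, HahnSeries.coeff_zero, zero_eq_mul] at this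
    exact this.resolve_right (zpow_ne_zero i hT)
  apply polyPairs_fst_ne_zero hT hc hind hp h0
  rw [h2, this]; simp

lemma polyPairs_mul_ne_zero {p q : D × HahnSeries ℤ D} (hp : p ∈ polyPairs hT hc) (h0 : p ≠ 0)
    (hq : q ∈ polyPairs hT hc) (h0' : q ≠ 0) : p * q ≠ 0 := by
  intro h
  exact mul_ne_zero (polyPairs_fst_ne_zero hT hc hind hp h0)
    (polyPairs_fst_ne_zero hT hc hind hq h0') (congrArg Prod.fst h)

include hT hc in
omit hind in
lemma zpow_smul_mem_span [DecidableEq D] (n m : ℕ) (i : ℤ) (hi : |i| ≤ n) {x : D}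
    (hx : x ∈ Submodule.span L ((Finset.Icc (-m : ℤ) m).image (T ^ ·) : Set D)) :
    T ^ i * x ∈ Submodule.span L
      ((Finset.Icc (-(n + m : ℕ) : ℤ) (n + m : ℕ)).image (T ^ ·) : Set D) := by
  classical
  induction hx using Submodule.span_induction with
  | mem x hx =>
    obtain ⟨j, hj, rfl⟩ := Finset.mem_image.1 (Finset.mem_coe.1 hx)
    apply Submodule.subset_span
    rw [Finset.mem_coe, Finset.mem_image]
    refine ⟨i + j, ?_, by rw [zpow_add₀ hT]⟩
    rw [Finset.mem_Icc] at *
    rw [abs_le] at hi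
    push_cast
    constructor <;> lia
  | zero => simp
  | add x y _ _ hx hy => rw [mul_add]; exact add_mem hx hy
  | smul a x _ hx =>
    have : T ^ i * (a • x) = (⟨_, hc i a a.2⟩ : L) • (T ^ i * x) := by
      rw [Subring.smul_def, Subring.smul_def, smul_eq_mul, smul_eq_mul]
      simp only [mul_assoc, zpow_neg]
      rw [inv_mul_cancel_left₀ (zpow_ne_zero i hT)]
    rw [this]
    exact Submodule.smul_mem _ _ hx

omit hind in
lemma exists_mem_span_of_mem_polyPairs [DecidableEq D] {p : D × HahnSeries ℤ D}
    (hp : p ∈ polyPairs hT hc) :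
    ∃ m : ℕ, ∀ n ≥ m,
      p.1 ∈ Submodule.span L ((Finset.Icc (-n : ℤ) n).image (T ^ ·) : Set D) := by
  obtain ⟨c, h1, h2, h3⟩ := exists_finsupp_of_mem_polyPairs hT hc hp
  refine ⟨c.support.sup Int.natAbs, fun n hn => ?_⟩
  rw [h2]
  refine Submodule.sum_mem _ fun i hi => ?_
  beta_reduce
  have : c i * T ^ i = (⟨c i, h1 i⟩ : L) • T ^ i := rfl
  rw [this]
  refine Submodule.smul_mem _ _ (Submodule.subset_span ?_)
  have := (Finset.le_sup (f := Int.natAbs) hi).trans hn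
  exact Finset.mem_coe.2 (Finset.mem_image.2 ⟨i, by rw [Finset.mem_Icc]; lia, rfl⟩)

omit hind in
lemma exists_ore_relation (hinv : ∀ a ∈ L, a⁻¹ ∈ L) {r q : D × HahnSeries ℤ D}
    (hr : r ∈ polyPairs hT hc)
    (hq : q ∈ polyPairs hT hc) :
    ∃ (n : ℕ) (a b : Finset.Icc (-n : ℤ) n → L), (a ≠ 0 ∨ b ≠ 0) ∧
      (∑ i, (a i : D) * T ^ (i : ℤ)) * r.1 = (∑ i, (b i : D) * T ^ (i : ℤ)) * q.1 := by
  classical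
  let _ : DivisionRing L := by
    refine DivisionRing.ofIsUnitOrEqZero fun a => ?_
    by_cases h : a = 0
    · exact Or.inr h
    · left
      have h' : (a : D) ≠ 0 := by simpa using h
      exact ⟨⟨a, ⟨a⁻¹, hinv a a.2⟩, Subtype.ext (mul_inv_cancel₀ h'),
        Subtype.ext (inv_mul_cancel₀ h')⟩, rfl⟩
  obtain ⟨m₁, h₁⟩ := exists_mem_span_of_mem_polyPairs hT hc hr
  obtain ⟨m₂, h₂⟩ := exists_mem_span_of_mem_polyPairs hT hc hq
  set n := max m₁ m₂ with hn
  let U : Submodule L D :=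
    Submodule.span L ((Finset.Icc (-(n + n : ℕ) : ℤ) (n + n : ℕ)).image (T ^ ·) : Set D)
  have hi : ∀ i : Finset.Icc (-n : ℤ) n, |(i : ℤ)| ≤ n := fun i => by
    have := Finset.mem_Icc.1 i.2
    rw [abs_le]; exact this
  let v : Finset.Icc (-n : ℤ) n ⊕ Finset.Icc (-n : ℤ) n → U := Sum.elim
    (fun i => ⟨T ^ (i : ℤ) * r.1, zpow_smul_mem_span hT hc n n i (hi i) (h₁ n (le_max_left _ _))⟩)
    (fun i => ⟨T ^ (i : ℤ) * q.1, zpow_smul_mem_span hT hc n n i (hi i) (h₂ n (le_max_right _ _))⟩)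
  have hv : ¬ LinearIndependent L v := by
    intro hv
    have hfin : Module.Finite L U := Module.Finite.span_of_finite L (Finset.finite_toSet _)
    have e1 := hv.fintype_card_le_finrank
    have e2 : Module.finrank L U ≤ _ := finrank_span_finset_le_card (R := L)
      ((Finset.Icc (-(n + n : ℕ) : ℤ) (n + n : ℕ)).image (T ^ ·))
    have e3 := e2.trans Finset.card_image_le
    rw [Fintype.card_sum, Fintype.card_coe, Int.card_Icc] at e1
    rw [Int.card_Icc] at e3
    lia
  rw [Fintype.not_linearIndependent_iff] at hv
  obtain ⟨g, hg, x, hx⟩ := hv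
  refine ⟨n, fun i => g (Sum.inl i), fun i => -g (Sum.inr i), ?_, ?_⟩
  · rcases x with x | x
    · exact Or.inl fun h => hx (congrFun h x)
    · exact Or.inr fun h => hx (by simpa using congrFun h x)
  · have := congrArg Subtype.val hg
    simp only [Fintype.sum_sum_type, v, Sum.elim_inl, Sum.elim_inr, Submodule.coe_add,
      Submodule.coe_sum, Submodule.coe_smul, Subring.smul_def, smul_eq_mul,
      Submodule.coe_zero] at this
    simp only [Finset.sum_mul, mul_assoc, Subring.coe_neg, neg_mul, Finset.sum_neg_distrib]
    exact eq_neg_of_add_eq_zero_left this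

lemma exists_ore (hinv : ∀ a ∈ L, a⁻¹ ∈ L) {r q : D × HahnSeries ℤ D}
    (hr : r ∈ polyPairs hT hc) (hq : q ∈ polyPairs hT hc) (h0 : q ≠ 0) :
    ∃ a ∈ polyPairs hT hc, ∃ b ∈ polyPairs hT hc, a ≠ 0 ∧ a * r = b * q := by
  classical
  obtain ⟨n, a, b, hab, h⟩ := exists_ore_relation hT hc hinv hr hq
  let S : (Finset.Icc (-n : ℤ) n → L) → D × HahnSeries ℤ D := fun a =>
    ∑ i, ((a i : D) * T ^ (i : ℤ), HahnSeries.single (i : ℤ) ((a i : D) * T ^ (i : ℤ)))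
  have hS : ∀ a, S a ∈ polyPairs hT hc := fun a =>
    Subring.sum_mem _ fun i _ => monomial_mem_polyPairs hT hc i (a i).2
  have hS1 : ∀ a, (S a).1 = ∑ i, (a i : D) * T ^ (i : ℤ) := fun a => by
    simp only [S, Prod.fst_sum]
  have hS0 : ∀ a, S a = 0 → a = 0 := fun a h => by
    funext i
    have h2 : (S a).2.coeff i = 0 := by rw [h]; simp
    simp only [S, Prod.snd_sum, HahnSeries.coeff_sum, coeff_single_ite] at h2
    rw [Finset.sum_eq_single i (fun j _ hj => if_neg (fun h => hj (Subtype.ext h.symm))) (by simp),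
      if_pos rfl, mul_eq_zero] at h2
    exact Subtype.ext (h2.resolve_right (zpow_ne_zero _ hT))
  have hrel : S a * r = S b * q := by
    by_contra hne
    refine polyPairs_fst_ne_zero hT hc hind (p := S a * r - S b * q) ?_ (sub_ne_zero.2 hne) ?_
    · exact sub_mem (mul_mem (hS a) hr) (mul_mem (hS b) hq)
    · rw [Prod.fst_sub, Prod.fst_mul, Prod.fst_mul, hS1, hS1, h, sub_self]
  refine ⟨S a, hS a, S b, hS b, fun ha => ?_, hrel⟩
  have hb : S b = 0 := by
    by_contra hb
    exact polyPairs_mul_ne_zero hT hc hind (hS b) hb hq h0 (by rw [← hrel, ha, zero_mul])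
  exact hab.elim (fun h => h (hS0 a ha)) (fun h => h (hS0 b hb))

omit hind in
/-- The pairs that are left fractions of skew Laurent polynomials. -/
def IsFracPair (p : D × HahnSeries ℤ D) : Prop :=
  ∃ q ∈ polyPairs hT hc, q ≠ 0 ∧ q * p ∈ polyPairs hT hc

variable {hT hc}

omit hind in
lemma isFracPair_of_mem {p : D × HahnSeries ℤ D}
    (hp : p ∈ polyPairs hT hc) :
    IsFracPair hT hc p :=
  ⟨1, one_mem _, one_ne_zero, by rwa [one_mul]⟩

lemma IsFracPair.iff {p : D × HahnSeries ℤ D} (hp : IsFracPair hT hc p) : p.1 = 0 ↔ p.2 = 0 := by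
  obtain ⟨q, hq, h0, hqp⟩ := hp
  have h1 := polyPairs_fst_ne_zero hT hc hind hq h0
  have h2 := (laurent_isUnit_or_eq_zero q.2).resolve_right (polyPairs_snd_ne_zero hT hc hind hq h0)
  constructor
  · intro h
    have : q * p = 0 := by
      by_contra hne
      exact polyPairs_fst_ne_zero hT hc hind hqp hne (by simp [h])
    have := congrArg Prod.snd this
    exact (h2.mul_right_eq_zero).1 this
  · intro h
    have : q * p = 0 := by
      by_contra hne
      exact polyPairs_snd_ne_zero hT hc hind hqp hne (by simp [h])
    have := congrArg Prod.fst this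
    exact (mul_eq_zero.1 this).resolve_left h1

lemma IsFracPair.add (hinv : ∀ a ∈ L, a⁻¹ ∈ L) {p p' : D × HahnSeries ℤ D}
    (hp : IsFracPair hT hc p) (hp' : IsFracPair hT hc p') : IsFracPair hT hc (p + p') := by
  obtain ⟨q, hq, h0, hqp⟩ := hp
  obtain ⟨q', hq', h0', hqp'⟩ := hp'
  obtain ⟨a, ha, b, hb, ha0, h⟩ := exists_ore hT hc hind hinv hq hq' h0'
  refine ⟨a * q, mul_mem ha hq, polyPairs_mul_ne_zero hT hc hind ha ha0 hq h0, ?_⟩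
  have : a * q * (p + p') = a * (q * p) + b * (q' * p') := by
    rw [mul_add, mul_assoc, h, mul_assoc]
  rw [this]
  exact add_mem (mul_mem ha hqp) (mul_mem hb hqp')

lemma IsFracPair.mul (hinv : ∀ a ∈ L, a⁻¹ ∈ L) {p p' : D × HahnSeries ℤ D}
    (hp : IsFracPair hT hc p) (hp' : IsFracPair hT hc p') : IsFracPair hT hc (p * p') := by
  obtain ⟨q, hq, h0, hqp⟩ := hp
  obtain ⟨q', hq', h0', hqp'⟩ := hp'
  obtain ⟨a, ha, b, hb, ha0, h⟩ := exists_ore hT hc hind hinv hqp hq' h0'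
  refine ⟨a * q, mul_mem ha hq, polyPairs_mul_ne_zero hT hc hind ha ha0 hq h0, ?_⟩
  have : a * q * (p * p') = b * (q' * p') := by
    rw [← mul_assoc b, ← h]; simp only [mul_assoc]
  rw [this]
  exact mul_mem hb hqp'

lemma IsFracPair.inv {p : D × HahnSeries ℤ D} (hp : IsFracPair hT hc p) :
    IsFracPair hT hc (Ring.inverse p.1, Ring.inverse p.2) := by
  have hiff := hp.iff hind
  obtain ⟨q, hq, h0, hqp⟩ := hp
  by_cases h : p.1 = 0
  · rw [h, hiff.1 h, Ring.inverse_zero, Ring.inverse_zero]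
    exact isFracPair_of_mem (zero_mem _)
  · have h2 := (laurent_isUnit_or_eq_zero p.2).resolve_right (fun h' => h (hiff.2 h'))
    refine ⟨q * p, hqp, fun h' => ?_, ?_⟩
    · exact mul_ne_zero (polyPairs_fst_ne_zero hT hc hind hq h0) h (congrArg Prod.fst h')
    · have : p * (Ring.inverse p.1, Ring.inverse p.2) = 1 :=
        Prod.ext (Ring.mul_inverse_cancel _ (isUnit_iff_ne_zero.2 h))
          (Ring.mul_inverse_cancel _ h2)
      rw [mul_assoc, this, mul_one]
      exact hq

variable (hT hc)

theorem isFracPair_eval {k G : Type*} (hinv : ∀ a ∈ L, a⁻¹ ∈ L) (v : k → G → D) (τ : G → ℤ)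
    (S : Set G) (hS : ∀ c, ∀ g ∈ S, v c g * T ^ (-τ g) ∈ L) (e : RExpr k G) (he : AtomsIn S e) :
    IsFracPair hT hc (eval v e, leval v τ e) := by
  induction e with
  | atom c g =>
    have := monomial_mem_polyPairs hT hc (τ g) (hS c g he)
    rw [mul_assoc, ← zpow_add₀ hT, neg_add_cancel, zpow_zero, mul_one] at this
    exact isFracPair_of_mem this
  | add e e' ih ih' => exact (ih he.1).add hind hinv (ih' he.2)
  | mul e e' ih ih' => exact (ih he.1).mul hind hinv (ih' he.2)
  | inv e ih => exact (ih he).inv hind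

end Ore

end

end HughesFree

namespace HughesFree

section

open RExpr

lemma subgroup_fg_map {G G' : Type*} [Group G] [Group G'] {H : Subgroup G} (hH : H.FG)
    (f : G →* G') : (H.map f).FG := by
  classical
  obtain ⟨S, rfl⟩ := hH
  exact ⟨S.image f, by rw [Finset.coe_image, MonoidHom.map_closure]⟩

section Hughes

variable {k G D : Type*} [DivisionRing k] [Group G] [DivisionRing D]

lemma ringZPow_eq_zpow (x : D) (i : ℤ) : ringZPow x i = x ^ i := by
  rw [ringZPow]
  split_ifs with h
  · rw [← zpow_natCast, Int.toNat_of_nonneg h]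
  · rw [Ring.inverse_eq_inv', ← zpow_natCast, Int.toNat_of_nonneg (by lia), inv_zpow, zpow_neg,
      inv_inv]

lemma inv_mem_divisionClosure {s : Set D} {a : D} (ha : a ∈ divisionClosure s) :
    a⁻¹ ∈ divisionClosure s := by
  rcases eq_or_ne a 0 with rfl | h0
  · rwa [inv_zero]
  · refine Subring.mem_sInf.2 fun S hS => ?_
    obtain ⟨y, hy, h1, -⟩ := hS.1 a (Subring.mem_sInf.1 ha S hS) h0
    rwa [inv_eq_of_mul_eq_one_right h1]

/-- Conjugation by a nonzero element, as a ring homomorphism. -/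
def conjHom (u : D) (hu : u ≠ 0) : D →+* D where
  toFun x := u * x * u⁻¹
  map_one' := by simp [hu]
  map_zero' := by simp
  map_add' x y := by rw [mul_add, add_mul]
  map_mul' x y := by
    simp only [mul_assoc]
    rw [inv_mul_cancel_left₀ hu]

lemma conj_mem_divisionClosure {s : Set D} {u : D} (hu : u ≠ 0)
    (h : ∀ a ∈ s, u * a * u⁻¹ ∈ divisionClosure s) {a : D} (ha : a ∈ divisionClosure s) :
    u * a * u⁻¹ ∈ divisionClosure s := by
  refine Subring.mem_sInf.1 ha ((divisionClosure s).comap (conjHom u hu)) ⟨?_, h⟩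
  intro x hx h0
  refine ⟨x⁻¹, ?_, mul_inv_cancel₀ h0, inv_mul_cancel₀ h0⟩
  rw [Subring.mem_comap, map_inv₀]
  exact inv_mem_divisionClosure hx

/-- The coefficient representation attached to a homomorphism from a group algebra. -/
noncomputable def algRep {D : Type*} [Ring D] (φ : MonoidAlgebra k G →+* D) : CoeffRep k G D where
  scalar := φ.comp MonoidAlgebra.singleOneRingHom
  grp := (φ : MonoidAlgebra k G →* D).comp (MonoidAlgebra.of k G)
  comm c g := by
    simp [← map_mul, MonoidAlgebra.single_mul_single]

lemma algRep_val {D : Type*} [Ring D] (φ : MonoidAlgebra k G →+* D) (c : k) (g : G) :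
    (algRep φ).val c g = φ (MonoidAlgebra.single g c) := by
  simp [algRep, CoeffRep.val, ← map_mul, MonoidAlgebra.single_mul_single]

/-- Vanishing of rational expressions over a finitely generated subgroup is detected by the
Laurent expansion along any degree map onto `ℤ`. -/
def HasExpansions (ρ : CoeffRep k G D) : Prop :=
  ∀ H : Subgroup G, H.FG → ∀ τ : G → ℤ, AddOn τ H → (∃ h ∈ H, τ h = 1) →
    ∀ e : RExpr k G, AtomsIn H e → (eval ρ.val e = 0 ↔ leval ρ.val τ e = 0)

theorem hasExpansions_algRep {φ : MonoidAlgebra k G →+* D} (hφ : IsHughesFreeEmbedding φ) :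
    HasExpansions (algRep φ) := by
  intro H hH τ hτ ⟨t, ht, hτt⟩ e he
  let F : H →* Multiplicative ℤ :=
    { toFun := fun x => Multiplicative.ofAdd (τ x)
      map_one' := by
        rw [Subgroup.coe_one, hτ.one]; rfl
      map_mul' := fun x y => by
        rw [Subgroup.coe_mul, hτ _ x.2 _ y.2, ofAdd_add] }
  have hFt : F ⟨t, ht⟩ = Multiplicative.ofAdd 1 := by
    show Multiplicative.ofAdd (τ t) = _
    rw [hτt]
  have hF : Function.Surjective F := fun n => by
    refine ⟨⟨t, ht⟩ ^ n.toAdd, ?_⟩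
    rw [map_zpow, hFt, ← ofAdd_zsmul]
    simp
  have hcond := hφ.2.2 H hH F.ker ⟨t, ht⟩ ⟨F, hF, rfl, hFt⟩
  set X : Set D :=
    Set.range (φ.comp (MonoidAlgebra.mapDomainRingHom k (H.subtype.comp F.ker.subtype))) with hX
  set T : D := φ (MonoidAlgebra.of k G t) with hT_def
  have hTz : ∀ i : ℤ, T ^ i = φ (MonoidAlgebra.single (t ^ i) 1) := fun i => by
    have : (algRep φ).grp (t ^ i) = (algRep φ).grp t ^ i := map_zpow' _ (algRep φ).grp_inv _ _
    exact this.symm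
  have hT : T ≠ 0 := (algRep φ).grp_ne_zero t
  have hmemX : ∀ (g : G) (c : k), g ∈ H → τ g = 0 → φ (MonoidAlgebra.single g c) ∈ X := by
    intro g c hg h0
    refine ⟨MonoidAlgebra.single (⟨⟨g, hg⟩, ?_⟩ : F.ker) c, ?_⟩
    · rw [MonoidHom.mem_ker]
      show Multiplicative.ofAdd (τ g) = 1
      rw [h0]; rfl
    · simp
  have hτz : ∀ i : ℤ, τ (t ^ i) = i := fun i => by
    have := map_zpow F ⟨t, ht⟩ i
    rw [hFt, ← ofAdd_zsmul] at this
    have h2 := congrArg Multiplicative.toAdd this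
    simpa [F] using h2
  have hc : ∀ i : ℤ, ∀ a ∈ divisionClosure X, T ^ i * a * T ^ (-i) ∈ divisionClosure X := by
    intro i a ha
    rw [zpow_neg]
    refine conj_mem_divisionClosure (zpow_ne_zero i hT) ?_ ha
    rintro _ ⟨x, rfl⟩
    rw [← zpow_neg]
    induction x using MonoidAlgebra.induction_linear with
    | zero => simp [zero_mem]
    | add x y hx hy =>
      rw [map_add, mul_add, add_mul]
      exact add_mem hx hy
    | single g c =>
      apply subset_divisionClosure
      have h1 : ((g : H) : G) ∈ H := g.1.2
      have h2 : τ ((g : H) : G) = 0 := congrArg Multiplicative.toAdd (MonoidHom.mem_ker.1 g.2)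
      have hi := H.zpow_mem ht i
      have hi' := H.zpow_mem ht (-i)
      have := hmemX (t ^ i * ((g : H) : G) * t ^ (-i)) c
        (H.mul_mem (H.mul_mem hi h1) hi')
        (by rw [hτ _ (H.mul_mem hi h1) _ hi', hτ _ hi _ h1, hτz, hτz, h2]; ring)
      convert this using 1
      simp [hTz, ← map_mul, MonoidAlgebra.single_mul_single]
  refine (isFracPair_eval hT hc (L := divisionClosure X) ?_
    (fun a ha => inv_mem_divisionClosure ha) _ τ H ?_ e he).iff ?_
  · intro c h1 h2
    exact hcond c h1 (by simp only [ringZPow_eq_zpow]; exact h2)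
  · intro c g hg
    apply subset_divisionClosure
    rw [hTz, algRep_val, ← map_mul, MonoidAlgebra.single_mul_single, mul_one]
    have hi' := H.zpow_mem ht (-τ g)
    exact hmemX _ c (H.mul_mem hg hi') (by rw [hτ _ hg _ hi', hτz]; ring)
  · intro c h1 h2
    exact hcond c h1 (by simp only [ringZPow_eq_zpow]; exact h2)

/-- Restriction of a coefficient representation along a group homomorphism. -/
def CoeffRep.comap {G' D : Type*} [Group G'] [Ring D] (ρ : CoeffRep k G D) (f : G' →* G) :
    CoeffRep k G' D where
  scalar := ρ.scalar
  grp := ρ.grp.comp f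
  comm c g := ρ.comm c (f g)

theorem HasExpansions.comap {G' : Type*} [Group G'] {ρ : CoeffRep k G D} (hρ : HasExpansions ρ)
    (f : G' →* G) (hf : Function.Injective f) : HasExpansions (ρ.comap f) := by
  intro H hH τ hτ ⟨h, hh, h1⟩ e he
  have hext : ∀ x, Function.extend f τ 0 (f x) = τ x := fun x => hf.extend_apply _ _ _
  have key := hρ (H.map f) (subgroup_fg_map hH f) (Function.extend f τ 0) ?_
    ⟨f h, ⟨h, hh, rfl⟩, by rw [hext, h1]⟩
    (e.map f) (AtomsIn.map (S := H) (fun x hx => Subgroup.mem_map_of_mem f hx) he)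
  · rw [leval, eval_map, eval_map] at key
    simp only [hext] at key
    exact key
  · rintro _ ⟨x, hx, rfl⟩ _ ⟨y, hy, rfl⟩
    rw [← map_mul, hext, hext, hext]
    exact hτ x hx y hy

end Hughes

end

end HughesFree

namespace HughesFree

section

open RExpr

section Degree

variable {G : Type*} [Group G]

lemma LocallyIndicable.of_injective {G' : Type*} [Group G'] (hG : LocallyIndicable G)
    (f : G' →* G) (hf : Function.Injective f) : LocallyIndicable G' := by
  intro H hH hfg
  obtain ⟨F, hF⟩ := hG (H.map f) (fun h => hH ((H.map_eq_bot_iff_of_injective hf).1 h))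
    (subgroup_fg_map hfg f)
  refine ⟨F.comp (H.equivMapOfInjective f hf).toMonoidHom, ?_⟩
  exact hF.comp (H.equivMapOfInjective f hf).surjective

lemma exists_degree (hG : LocallyIndicable G) (H : Subgroup G) (hH : H ≠ ⊥) (hfg : H.FG) :
    ∃ τ : G → ℤ, AddOn τ H ∧ ∃ h ∈ H, τ h = 1 := by
  classical
  obtain ⟨F, hF⟩ := hG H hH hfg
  refine ⟨fun x => if h : x ∈ H then (F ⟨x, h⟩).toAdd else 0, fun x hx y hy => ?_, ?_⟩
  · simp only [dif_pos hx, dif_pos hy, dif_pos (H.mul_mem hx hy)]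
    rw [← toAdd_mul, ← map_mul]; rfl
  · obtain ⟨t, ht⟩ := hF (Multiplicative.ofAdd 1)
    exact ⟨t, t.2, by simp [ht]⟩

lemma RExpr.AddOn.eq_zero_of_mem_closure {τ : G → ℤ} {H : Subgroup G} (hτ : AddOn τ H) {S : Set G}
    (hS : S ⊆ H) (h : ∀ x ∈ S, τ x = 0) {x : G} (hx : x ∈ Subgroup.closure S) : τ x = 0 := by
  have hle : Subgroup.closure S ≤ H := (Subgroup.closure_le H).2 hS
  induction hx using Subgroup.closure_induction with
  | mem x hx => exact h x hx
  | one => exact hτ.one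
  | mul x y hx hy h1 h2 => rw [hτ x (hle hx) y (hle hy), h1, h2, add_zero]
  | inv x hx h1 => rw [hτ.inv (hle hx), h1, neg_zero]

end Degree

section Compare

universe w

variable {k C : Type*} {D₁ D₂ : Type w} [DivisionRing k] [Group C] [DivisionRing D₁]
  [DivisionRing D₂]

lemma eval_of_atoms_one {D : Type*} [DivisionRing D] (ρ : CoeffRep k C D) (e : RExpr k C)
    (he : AtomsIn ({1} : Set C) e) :
    eval ρ.val e = ρ.scalar (eval (fun c _ => c) e) := by
  induction e with
  | atom c g =>
    obtain rfl : g = 1 := he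
    simp [eval, CoeffRep.val]
  | add e e' ih ih' => simp only [eval, ih he.1, ih' he.2, map_add]
  | mul e e' ih ih' => simp only [eval, ih he.1, ih' he.2, map_mul]
  | inv e ih => simp only [eval, ih he, Ring.inverse_eq_inv', map_inv₀]

theorem eval_eq_zero_iff (hC : LocallyIndicable C) (ρ₁ : CoeffRep k C D₁) (ρ₂ : CoeffRep k C D₂)
    (h₁ : HasExpansions ρ₁) (h₂ : HasExpansions ρ₂) (e : RExpr k C) :
    eval ρ₁.val e = 0 ↔ eval ρ₂.val e = 0 := by
  induction he : cplx e using WellFoundedLT.induction generalizing e with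
  | ind θ IH =>
  subst he
  obtain ⟨d, e', F, hc, ha, hv, hh⟩ := exists_normalForm.{w} e
  rw [hv _ ρ₁, hv _ ρ₂, mul_eq_zero_iff_right (ρ₁.grp_ne_zero d),
    mul_eq_zero_iff_right (ρ₂.grp_ne_zero d)]
  by_cases hF : Subgroup.closure (F : Set C) = ⊥
  · rw [hF, Subgroup.coe_bot] at ha
    rw [eval_of_atoms_one ρ₁ e' ha, eval_of_atoms_one ρ₂ e' ha, map_eq_zero, map_eq_zero]
  · obtain ⟨τ, hτ, t, ht, hτt⟩ := exists_degree hC _ hF ⟨F, rfl⟩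
    rw [h₁ _ ⟨F, rfl⟩ τ hτ ⟨t, ht, hτt⟩ e' ha, h₂ _ ⟨F, rfl⟩ τ hτ ⟨t, ht, hτt⟩ e' ha]
    have hhom : ∀ m, ¬ Homog τ e' m := fun m hm => by
      have := hτ.eq_zero_of_mem_closure Subgroup.subset_closure (hh τ hτ m hm).2 ht
      lia
    have IH' : ∀ e'' : RExpr k C, cplx e'' < cplx e' →
        (eval ρ₁.val e'' = 0 ↔ eval ρ₂.val e'' = 0) := fun e'' h => IH _ (hc ▸ h) e'' rfl
    have key := (coeffPair_decomposition ρ₁.val_neg_one ρ₂.val_neg_one τ e' IH').2.1 hhom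
    exact eq_zero_iff_of_coeff_iff fun n => (key n).iff IH'

end Compare

section Independence

variable {k A C D : Type*} [DivisionRing k] [Group A] [Group C] [DivisionRing D]

lemma exists_sum_expr {G R ι : Type*} [Group G] [Ring R] (ρ : CoeffRep k G R) (τ : G → ℤ)
    (H : Subgroup G) (s : Finset ι) (E : ι → RExpr k G) (hE : ∀ i ∈ s, AtomsIn H (E i)) :
    ∃ e : RExpr k G, AtomsIn H e ∧ eval ρ.val e = ∑ i ∈ s, eval ρ.val (E i) ∧
      leval ρ.val τ e = ∑ i ∈ s, leval ρ.val τ (E i) := by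
  classical
  induction s using Finset.induction_on with
  | empty =>
    exact ⟨atom 0 1, H.one_mem, by simp [eval, CoeffRep.val],
      by simp [leval, eval, CoeffRep.val]⟩
  | insert j s hj ih =>
    obtain ⟨e, h1, h2, h3⟩ := ih fun i hi => hE i (Finset.mem_insert_of_mem hi)
    refine ⟨(E j).add e, ⟨hE j (Finset.mem_insert_self _ _), h1⟩, ?_, ?_⟩
    · rw [Finset.sum_insert hj, ← h2]; rfl
    · rw [Finset.sum_insert hj, ← h3]; rfl

theorem eq_zero_of_sum_translates (hA : LocallyIndicable A) (ρ : CoeffRep k A D)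
    (hρ : HasExpansions ρ) (f : C →* A) {ι : Type*} [Fintype ι]
    (a : ι → Ordinal.{0}) (x : ι → D) (b : ι → A)
    (hx : ∀ i, InK (ρ.comap f).val (ρ.comap f).val (a i) (x i, x i))
    (hb : ∀ i j, i ≠ j → b i * (b j)⁻¹ ∉ f.range)
    (hsum : ∑ i, x i * ρ.grp (b i) = 0) : ∀ i, x i = 0 := by
  classical
  induction a using WellFoundedLT.induction generalizing x b with
  | ind a IH =>
  by_contra! hne
  obtain ⟨i₀, hi₀⟩ := hne
  have hnf : ∀ i, ∃ (d : C) (e' : RExpr k C) (F : Finset C), (x i ≠ 0 → cplx e' < a i) ∧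
      AtomsIn (Subgroup.closure (F : Set C) : Set C) e' ∧
      (x i ≠ 0 → x i = eval (ρ.comap f).val e' * ρ.grp (f d)) ∧
      ∀ τ : C → ℤ, AddOn τ (Subgroup.closure (F : Set C)) → ∀ n, Homog τ e' n →
        n = 0 ∧ ∀ x ∈ F, τ x = 0 := by
    intro i
    rcases hx i with h | ⟨e, he, hex⟩
    · obtain ⟨d, e', F, -, h2, -, h4⟩ := exists_normalForm.{0} (atom (0 : k) (1 : C))
      have h0 : x i = 0 := congrArg Prod.fst h
      exact ⟨d, e', F, fun h => (h h0).elim, h2, fun h => (h h0).elim, h4⟩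
    · obtain ⟨d, e', F, h1, h2, h3, h4⟩ := exists_normalForm e
      refine ⟨d, e', F, fun _ => h1 ▸ he, h2, fun _ => ?_, h4⟩
      have hx1 : eval _ e = x i := congrArg Prod.fst hex
      rw [← hx1]
      exact h3 _ (ρ.comap f)
  choose d e F hcplx hatoms hval hhom using hnf
  set b' : ι → A := fun i => f (d i) * b i * (f (d i₀) * b i₀)⁻¹ with hb'_def
  have hb'₀ : b' i₀ = 1 := mul_inv_cancel _
  have hb' : ∀ i j, i ≠ j → b' i * (b' j)⁻¹ ∉ f.range := by
    intro i j hij h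
    apply hb i j hij
    have : b i * (b j)⁻¹ = f (d i)⁻¹ * (b' i * (b' j)⁻¹) * f (d j) := by
      simp [hb'_def, mul_assoc]
    rw [this]
    exact mul_mem (mul_mem ⟨_, rfl⟩ h) ⟨_, rfl⟩
  set s : Finset ι := Finset.univ.filter fun i => x i ≠ 0 with hs_def
  have hs : ∀ i, i ∈ s ↔ x i ≠ 0 := fun i => by simp [hs_def]
  set S : Finset A := s.biUnion fun i => insert (b' i) ((F i).image f) with hS_def
  set H := Subgroup.closure (S : Set A) with hH_def
  have hFS : ∀ i ∈ s, ∀ y ∈ F i, f y ∈ S := fun i hi y hy =>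
    Finset.mem_biUnion.2 ⟨i, hi, Finset.mem_insert_of_mem (Finset.mem_image_of_mem _ hy)⟩
  have hbS : ∀ i ∈ s, b' i ∈ S := fun i hi =>
    Finset.mem_biUnion.2 ⟨i, hi, Finset.mem_insert_self _ _⟩
  have hclF : ∀ i ∈ s, ∀ y ∈ Subgroup.closure (F i : Set C), f y ∈ H := by
    intro i hi y hy
    have : Subgroup.closure (F i : Set C) ≤ H.comap f :=
      (Subgroup.closure_le _).2 fun y hy => Subgroup.subset_closure (hFS i hi y hy)
    exact this hy
  have hsum' : ∑ i ∈ s, eval ρ.val ((e i).map f) * ρ.grp (b' i) = 0 := by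
    have h1 : ∀ i ∈ s, eval ρ.val ((e i).map f) * ρ.grp (b' i) =
        x i * ρ.grp (b i) * ρ.grp (f (d i₀) * b i₀)⁻¹ := fun i hi => by
      rw [eval_map, hval i ((hs i).1 hi), hb'_def]
      simp only [map_mul, mul_assoc]; rfl
    rw [Finset.sum_congr rfl h1, ← Finset.sum_mul, hs_def, Finset.sum_filter_of_ne, hsum, zero_mul]
    intro i _ h h'
    exact h (by rw [h', zero_mul])
  by_cases hs1 : ∀ i ∈ s, i = i₀
  · have h1 : s = {i₀} := Finset.eq_singleton_iff_unique_mem.2 ⟨(hs i₀).2 hi₀, hs1⟩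
    rw [h1, Finset.sum_singleton] at hsum'
    have h2 := (mul_eq_zero.1 hsum').resolve_right (ρ.grp_ne_zero _)
    rw [eval_map] at h2
    apply hi₀
    rw [hval i₀ hi₀]
    exact mul_eq_zero_of_left h2 _
  push Not at hs1
  obtain ⟨i₁, hi₁, hne⟩ := hs1
  have hHne : H ≠ ⊥ := by
    intro h
    have : b' i₁ ∈ H := Subgroup.subset_closure (hbS i₁ hi₁)
    rw [h, Subgroup.mem_bot] at this
    apply hb' i₁ i₀ hne
    rw [this, hb'₀, one_mul, inv_one]
    exact one_mem _
  obtain ⟨τ, hτ, t, ht, hτt⟩ := exists_degree hA H hHne ⟨S, rfl⟩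
  have hatomsH : ∀ i ∈ s, AtomsIn H ((e i).map f) := fun i hi =>
    AtomsIn.map (hclF i hi) (hatoms i)
  obtain ⟨E, hE, hE1, hE2⟩ := exists_sum_expr ρ τ H s
    (fun i => ((e i).map f).mul (atom 1 (b' i)))
    (fun i hi => ⟨hatomsH i hi, Subgroup.subset_closure (hbS i hi)⟩)
  have hz : leval ρ.val τ E = 0 := by
    rw [← hρ H ⟨S, rfl⟩ τ hτ ⟨t, ht, hτt⟩ E hE, hE1, ← hsum']
    refine Finset.sum_congr rfl fun i _ => ?_
    simp [eval, CoeffRep.val]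
  have hl : ∀ i, leval ρ.val τ ((e i).map f) = leval (ρ.comap f).val (τ ∘ f) (e i) := fun i => by
    rw [leval, eval_map]; rfl
  have hdec := fun i => coeffPair_decomposition (ρ.comap f).val_neg_one (ρ.comap f).val_neg_one
    (τ ∘ f) (e i) (fun _ _ => Iff.rfl)
  set c : ι → ℤ → D := fun i n => (leval (ρ.comap f).val (τ ∘ f) (e i)).coeff n with hc_def
  have hcoeff : ∀ N, ∑ i ∈ s, c i (N - τ (b' i)) * ρ.grp (b' i) = 0 := by
    intro N
    have h1 := congrArg (fun y : HahnSeries ℤ D => y.coeff N) (hE2.symm.trans hz)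
    simp only [HahnSeries.coeff_sum, HahnSeries.coeff_zero] at h1
    rw [← h1]
    refine Finset.sum_congr rfl fun i _ => ?_
    have : leval ρ.val τ (((e i).map f).mul (atom 1 (b' i))) =
        leval (ρ.comap f).val (τ ∘ f) (e i) * HahnSeries.single (τ (b' i)) (ρ.grp (b' i)) := by
      rw [← hl]
      simp [leval, eval, CoeffRep.val]
    rw [this, HahnSeries.coeff_mul_single]
  have hzero : ∀ N, ∀ i ∈ s, c i (N - τ (b' i)) = 0 := by
    intro N
    have hex : ∃ j ∈ s, ∃ θ < a j, InK (ρ.comap f).val (ρ.comap f).val θ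
        (c j (N - τ (b' j)), c j (N - τ (b' j))) := by
      by_cases hall : ∀ i ∈ s, ∃ m, Homog (τ ∘ f) (e i) m
      · have hadd : ∀ i ∈ s, AddOn (τ ∘ f) (Subgroup.closure (F i : Set C)) := by
          intro i hi y hy z hz
          rw [Function.comp, Function.comp, Function.comp, map_mul,
            hτ _ (hclF i hi y hy) _ (hclF i hi z hz)]
        have hdeg : ∀ i ∈ s, Homog (τ ∘ f) (e i) 0 ∧ ∀ y ∈ F i, τ (f y) = 0 := by
          intro i hi
          obtain ⟨m, hm⟩ := hall i hi
          obtain ⟨rfl, h2⟩ := hhom i _ (hadd i hi) m hm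
          exact ⟨hm, h2⟩
        obtain ⟨j, hj, hjN⟩ : ∃ j ∈ s, N - τ (b' j) ≠ 0 := by
          by_contra! hcon
          have hN : N = 0 := by
            have := hcon i₀ ((hs i₀).2 hi₀)
            rw [hb'₀, hτ.one] at this
            lia
          have := hτ.eq_zero_of_mem_closure (S := S) Subgroup.subset_closure ?_ ht
          · lia
          · intro y hy
            obtain ⟨i, hi, hy⟩ := Finset.mem_biUnion.1 (Finset.mem_coe.1 hy)
            rcases Finset.mem_insert.1 hy with rfl | hy
            · have := hcon i hi
              lia
            · obtain ⟨z, hz, rfl⟩ := Finset.mem_image.1 hy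
              exact (hdeg i hi).2 z hz
        refine ⟨j, hj, 0, lt_of_le_of_lt zero_le (hcplx j ((hs j).1 hj)), Or.inl ?_⟩
        exact (hdec j).2.2 0 (hdeg j hj).1 _ hjN
      · push Not at hall
        obtain ⟨j, hj, hjm⟩ := hall
        exact ⟨j, hj, cplx (e j), hcplx j ((hs j).1 hj), (hdec j).2.1 hjm _⟩
    obtain ⟨j, hj, θ, hθ, hjθ⟩ := hex
    have key := IH (Function.update a j θ) (update_lt_self_iff.2 hθ)
      (fun i => if i ∈ s then c i (N - τ (b' i)) else 0) b' ?_ hb' ?_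
    · intro i hi
      simpa [hi] using key i
    · intro i
      split_ifs with hi
      · rcases eq_or_ne i j with rfl | hij
        · rwa [Function.update_self]
        · rw [Function.update_of_ne hij]
          exact ((hdec i).1 _).mono (Order.succ_le_of_lt (hcplx i ((hs i).1 hi)))
      · exact Or.inl rfl
    · simp only [ite_mul, zero_mul]
      rw [Finset.sum_ite_mem, Finset.univ_inter, hcoeff N]
  apply hi₀
  rw [hval i₀ hi₀]
  refine mul_eq_zero_of_left ?_ _
  have := (hρ H ⟨S, rfl⟩ τ hτ ⟨t, ht, hτt⟩ _ (hatomsH i₀ ((hs i₀).2 hi₀))).2 ?_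
  · rw [eval_map] at this; exact this
  · rw [hl]
    ext n
    have := hzero (n + τ (b' i₀)) i₀ ((hs i₀).2 hi₀)
    rwa [add_sub_cancel_right] at this

end Independence

end

end HughesFree

namespace HughesFree

section

section Finrank

variable {K M N : Type*} [DivisionRing K] [AddCommGroup M] [Module K M]
  [AddCommGroup N] [Module K N]

lemma fg_of_le {X Y : Submodule K M} (hY : Y.FG) (h : X ≤ Y) : X.FG := by
  have : FiniteDimensional K Y := Module.Finite.iff_fg.2 hY
  exact Module.Finite.iff_fg.1 (Submodule.finiteDimensional_of_le h)

lemma finrank_mono_of_fg {X Y : Submodule K M} (hY : Y.FG) (h : X ≤ Y) :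
    Module.finrank K X ≤ Module.finrank K Y := by
  have : FiniteDimensional K Y := Module.Finite.iff_fg.2 hY
  exact Submodule.finrank_mono h

lemma eq_of_le_of_finrank_le_of_fg {X Y : Submodule K M} (hY : Y.FG) (h : X ≤ Y)
    (hle : Module.finrank K Y ≤ Module.finrank K X) : X = Y := by
  have : FiniteDimensional K Y := Module.Finite.iff_fg.2 hY
  exact Submodule.eq_of_le_of_finrank_le h hle

lemma finrank_lt_of_lt_of_fg {X Y : Submodule K M} (hY : Y.FG) (h : X < Y) :
    Module.finrank K X < Module.finrank K Y := by
  have : FiniteDimensional K Y := Module.Finite.iff_fg.2 hY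
  exact Submodule.finrank_lt_finrank_of_lt h

lemma eq_bot_of_finrank_eq_zero {X : Submodule K M} (hX : X.FG) (h : Module.finrank K X = 0) :
    X = ⊥ :=
  (eq_of_le_of_finrank_le_of_fg hX bot_le (by rw [h]; exact zero_le)).symm

lemma finrank_map_add_finrank_inf_ker {X : Submodule K M} (hX : X.FG) (f : M →ₗ[K] N) :
    Module.finrank K (X.map f) + Module.finrank K (X ⊓ LinearMap.ker f : Submodule K M) =
      Module.finrank K X := by
  have : FiniteDimensional K X := Module.Finite.iff_fg.2 hX
  have h := LinearMap.finrank_range_add_finrank_ker (f.domRestrict X)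
  rw [LinearMap.range_domRestrict] at h
  have h2 : X ⊓ LinearMap.ker f = (LinearMap.ker (f.domRestrict X)).map X.subtype := by
    ext x
    simp only [Submodule.mem_inf, Submodule.mem_map, LinearMap.mem_ker, Submodule.coe_subtype,
      Subtype.exists, exists_and_right, exists_eq_right, LinearMap.domRestrict_apply]
    constructor
    · rintro ⟨h1, h2⟩; exact ⟨h1, h2⟩
    · rintro ⟨h1, h2⟩; exact ⟨h1, h2⟩
  rw [← h, ← Submodule.finrank_map_subtype_eq X (LinearMap.ker (f.domRestrict X)), h2]

lemma finrank_sup_map_add {B : Submodule K M} (hB : B.FG) {Z : Submodule K N} (hZ : Z.FG)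
    (f : M →ₗ[K] N) :
    Module.finrank K (Z ⊔ B.map f : Submodule K N) +
      Module.finrank K (B ⊓ Z.comap f : Submodule K M) =
    Module.finrank K Z + Module.finrank K B := by
  have : FiniteDimensional K Z := Module.Finite.iff_fg.2 hZ
  have : FiniteDimensional K (B.map f) := Module.Finite.iff_fg.2 (hB.map f)
  have h1 := Submodule.finrank_sup_add_finrank_inf_eq Z (B.map f)
  have h2 := finrank_map_add_finrank_inf_ker hB f
  have h3 := finrank_map_add_finrank_inf_ker (fg_of_le hB inf_le_left : (B ⊓ Z.comap f).FG) f
  have h4 : (B ⊓ Z.comap f).map f = Z ⊓ B.map f := by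
    rw [inf_comm Z]; exact Submodule.map_inf_eq_map_inf_comap.symm
  have h5 : B ⊓ Z.comap f ⊓ LinearMap.ker f = B ⊓ LinearMap.ker f := by
    ext x
    simp only [Submodule.mem_inf, Submodule.mem_comap, LinearMap.mem_ker]
    constructor
    · tauto
    · rintro ⟨h, h'⟩
      exact ⟨⟨h, by rw [h']; exact Z.zero_mem⟩, h'⟩
  rw [h4, h5] at h3
  lia

lemma exists_proj (A : Submodule K M) :
    ∃ π : M →ₗ[K] M, (∀ x, π x ∈ A) ∧ (∀ x ∈ A, π x = x) := by
  obtain ⟨g, hg⟩ := A.subtype.exists_leftInverse_of_injective A.ker_subtype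
  refine ⟨A.subtype ∘ₗ g, fun x => (g x).2, fun x hx => ?_⟩
  have := congrArg Subtype.val (LinearMap.congr_fun hg ⟨x, hx⟩)
  exact this

lemma exists_proj_of_disjoint {A B : Submodule K M} (h : Disjoint A B) :
    ∃ q : M →ₗ[K] M, (∀ x ∈ A, q x = x) ∧ (∀ x ∈ B, q x = 0) := by
  obtain ⟨π, h1, h2⟩ := exists_proj B
  have hinj : LinearMap.ker (((1 : M →ₗ[K] M) - π).domRestrict A) = ⊥ := by
    rw [LinearMap.ker_eq_bot']
    intro x hx
    have hx' : (x : M) = π x := sub_eq_zero.1 hx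
    have : (x : M) ∈ A ⊓ B := ⟨x.2, by rw [hx']; exact h1 _⟩
    rw [h.eq_bot] at this
    exact Subtype.ext ((Submodule.mem_bot K).1 this)
  obtain ⟨g, hg⟩ := LinearMap.exists_leftInverse_of_injective _ hinj
  refine ⟨A.subtype ∘ₗ g ∘ₗ ((1 : M →ₗ[K] M) - π), fun x hx => ?_, fun x hx => ?_⟩
  · exact congrArg Subtype.val (LinearMap.congr_fun hg ⟨x, hx⟩)
  · simp [h2 x hx]

end Finrank

section SpanImg

variable {E M M' : Type*} (D : Type*) {V V' : Type*} [DivisionRing E] [DivisionRing D]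
  [AddCommGroup M] [Module E M] [AddCommGroup M'] [Module E M']
  [AddCommGroup V] [Module E V] [Module D V] [AddCommGroup V'] [Module E V'] [Module D V']

/-- The `D`-span of the image of an `E`-subspace. -/
def spanImg (p : M →ₗ[E] V) (W : Submodule E M) : Submodule D V := Submodule.span D (p '' W)

variable {D} {p : M →ₗ[E] V} {W W' : Submodule E M}

lemma mem_spanImg {w : M} (hw : w ∈ W) : p w ∈ spanImg D p W :=
  Submodule.subset_span ⟨w, hw, rfl⟩

lemma spanImg_le_iff {Q : Submodule D V} : spanImg D p W ≤ Q ↔ ∀ w ∈ W, p w ∈ Q := by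
  rw [spanImg, Submodule.span_le, Set.image_subset_iff]
  rfl

lemma spanImg_mono (h : W ≤ W') : spanImg D p W ≤ spanImg D p W' :=
  spanImg_le_iff.2 fun _ hw => mem_spanImg (h hw)

lemma spanImg_sup : spanImg D p (W ⊔ W') = spanImg D p W ⊔ spanImg D p W' := by
  refine le_antisymm (spanImg_le_iff.2 fun w hw => ?_)
    (sup_le (spanImg_mono le_sup_left) (spanImg_mono le_sup_right))
  obtain ⟨a, ha, b, hb, rfl⟩ := Submodule.mem_sup.1 hw
  rw [map_add]
  exact Submodule.add_mem_sup (mem_spanImg ha) (mem_spanImg hb)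

lemma spanImg_map {f : V →ₗ[D] V'} {F : M →ₗ[E] M'} {p' : M' →ₗ[E] V'}
    (h : ∀ m, p' (F m) = f (p m)) : spanImg D p' (W.map F) = (spanImg D p W).map f := by
  rw [spanImg, spanImg, Submodule.map_span, Submodule.map_coe, Set.image_image, Set.image_image]
  simp only [h]

lemma spanImg_span [SMul E D] [IsScalarTower E D V] (S : Set M) :
    spanImg D p (Submodule.span E S) = Submodule.span D (p '' S) := by
  refine le_antisymm (spanImg_le_iff.2 fun w hw => ?_)
    (Submodule.span_mono (Set.image_mono Submodule.subset_span))
  induction hw using Submodule.span_induction with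
  | mem x hx => exact Submodule.subset_span ⟨x, hx, rfl⟩
  | zero => rw [map_zero]; exact zero_mem _
  | add x y _ _ hx hy => rw [map_add]; exact add_mem hx hy
  | smul e x _ hx =>
    rw [map_smul, ← one_smul D (p x), ← smul_assoc]
    exact Submodule.smul_mem _ _ hx

lemma spanImg_fg [SMul E D] [IsScalarTower E D V] (hW : W.FG) : (spanImg D p W).FG := by
  classical
  obtain ⟨S, rfl⟩ := hW
  rw [spanImg_span]
  exact ⟨S.image p, by rw [Finset.coe_image]⟩

end SpanImg

end

end HughesFree

namespace HughesFree

section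

open Module

section PairModules

universe w

variable {E : Type w} (D₁ D₂ : Type w) {V₁ V₂ : Type w} [DivisionRing E] [DivisionRing D₁]
  [DivisionRing D₂] [AddCommGroup V₁] [AddCommGroup V₂] [Module E V₁] [Module E V₂]
  [Module D₁ V₁] [Module D₂ V₂]

/-- The sum of the dimensions of the two coordinate spans of a space of pairs. -/
noncomputable def coordDim (W : Submodule E (V₁ × V₂)) : ℕ :=
  finrank D₁ (spanImg D₁ (LinearMap.fst E V₁ V₂) W) +
    finrank D₂ (spanImg D₂ (LinearMap.snd E V₁ V₂) W)

/-- Every nonzero finite-dimensional subspace has coordinate dimension larger than its own. -/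
def TorsionFree (Γ : Submodule E (V₁ × V₂)) : Prop :=
  ∀ W ≤ Γ, W.FG → W ≠ ⊥ → finrank E W + 1 ≤ coordDim D₁ D₂ W

/-- Every finite-dimensional subspace lies in one containing `γ` that is closed. -/
def IsAlgebraicOver (γ : V₁ × V₂) (Γ : Submodule E (V₁ × V₂)) : Prop :=
  ∀ W ≤ Γ, W.FG → ∃ W' ≤ Γ, W'.FG ∧ W ≤ W' ∧ γ ∈ W' ∧ coordDim D₁ D₂ W' ≤ finrank E W' + 1

variable {D₁ D₂} [SMul E D₁] [SMul E D₂] [IsScalarTower E D₁ V₁] [IsScalarTower E D₂ V₂]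

/-- A pair of linear maps acting on pairs. -/
def pairMap (f₁ : V₁ →ₗ[D₁] V₁) (f₂ : V₂ →ₗ[D₂] V₂) : V₁ × V₂ →ₗ[E] V₁ × V₂ :=
  (f₁.restrictScalars E).prodMap (f₂.restrictScalars E)

@[simp] lemma pairMap_apply (f₁ : V₁ →ₗ[D₁] V₁) (f₂ : V₂ →ₗ[D₂] V₂) (x : V₁ × V₂) :
    pairMap (E := E) f₁ f₂ x = (f₁ x.1, f₂ x.2) := rfl

lemma coordDim_span_singleton_le (x : V₁ × V₂) :
    coordDim D₁ D₂ (Submodule.span E {x}) ≤ 2 := by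
  rw [coordDim, spanImg_span, spanImg_span, Set.image_singleton, Set.image_singleton]
  have h1 := finrank_span_le_card (R := D₁) ({x.1} : Set V₁)
  have h2 := finrank_span_le_card (R := D₂) ({x.2} : Set V₂)
  simp only [Set.toFinset_singleton, Finset.card_singleton] at h1 h2
  exact add_le_add h1 h2

lemma TorsionFree.fst_ne_zero {Γ : Submodule E (V₁ × V₂)} (hΓ : TorsionFree D₁ D₂ Γ)
    {x : V₁ × V₂} (hx : x ∈ Γ) (h0 : x ≠ 0) : x.1 ≠ 0 := by
  intro h
  have := hΓ (Submodule.span E {x}) ((Submodule.span_singleton_le_iff_mem _ _).2 hx)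
    (Submodule.fg_span_singleton x) (by simpa using h0)
  rw [finrank_span_singleton h0, coordDim, spanImg_span, spanImg_span, Set.image_singleton,
    Set.image_singleton] at this
  have h2 := finrank_span_le_card (R := D₂) ({x.2} : Set V₂)
  simp only [Set.toFinset_singleton, Finset.card_singleton] at h2
  have h3 : finrank D₁ (Submodule.span D₁ {x.1}) = 0 := by
    rw [h, Submodule.span_zero_singleton, finrank_bot]
  exact absurd (this.trans (add_le_add h3.le h2)) (by norm_num)

lemma TorsionFree.snd_ne_zero {Γ : Submodule E (V₁ × V₂)} (hΓ : TorsionFree D₁ D₂ Γ)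
    {x : V₁ × V₂} (hx : x ∈ Γ) (h0 : x ≠ 0) : x.2 ≠ 0 := by
  intro h
  have := hΓ (Submodule.span E {x}) ((Submodule.span_singleton_le_iff_mem _ _).2 hx)
    (Submodule.fg_span_singleton x) (by simpa using h0)
  rw [finrank_span_singleton h0, coordDim, spanImg_span, spanImg_span, Set.image_singleton,
    Set.image_singleton] at this
  have h2 := finrank_span_le_card (R := D₁) ({x.1} : Set V₁)
  simp only [Set.toFinset_singleton, Finset.card_singleton] at h2
  have h3 : finrank D₂ (Submodule.span D₂ {x.2}) = 0 := by
    rw [h, Submodule.span_zero_singleton, finrank_bot]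
  exact absurd (this.trans (add_le_add h2 h3.le)) (by norm_num)

lemma finrank_spanImg_ge {M V : Type w} {D : Type w} [DivisionRing D] [AddCommGroup M]
    [AddCommGroup V] [Module E M] [Module E V] [Module D V] [SMul E D]
    [IsScalarTower E D V] {p : M →ₗ[E] V} {f : V →ₗ[D] V} {F : M →ₗ[E] M}
    (h : ∀ m, p (F m) = f (p m)) {W : Submodule E M} (hW : W.FG) :
    finrank D (spanImg D p (W.map F)) +
      finrank D (spanImg D p (W ⊓ LinearMap.ker F : Submodule E M)) ≤
      finrank D (spanImg D p W) := by
  rw [spanImg_map h, ← finrank_map_add_finrank_inf_ker (spanImg_fg hW) f]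
  refine Nat.add_le_add_left (finrank_mono_of_fg (fg_of_le (spanImg_fg hW) inf_le_left) ?_) _
  refine spanImg_le_iff.2 fun w hw => ⟨mem_spanImg hw.1, ?_⟩
  rw [SetLike.mem_coe, LinearMap.mem_ker, ← h, LinearMap.mem_ker.1 hw.2, map_zero]

/-- A pair of linear maps carrying a closed space into a torsion-free one and killing a nonzero
element vanishes on the closed space. -/
lemma TorsionFree.pairMap_eq_zero {Γ : Submodule E (V₁ × V₂)} (hΓ : TorsionFree D₁ D₂ Γ)
    {W : Submodule E (V₁ × V₂)} (hWΓ : W ≤ Γ) (hW : W.FG)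
    (hcl : coordDim D₁ D₂ W ≤ finrank E W + 1) {f₁ : V₁ →ₗ[D₁] V₁} {f₂ : V₂ →ₗ[D₂] V₂}
    (hf : ∀ x ∈ W, pairMap (E := E) f₁ f₂ x ∈ Γ) {y : V₁ × V₂} (hy : y ∈ W) (hy0 : y ≠ 0)
    (hfy : pairMap (E := E) f₁ f₂ y = 0) : ∀ x ∈ W, pairMap (E := E) f₁ f₂ x = 0 := by
  set F : V₁ × V₂ →ₗ[E] V₁ × V₂ := pairMap f₁ f₂ with hF
  by_contra! hne
  obtain ⟨x, hx, hx0⟩ := hne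
  have h1 := hΓ (W.map F) (Submodule.map_le_iff_le_comap.2 hf) (hW.map F)
    (fun h => hx0 (by
      have : F x ∈ W.map F := Submodule.mem_map_of_mem hx
      rw [h] at this
      exact (Submodule.mem_bot E).1 this))
  have h2 := hΓ (W ⊓ LinearMap.ker F) (inf_le_left.trans hWΓ) (fg_of_le hW inf_le_left)
    (fun h => hy0 (by
      have : y ∈ W ⊓ LinearMap.ker F := ⟨hy, hfy⟩
      rw [h] at this
      exact (Submodule.mem_bot E).1 this))
  have h3 := finrank_map_add_finrank_inf_ker hW F
  have h4 := finrank_spanImg_ge (D := D₁) (p := LinearMap.fst E V₁ V₂) (f := f₁)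
    (F := F) (fun _ => rfl) hW
  have h5 := finrank_spanImg_ge (D := D₂) (p := LinearMap.snd E V₁ V₂) (f := f₂)
    (F := F) (fun _ => rfl) hW
  unfold coordDim at *
  lia

end PairModules

end

end HughesFree

namespace HughesFree

section

open Module

section Fresh

variable {D V : Type*} [DivisionRing D] [AddCommGroup V] [Module D V]

/-- Extend a map given on `P` by sending a complement of `P` to fresh directions. -/
lemma exists_fresh_extension {P Q : Submodule D V} (f s : V →ₗ[D] V) (hs : Function.Injective s)
    (hsQ : Disjoint (LinearMap.range s) Q) (hf : ∀ v ∈ P, f v ∈ Q) :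
    ∃ h : V →ₗ[D] V, (∀ v ∈ P, h v = f v) ∧ ∀ v, h v ∈ Q → v ∈ P := by
  obtain ⟨π, h1, h2⟩ := exists_proj P
  refine ⟨f ∘ₗ π + s ∘ₗ (LinearMap.id - π), fun v hv => by simp [h2 v hv], fun v hv => ?_⟩
  have h3 : s (v - π v) ∈ Q := by
    have := Q.sub_mem hv (hf _ (h1 v))
    simpa using this
  have h4 := (Submodule.disjoint_def.1 hsQ) _ ⟨_, rfl⟩ h3
  have h5 : v - π v = 0 := hs (by rw [h4, map_zero])
  rw [sub_eq_zero.1 h5]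
  exact h1 v

variable {E M : Type*} [DivisionRing E] [AddCommGroup M] [Module E M] [Module E V] [SMul E D]
  [IsScalarTower E D V] {p : M →ₗ[E] V} {F : M →ₗ[E] M} {h : V →ₗ[D] V}

lemma finrank_spanImg_sup_map_le (hF : ∀ m, p (F m) = h (p m)) {W W₂ Z : Submodule E M}
    (hW₂ : W₂.FG) (hZ : Z.FG) (hWW₂ : W ≤ W₂) (hWZ : ∀ w ∈ W, F w ∈ Z) :
    finrank D (spanImg D p (Z ⊔ W₂.map F)) + finrank D (spanImg D p W) ≤
      finrank D (spanImg D p Z) + finrank D (spanImg D p W₂) := by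
  rw [spanImg_sup, spanImg_map hF,
    ← finrank_sup_map_add (spanImg_fg hW₂) (spanImg_fg hZ) h]
  refine Nat.add_le_add_left (finrank_mono_of_fg (fg_of_le (spanImg_fg hW₂) inf_le_left) ?_) _
  refine spanImg_le_iff.2 fun w hw => ⟨mem_spanImg (hWW₂ hw), ?_⟩
  rw [SetLike.mem_coe, Submodule.mem_comap, ← hF]
  exact mem_spanImg (hWZ w hw)

lemma finrank_spanImg_add_le (hF : ∀ m, p (F m) = h (p m)) {Γ W Y X : Submodule E M}
    (hY : Y.FG) (hX : X.FG) (hYX : ∀ y ∈ Y, F y ∈ Γ ⊔ X)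
    (hmem : ∀ v, h v ∈ spanImg D p Γ → v ∈ spanImg D p W) :
    finrank D (spanImg D p Y) +
        finrank D (spanImg D p X ⊓ spanImg D p Γ : Submodule D V) ≤
      finrank D (spanImg D p X) + finrank D (spanImg D p W ⊓ spanImg D p Y : Submodule D V) := by
  have h1 := finrank_map_add_finrank_inf_ker (spanImg_fg (D := D) (p := p) hX)
    (spanImg D p Γ).mkQ
  have h2 := finrank_map_add_finrank_inf_ker (spanImg_fg (D := D) (p := p) hY)
    ((spanImg D p Γ).mkQ ∘ₗ h)
  rw [Submodule.ker_mkQ] at h1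
  have h3 : finrank D ((spanImg D p Y).map ((spanImg D p Γ).mkQ ∘ₗ h)) ≤
      finrank D ((spanImg D p X).map (spanImg D p Γ).mkQ) := by
    refine finrank_mono_of_fg ((spanImg_fg hX).map _) ?_
    rw [Submodule.map_le_iff_le_comap]
    refine spanImg_le_iff.2 fun y hy => ?_
    obtain ⟨γ, hγ, x, hx, hxy⟩ := Submodule.mem_sup.1 (hYX y hy)
    refine ⟨p x, mem_spanImg hx, ?_⟩
    rw [LinearMap.comp_apply, ← hF, ← hxy, map_add, map_add, (Submodule.Quotient.mk_eq_zero _).2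
      (mem_spanImg hγ : p γ ∈ spanImg D p Γ) |> (show (spanImg D p Γ).mkQ (p γ) = 0 from ·),
      zero_add]
  have h4 : finrank D (spanImg D p Y ⊓ LinearMap.ker ((spanImg D p Γ).mkQ ∘ₗ h) : Submodule D V) ≤
      finrank D (spanImg D p W ⊓ spanImg D p Y : Submodule D V) := by
    refine finrank_mono_of_fg (fg_of_le (spanImg_fg hY) inf_le_right) fun v hv => ⟨hmem v ?_, hv.1⟩
    have := LinearMap.mem_ker.1 hv.2
    exact (Submodule.Quotient.mk_eq_zero _).1 this
  lia

end Fresh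

lemma exists_fg_le_sup {R M : Type*} [Ring R] [AddCommGroup M] [Module R M] {A B X : Submodule R M}
    (hX : X.FG) (h : X ≤ A ⊔ B) : ∃ X₀ ≤ A, X₀.FG ∧ X ≤ X₀ ⊔ B := by
  classical
  obtain ⟨S, rfl⟩ := hX
  have : ∀ x : S, ∃ a ∈ A, ∃ b ∈ B, a + b = (x : M) :=
    fun x => Submodule.mem_sup.1 (h (Submodule.subset_span x.2))
  choose a ha b hb hab using this
  refine ⟨Submodule.span R (Set.range a), Submodule.span_le.2 ?_, ?_, Submodule.span_le.2 ?_⟩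
  · rintro _ ⟨x, rfl⟩; exact ha x
  · exact Submodule.fg_span (Set.finite_range a)
  · intro x hx
    rw [SetLike.mem_coe, show x = a ⟨x, hx⟩ + b ⟨x, hx⟩ from (hab ⟨x, hx⟩).symm]
    exact Submodule.add_mem_sup (Submodule.subset_span ⟨_, rfl⟩) (hb _)

section Extend

universe w

variable {E : Type w} {D₁ D₂ : Type w} {V₁ V₂ : Type w} [DivisionRing E] [DivisionRing D₁]
  [DivisionRing D₂] [AddCommGroup V₁] [AddCommGroup V₂] [Module E V₁] [Module E V₂]
  [Module D₁ V₁] [Module D₂ V₂] [SMul E D₁] [SMul E D₂] [IsScalarTower E D₁ V₁]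
  [IsScalarTower E D₂ V₂]

/-- Existence of an injective endomorphism with image independent from a given subspace. -/
def HasRoom (D : Type*) {V : Type*} [DivisionRing D] [AddCommGroup V] [Module D V]
    (Q : Submodule D V) : Prop :=
  ∃ s : V →ₗ[D] V, Function.Injective s ∧ Disjoint (LinearMap.range s) Q

/-- In a maximal space of pairs, a pair of maps extends along tight extensions. -/
theorem exists_extension {Γ : Submodule E (V₁ × V₂)} {γ₀ : V₁ × V₂}
    (hTF : TorsionFree D₁ D₂ Γ) (hAlg : IsAlgebraicOver D₁ D₂ γ₀ Γ)
    (hmax : ∀ Γ', Γ ≤ Γ' → TorsionFree D₁ D₂ Γ' → IsAlgebraicOver D₁ D₂ γ₀ Γ' → Γ' ≤ Γ)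
    (hr₁ : HasRoom D₁ (spanImg D₁ (LinearMap.fst E V₁ V₂) Γ))
    (hr₂ : HasRoom D₂ (spanImg D₂ (LinearMap.snd E V₁ V₂) Γ))
    {W W₂ : Submodule E (V₁ × V₂)} (hWW₂ : W ≤ W₂) (hW₂ : W₂.FG)
    (f₁ : V₁ →ₗ[D₁] V₁) (f₂ : V₂ →ₗ[D₂] V₂) (hf : ∀ x ∈ W, pairMap (E := E) f₁ f₂ x ∈ Γ)
    (htight : coordDim D₁ D₂ W₂ + finrank E W = finrank E W₂ + coordDim D₁ D₂ W)
    (hbetween : ∀ Y, W < Y → Y < W₂ →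
      finrank E Y + coordDim D₁ D₂ W < coordDim D₁ D₂ Y + finrank E W) :
    ∃ (g₁ : V₁ →ₗ[D₁] V₁) (g₂ : V₂ →ₗ[D₂] V₂),
      (∀ x ∈ W, pairMap (E := E) g₁ g₂ x = pairMap (E := E) f₁ f₂ x) ∧
      ∀ x ∈ W₂, pairMap (E := E) g₁ g₂ x ∈ Γ := by
  have hW : W.FG := fg_of_le hW₂ hWW₂
  obtain ⟨s₁, hs₁, hd₁⟩ := hr₁
  obtain ⟨s₂, hs₂, hd₂⟩ := hr₂
  have key₁ : ∀ v ∈ spanImg D₁ (LinearMap.fst E V₁ V₂) W,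
      f₁ v ∈ spanImg D₁ (LinearMap.fst E V₁ V₂) Γ := by
    change _ ≤ (spanImg D₁ (LinearMap.fst E V₁ V₂) Γ).comap f₁
    exact spanImg_le_iff.2 fun x hx =>
      (mem_spanImg (hf x hx) : LinearMap.fst E V₁ V₂ (pairMap (E := E) f₁ f₂ x) ∈ _)
  have key₂ : ∀ v ∈ spanImg D₂ (LinearMap.snd E V₁ V₂) W,
      f₂ v ∈ spanImg D₂ (LinearMap.snd E V₁ V₂) Γ := by
    change _ ≤ (spanImg D₂ (LinearMap.snd E V₁ V₂) Γ).comap f₂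
    exact spanImg_le_iff.2 fun x hx =>
      (mem_spanImg (hf x hx) : LinearMap.snd E V₁ V₂ (pairMap (E := E) f₁ f₂ x) ∈ _)
  obtain ⟨h₁, hh₁, hm₁⟩ := exists_fresh_extension f₁ s₁ hs₁ hd₁ key₁
  obtain ⟨h₂, hh₂, hm₂⟩ := exists_fresh_extension f₂ s₂ hs₂ hd₂ key₂
  set F : V₁ × V₂ →ₗ[E] V₁ × V₂ := pairMap h₁ h₂ with hF
  have hFW : ∀ x ∈ W, F x = pairMap (E := E) f₁ f₂ x := fun x hx =>
    Prod.ext (hh₁ x.1 (mem_spanImg hx : LinearMap.fst E V₁ V₂ x ∈ _))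
      (hh₂ x.2 (mem_spanImg hx : LinearMap.snd E V₁ V₂ x ∈ _))
  have hFWΓ : ∀ x ∈ W, F x ∈ Γ := fun x hx => by rw [hFW x hx]; exact hf x hx
  have hpre₁ : ∀ x, F x ∈ Γ → x.1 ∈ spanImg D₁ (LinearMap.fst E V₁ V₂) W := fun x hx =>
    hm₁ _ (mem_spanImg hx : LinearMap.fst E V₁ V₂ (F x) ∈ _)
  have hpre₂ : ∀ x, F x ∈ Γ → x.2 ∈ spanImg D₂ (LinearMap.snd E V₁ V₂) W := fun x hx =>
    hm₂ _ (mem_spanImg hx : LinearMap.snd E V₁ V₂ (F x) ∈ _)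
  by_cases hall : ∀ x ∈ W₂, F x ∈ Γ
  · exact ⟨h₁, h₂, hFW, hall⟩
  have hstar : W₂ ⊓ Γ.comap F = W := by
    by_contra hne
    have hlt : W < W₂ ⊓ Γ.comap F := lt_of_le_of_ne (le_inf hWW₂ hFWΓ) (Ne.symm hne)
    have hlt2 : W₂ ⊓ Γ.comap F < W₂ := by
      refine lt_of_le_of_ne inf_le_left fun h => hall fun x hx => ?_
      rw [← h] at hx
      exact hx.2
    have h1 := hbetween _ hlt hlt2
    have hfg : (W₂ ⊓ Γ.comap F).FG := fg_of_le hW₂ inf_le_left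
    have h2 := finrank_lt_of_lt_of_fg hfg hlt
    have h3 : coordDim D₁ D₂ (W₂ ⊓ Γ.comap F) ≤ coordDim D₁ D₂ W :=
      add_le_add
        (finrank_mono_of_fg (spanImg_fg hW) (spanImg_le_iff.2 fun x hx => hpre₁ x hx.2))
        (finrank_mono_of_fg (spanImg_fg hW) (spanImg_le_iff.2 fun x hx => hpre₂ x hx.2))
    lia
  have hadd (Z : Submodule E (V₁ × V₂)) (hZ : Z.FG) (hZΓ : Z ≤ Γ) (hWZ : ∀ x ∈ W, F x ∈ Z) :
      finrank E (Z ⊔ W₂.map F : Submodule E (V₁ × V₂)) + finrank E W =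
        finrank E Z + finrank E W₂ := by
    have hWeq : W₂ ⊓ Z.comap F = W := le_antisymm
      ((inf_le_inf_left _ (Submodule.comap_mono hZΓ)).trans hstar.le) (le_inf hWW₂ hWZ)
    have := finrank_sup_map_add hW₂ hZ F
    rwa [hWeq] at this
  by_cases hTF' : TorsionFree D₁ D₂ (Γ ⊔ W₂.map F)
  · refine absurd (hmax _ le_sup_left hTF' fun X hX hXfg => ?_) fun h => hall fun x hx =>
      h (Submodule.mem_sup_right (Submodule.mem_map_of_mem hx))
    obtain ⟨X₀, hX₀, hX₀fg, hXX₀⟩ := exists_fg_le_sup hXfg hX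
    obtain ⟨Z, hZ, hZfg, hXZ, hγZ, hcl⟩ := hAlg (X₀ ⊔ W.map F)
      (sup_le hX₀ (Submodule.map_le_iff_le_comap.2 hFWΓ)) (hX₀fg.sup (hW.map F))
    have hWZ : ∀ x ∈ W, F x ∈ Z := fun x hx =>
      hXZ (Submodule.mem_sup_right (Submodule.mem_map_of_mem hx))
    refine ⟨Z ⊔ W₂.map F, sup_le_sup_right hZ _, hZfg.sup (hW₂.map F),
      hXX₀.trans (sup_le_sup_right (le_sup_left.trans hXZ) _), Submodule.mem_sup_left hγZ, ?_⟩
    have h1 := hadd Z hZfg hZ hWZ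
    have h2 := finrank_spanImg_sup_map_le (D := D₁) (p := LinearMap.fst E V₁ V₂) (F := F)
      (h := h₁) (fun _ => rfl) hW₂ hZfg hWW₂ hWZ
    have h3 := finrank_spanImg_sup_map_le (D := D₂) (p := LinearMap.snd E V₁ V₂) (F := F)
      (h := h₂) (fun _ => rfl) hW₂ hZfg hWW₂ hWZ
    unfold coordDim at *
    lia
  · unfold TorsionFree at hTF'
    push Not at hTF'
    obtain ⟨X, hX, hXfg, hX0, hXd⟩ := hTF'
    set Y := W₂ ⊓ (Γ ⊔ X).comap F with hYdef
    have hYfg : Y.FG := fg_of_le hW₂ inf_le_left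
    have hWY : W ≤ Y := le_inf hWW₂ fun x hx => Submodule.mem_sup_left (hFWΓ x hx)
    have e1 := finrank_map_add_finrank_inf_ker hXfg Γ.mkQ
    have e2 := finrank_map_add_finrank_inf_ker hYfg (Γ.mkQ ∘ₗ F)
    have e3 : Y.map (Γ.mkQ ∘ₗ F) = X.map Γ.mkQ := by
      apply le_antisymm
      · rw [Submodule.map_le_iff_le_comap]
        intro y hy
        obtain ⟨γ, hγ, x, hx, hxy⟩ := Submodule.mem_sup.1 hy.2
        refine ⟨x, hx, ?_⟩
        rw [LinearMap.comp_apply, ← hxy, map_add, Submodule.mkQ_apply _ γ,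
          (Submodule.Quotient.mk_eq_zero _).2 hγ, zero_add]
      · rw [Submodule.map_le_iff_le_comap]
        intro x hx
        obtain ⟨γ, hγ, _, ⟨y, hy, rfl⟩, hxy⟩ := Submodule.mem_sup.1 (hX hx)
        refine ⟨y, ⟨hy, ?_⟩, ?_⟩
        · rw [SetLike.mem_coe, Submodule.mem_comap, ← sub_eq_iff_eq_add'.2 hxy.symm, sub_eq_neg_add]
          exact Submodule.add_mem_sup (Γ.neg_mem hγ) hx
        · rw [LinearMap.comp_apply, ← hxy, map_add, Submodule.mkQ_apply _ γ,
            (Submodule.Quotient.mk_eq_zero _).2 hγ, zero_add]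
    have e4 : Y ⊓ LinearMap.ker (Γ.mkQ ∘ₗ F) = W := by
      rw [LinearMap.ker_comp, Submodule.ker_mkQ]
      refine le_antisymm ?_ (le_inf hWY hFWΓ)
      rw [← hstar]
      exact inf_le_inf_right _ inf_le_left
    rw [e3, e4] at e2
    rw [Submodule.ker_mkQ] at e1
    have u1 := finrank_spanImg_add_le (D := D₁) (p := LinearMap.fst E V₁ V₂) (F := F)
      (h := h₁) (fun _ => rfl) hYfg hXfg (fun y hy => hy.2) hm₁
    have u2 := finrank_spanImg_add_le (D := D₂) (p := LinearMap.snd E V₁ V₂) (F := F)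
      (h := h₂) (fun _ => rfl) hYfg hXfg (fun y hy => hy.2) hm₂
    rw [inf_eq_left.2 (spanImg_mono hWY)] at u1 u2
    have hYle : finrank E Y + coordDim D₁ D₂ W ≤ coordDim D₁ D₂ Y + finrank E W ∧
        (Y = W ∨ Y = W₂ ∨
          finrank E Y + coordDim D₁ D₂ W < coordDim D₁ D₂ Y + finrank E W) := by
      by_cases hY1 : Y = W
      · rw [hY1]; exact ⟨by lia, Or.inl rfl⟩
      by_cases hY2 : Y = W₂
      · rw [hY2]; exact ⟨by lia, Or.inr (Or.inl rfl)⟩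
      have := hbetween Y (lt_of_le_of_ne hWY (Ne.symm hY1)) (lt_of_le_of_ne inf_le_left hY2)
      exact ⟨this.le, Or.inr (Or.inr this)⟩
    obtain ⟨hYle, hYcases⟩ := hYle
    have q1 : finrank D₁ (spanImg D₁ (LinearMap.fst E V₁ V₂) (X ⊓ Γ)) ≤ _ :=
      finrank_mono_of_fg (fg_of_le (spanImg_fg (D := D₁) (p := LinearMap.fst E V₁ V₂) hXfg)
        inf_le_left) (le_inf (spanImg_mono inf_le_left) (spanImg_mono inf_le_right))
    have q2 : finrank D₂ (spanImg D₂ (LinearMap.snd E V₁ V₂) (X ⊓ Γ)) ≤ _ :=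
      finrank_mono_of_fg (fg_of_le (spanImg_fg (D := D₂) (p := LinearMap.snd E V₁ V₂) hXfg)
        inf_le_left) (le_inf (spanImg_mono inf_le_left) (spanImg_mono inf_le_right))
    have hX₀ : X ⊓ Γ = ⊥ := by
      by_contra hne
      have := hTF (X ⊓ Γ) inf_le_right (fg_of_le hXfg inf_le_left) hne
      unfold coordDim at *
      lia
    rw [hX₀, finrank_bot] at e1
    have hq1 : spanImg D₁ (LinearMap.fst E V₁ V₂) X ⊓ spanImg D₁ (LinearMap.fst E V₁ V₂) Γ = ⊥ := by
      refine eq_bot_of_finrank_eq_zero (fg_of_le (spanImg_fg hXfg) inf_le_left) ?_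
      unfold coordDim at *
      lia
    have hq2 : spanImg D₂ (LinearMap.snd E V₁ V₂) X ⊓ spanImg D₂ (LinearMap.snd E V₁ V₂) Γ = ⊥ := by
      refine eq_bot_of_finrank_eq_zero (fg_of_le (spanImg_fg hXfg) inf_le_left) ?_
      unfold coordDim at *
      lia
    have hYW₂ : Y = W₂ := by
      rcases hYcases with h | h | h
      · rw [h] at e2
        exact absurd (eq_bot_of_finrank_eq_zero hXfg (by lia)) hX0
      · exact h
      · unfold coordDim at *
        lia
    obtain ⟨q₁, hq₁Γ, hq₁X⟩ := exists_proj_of_disjoint (disjoint_iff.2 hq1).symm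
    obtain ⟨q₂, hq₂Γ, hq₂X⟩ := exists_proj_of_disjoint (disjoint_iff.2 hq2).symm
    have hqΓ : ∀ x ∈ Γ, (q₁ x.1, q₂ x.2) = x := fun x hx =>
      Prod.ext (hq₁Γ x.1 (mem_spanImg hx : LinearMap.fst E V₁ V₂ x ∈ _))
        (hq₂Γ x.2 (mem_spanImg hx : LinearMap.snd E V₁ V₂ x ∈ _))
    have hqX : ∀ x ∈ X, (q₁ x.1, q₂ x.2) = 0 := fun x hx =>
      Prod.ext (hq₁X x.1 (mem_spanImg hx : LinearMap.fst E V₁ V₂ x ∈ _))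
        (hq₂X x.2 (mem_spanImg hx : LinearMap.snd E V₁ V₂ x ∈ _))
    refine ⟨q₁ ∘ₗ h₁, q₂ ∘ₗ h₂, fun x hx => ?_, fun x hx => ?_⟩
    · rw [← hFW x hx]
      exact hqΓ _ (hFWΓ x hx)
    · rw [← hYW₂] at hx
      obtain ⟨γ, hγ, y, hy, hxy⟩ := Submodule.mem_sup.1 hx.2
      have : pairMap (E := E) (q₁ ∘ₗ h₁) (q₂ ∘ₗ h₂) x = γ := by
        change pairMap (E := E) q₁ q₂ (F x) = γ
        rw [← hxy, map_add]
        exact (congrArg₂ _ (hqΓ γ hγ) (hqX y hy)).trans (add_zero γ)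
      rw [this]
      exact hγ

end Extend

end

end HughesFree

namespace HughesFree

section

open Module Cardinal

universe w

section Exists

variable {E : Type w} {D₁ D₂ : Type w} {V₁ V₂ : Type w} [DivisionRing E] [DivisionRing D₁]
  [DivisionRing D₂] [AddCommGroup V₁] [AddCommGroup V₂] [Module E V₁] [Module E V₂]
  [Module D₁ V₁] [Module D₂ V₂] [SMul E D₁] [SMul E D₂] [IsScalarTower E D₁ V₁]
  [IsScalarTower E D₂ V₂]

lemma exists_le_of_le_sSup_chain {R M : Type*} [Ring R] [AddCommGroup M] [Module R M]
    {c : Set (Submodule R M)} (hc : IsChain (· ≤ ·) c) (hne : c.Nonempty) {W : Submodule R M}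
    (hW : W.FG) (h : W ≤ sSup c) : ∃ Γ ∈ c, W ≤ Γ :=
  (CompleteLattice.isCompactElement_iff_le_of_directed_sSup_le _ W).1
    ((Submodule.fg_iff_compact W).1 hW) c hne hc.directedOn h

theorem exists_maximal_torsionFree {γ₀ : V₁ × V₂} (h1 : γ₀.1 ≠ 0) (h2 : γ₀.2 ≠ 0) :
    ∃ Γ : Submodule E (V₁ × V₂), TorsionFree D₁ D₂ Γ ∧ IsAlgebraicOver D₁ D₂ γ₀ Γ ∧
      ∀ Γ', Γ ≤ Γ' → TorsionFree D₁ D₂ Γ' → IsAlgebraicOver D₁ D₂ γ₀ Γ' → Γ' ≤ Γ := by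
  have h0 : γ₀ ≠ 0 := fun h => h1 (by rw [h]; rfl)
  have hd : coordDim D₁ D₂ (Submodule.span E {γ₀}) = 2 := by
    rw [coordDim, spanImg_span, spanImg_span, Set.image_singleton, Set.image_singleton]
    exact congrArg₂ (· + ·) (finrank_span_singleton h1) (finrank_span_singleton h2)
  suffices h : ∃ Γ, Submodule.span E {γ₀} ≤ Γ ∧ Maximal
      (· ∈ {Γ : Submodule E (V₁ × V₂) | TorsionFree D₁ D₂ Γ ∧ IsAlgebraicOver D₁ D₂ γ₀ Γ}) Γ by
    obtain ⟨Γ, -, hΓ⟩ := h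
    exact ⟨Γ, hΓ.1.1, hΓ.1.2, fun Γ' hle hTF hAlg => hΓ.2 ⟨hTF, hAlg⟩ hle⟩
  refine zorn_le_nonempty₀ _ ?_ _ ⟨?_, ?_⟩
  · intro c hcs hc y hy
    refine ⟨sSup c, ⟨fun W hW hfg hW0 => ?_, fun W hW hfg => ?_⟩, fun z hz => le_sSup hz⟩
    · obtain ⟨Γ, hΓ, hWΓ⟩ := exists_le_of_le_sSup_chain hc ⟨y, hy⟩ hfg hW
      exact (hcs hΓ).1 W hWΓ hfg hW0
    · obtain ⟨Γ, hΓ, hWΓ⟩ := exists_le_of_le_sSup_chain hc ⟨y, hy⟩ hfg hW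
      obtain ⟨W', hW', h⟩ := (hcs hΓ).2 W hWΓ hfg
      exact ⟨W', hW'.trans (le_sSup hΓ), h⟩
  · intro W hW hfg hW0
    have h3 := finrank_mono_of_fg (Submodule.fg_span_singleton γ₀) hW
    rw [finrank_span_singleton h0] at h3
    have h4 : W = Submodule.span E {γ₀} := by
      refine eq_of_le_of_finrank_le_of_fg (Submodule.fg_span_singleton γ₀) hW ?_
      rw [finrank_span_singleton h0, Nat.one_le_iff_ne_zero]
      exact fun h => hW0 (eq_bot_of_finrank_eq_zero hfg h)
    rw [h4, hd, finrank_span_singleton h0]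
  · intro W hW hfg
    exact ⟨_, le_rfl, Submodule.fg_span_singleton γ₀, hW, Submodule.mem_span_singleton_self γ₀,
      by rw [hd, finrank_span_singleton h0]⟩

end Exists

section Coding

lemma exists_linearMap_of_linearIndependent {D V ι : Type*} [DivisionRing D] [AddCommGroup V]
    [Module D V] {b : ι → V} (hb : LinearIndependent D b) (b' : ι → V) :
    ∃ g : V →ₗ[D] V, ∀ i, g (b i) = b' i := by
  obtain ⟨g, hg⟩ := ((Basis.span hb).constr ℕ b').exists_extend
  refine ⟨g, fun i => ?_⟩
  have := LinearMap.congr_fun hg (Basis.span hb i)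
  rwa [Basis.constr_basis, LinearMap.comp_apply, Submodule.subtype_apply, Basis.span_apply] at this

lemma exists_linearIndependent_coords {D V : Type*} [DivisionRing D] [AddCommGroup V]
    [Module D V] {Q : Submodule D V} (hQ : Q.FG) :
    ∃ (p : ℕ) (b : Fin p → V), LinearIndependent D b ∧
      ∀ v ∈ Q, ∃ y : Fin p → D, ∑ j, y j • b j = v := by
  have : FiniteDimensional D Q := Module.Finite.iff_fg.2 hQ
  let B := finBasis D Q
  refine ⟨_, fun j => B j, B.linearIndependent.map' _ (Submodule.ker_subtype _), fun v hv =>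
    ⟨B.repr ⟨v, hv⟩, ?_⟩⟩
  have := congrArg Q.subtype (B.sum_repr ⟨v, hv⟩)
  rwa [map_sum] at this

variable {E : Type w} (D₁ D₂ : Type w) {V₁ V₂ : Type w} [DivisionRing E] [DivisionRing D₁]
  [DivisionRing D₂] [AddCommGroup V₁] [AddCommGroup V₂] [Module E V₁] [Module E V₂]
  [Module D₁ V₁] [Module D₂ V₂]

/-- Coordinates of a finite family of pairs, and of two further pairs. -/
abbrev PairCode : Type w :=
  Σ n p q : ℕ, (Fin n → (Fin p → D₁) × (Fin q → D₂)) ×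
    ((Fin p → D₁) × (Fin q → D₂)) × ((Fin p → D₁) × (Fin q → D₂))

variable {D₁ D₂}

/-- The pair with given coordinates. -/
def ofCoords {p q : ℕ} (b₁ : Fin p → V₁) (b₂ : Fin q → V₂) (x : (Fin p → D₁) × (Fin q → D₂)) :
    V₁ × V₂ :=
  (∑ j, x.1 j • b₁ j, ∑ j, x.2 j • b₂ j)

/-- `c` lists coordinates of generators of a closed subspace of `Γ`, of `γ₀` and of `γ`. -/
def IsPairCode (Γ : Submodule E (V₁ × V₂)) (γ₀ γ : V₁ × V₂) (c : PairCode D₁ D₂) : Prop :=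
  ∃ (W : Submodule E (V₁ × V₂)) (b₁ : Fin c.2.1 → V₁) (b₂ : Fin c.2.2.1 → V₂),
    W ≤ Γ ∧ W.FG ∧ coordDim D₁ D₂ W ≤ finrank E W + 1 ∧ γ₀ ∈ W ∧ γ ∈ W ∧
    LinearIndependent D₁ b₁ ∧ LinearIndependent D₂ b₂ ∧
    Submodule.span E (Set.range fun i => ofCoords b₁ b₂ (c.2.2.2.1 i)) = W ∧
    ofCoords b₁ b₂ c.2.2.2.2.1 = γ₀ ∧ ofCoords b₁ b₂ c.2.2.2.2.2 = γ

variable [SMul E D₁] [SMul E D₂] [IsScalarTower E D₁ V₁] [IsScalarTower E D₂ V₂]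

lemma exists_isPairCode {Γ : Submodule E (V₁ × V₂)} {γ₀ γ : V₁ × V₂}
    (hAlg : IsAlgebraicOver D₁ D₂ γ₀ Γ) (hγ : γ ∈ Γ) :
    ∃ c : PairCode D₁ D₂, IsPairCode Γ γ₀ γ c := by
  obtain ⟨W, hWΓ, hW, hle, hγ₀, hcl⟩ := hAlg _ ((Submodule.span_singleton_le_iff_mem γ Γ).2 hγ)
    (Submodule.fg_span_singleton γ)
  have hγW : γ ∈ W := hle (Submodule.mem_span_singleton_self γ)
  obtain ⟨n, u, hu⟩ := Submodule.fg_iff_exists_fin_generating_family.1 hW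
  obtain ⟨p, b₁, hb₁, hex₁⟩ := exists_linearIndependent_coords
    (spanImg_fg (D := D₁) (p := LinearMap.fst E V₁ V₂) hW)
  obtain ⟨q, b₂, hb₂, hex₂⟩ := exists_linearIndependent_coords
    (spanImg_fg (D := D₂) (p := LinearMap.snd E V₁ V₂) hW)
  have hex : ∀ x ∈ W, ∃ y, ofCoords (D₁ := D₁) (D₂ := D₂) b₁ b₂ y = x := by
    intro x hx
    obtain ⟨y₁, hy₁⟩ := hex₁ _ (mem_spanImg hx)
    obtain ⟨y₂, hy₂⟩ := hex₂ _ (mem_spanImg hx)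
    exact ⟨(y₁, y₂), Prod.ext hy₁ hy₂⟩
  have hex' : ∀ i, ∃ y, ofCoords (D₁ := D₁) (D₂ := D₂) b₁ b₂ y = u i :=
    fun i => hex _ (hu ▸ Submodule.subset_span ⟨i, rfl⟩)
  choose y hy using hex'
  obtain ⟨y₀, hy₀⟩ := hex _ hγ₀
  obtain ⟨y₁, hy₁⟩ := hex _ hγW
  refine ⟨⟨n, _, _, y, y₀, y₁⟩, W, b₁, b₂, hWΓ, hW, hcl, hγ₀, hγW,
    hb₁, hb₂, ?_, hy₀, hy₁⟩
  simp only [hy]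
  exact hu

lemma IsPairCode.unique {Γ : Submodule E (V₁ × V₂)} {γ₀ γ γ' : V₁ × V₂}
    (hTF : TorsionFree D₁ D₂ Γ) (h0 : γ₀ ≠ 0) {c : PairCode D₁ D₂}
    (h : IsPairCode Γ γ₀ γ c) (h' : IsPairCode Γ γ₀ γ' c) : γ = γ' := by
  obtain ⟨W, b₁, b₂, hWΓ, hW, hcl, hγ₀, hγ, hb₁, hb₂, hsp, hc₀, hc⟩ := h
  obtain ⟨W', b₁', b₂', hWΓ', hW', hcl', hγ₀', hγ', hb₁', hb₂', hsp', hc₀', hc'⟩ := h'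
  obtain ⟨g₁, hg₁⟩ := exists_linearMap_of_linearIndependent hb₁ b₁'
  obtain ⟨g₂, hg₂⟩ := exists_linearMap_of_linearIndependent hb₂ b₂'
  have hg (x : (Fin c.2.1 → D₁) × (Fin c.2.2.1 → D₂)) :
      pairMap (E := E) g₁ g₂ (ofCoords b₁ b₂ x) = ofCoords b₁' b₂' x := by
    simp [ofCoords, hg₁, hg₂]
  have hsub (x : V₁ × V₂) : pairMap (E := E) (g₁ - LinearMap.id) (g₂ - LinearMap.id) x =
      pairMap (E := E) g₁ g₂ x - x := rfl
  have hgW : ∀ x ∈ W, pairMap (E := E) g₁ g₂ x ∈ Γ := by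
    change W ≤ Γ.comap (pairMap g₁ g₂)
    rw [← hsp, Submodule.span_le]
    rintro _ ⟨i, rfl⟩
    change pairMap (E := E) g₁ g₂ _ ∈ Γ
    rw [hg]
    exact hWΓ' (hsp' ▸ Submodule.subset_span ⟨i, rfl⟩)
  have := hTF.pairMap_eq_zero hWΓ hW hcl (f₁ := g₁ - LinearMap.id) (f₂ := g₂ - LinearMap.id)
    (fun x hx => by rw [hsub]; exact Γ.sub_mem (hgW x hx) (hWΓ hx)) hγ₀ h0
    (by rw [hsub, ← hc₀, hg, hc₀', hc₀, sub_self]) γ hγ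
  rw [hsub, ← hc, hg, hc', hc] at this
  exact (sub_eq_zero.1 this).symm

lemma mk_le_mk_pairCode {Γ : Submodule E (V₁ × V₂)} {γ₀ : V₁ × V₂}
    (hTF : TorsionFree D₁ D₂ Γ) (hAlg : IsAlgebraicOver D₁ D₂ γ₀ Γ) (h0 : γ₀ ≠ 0) :
    #Γ ≤ #(PairCode D₁ D₂) := by
  have : ∀ γ : Γ, ∃ c : PairCode D₁ D₂, IsPairCode Γ γ₀ (γ : V₁ × V₂) c :=
    fun γ => exists_isPairCode hAlg γ.2
  choose c hc using this
  refine mk_le_of_injective (f := c) fun γ γ' h => Subtype.ext ?_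
  exact (hc γ).unique hTF h0 (h ▸ hc γ')

instance : Infinite (PairCode D₁ D₂) :=
  Infinite.of_injective (fun n : ℕ => (⟨n, 0, 0, 0, 0, 0⟩ : PairCode D₁ D₂))
    fun _ _ h => congrArg Sigma.fst h

end Coding

section Room

lemma hasRoom_of_supports {D ι : Type w} [DivisionRing D] [Infinite ι] (Q : Submodule D (ι →₀ D))
    (U : Set ι) (hU : #U < #ι) (h : ∀ x ∈ Q, ∀ i, x i ≠ 0 → i ∈ U) : HasRoom D Q := by
  obtain ⟨σ⟩ : Nonempty (ι ↪ (Uᶜ : Set ι)) := by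
    rw [← Cardinal.le_def, Cardinal.mk_compl_of_infinite U hU]
  let τ : ι ↪ ι := σ.trans (Function.Embedding.subtype _)
  refine ⟨Finsupp.lmapDomain D D τ, Finsupp.mapDomain_injective τ.injective, ?_⟩
  rw [Submodule.disjoint_def]
  rintro _ ⟨x, rfl⟩ hx
  have hx0 : x = 0 := by
    ext i
    by_contra hi
    refine (σ i).2 (h _ hx (τ i) ?_)
    rw [Finsupp.lmapDomain_apply, Finsupp.mapDomain_apply τ.injective]
    exact hi
  rw [hx0, map_zero]

lemma mk_iUnion_support_le {D ι κ T : Type w} [Zero D] [Infinite T] (hκ : #κ ≤ #T)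
    (x : κ → ι →₀ D) : #(⋃ j, ((x j).support : Set ι)) ≤ #T := by
  refine (mk_iUnion_le_sum_mk).trans ?_
  refine (sum_le_sum _ (fun _ => ℵ₀) fun j => ?_).trans ?_
  · exact (lt_aleph0_of_finite _).le
  · rw [sum_const']
    exact (mul_le_mul' hκ (aleph0_le_mk T)).trans (mul_eq_self (aleph0_le_mk T)).le

lemma spanImg_support {E D ι M : Type*} [DivisionRing E] [DivisionRing D] [AddCommGroup M]
    [Module E M] [Module E (ι →₀ D)] {p : M →ₗ[E] ι →₀ D} {Γ : Submodule E M} {U : Set ι}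
    (h : ∀ γ ∈ Γ, ∀ i, p γ i ≠ 0 → i ∈ U) : ∀ x ∈ spanImg D p Γ, ∀ i, x i ≠ 0 → i ∈ U := by
  have hle : spanImg D p Γ ≤ Finsupp.supported D D U := by
    refine spanImg_le_iff.2 fun γ hγ => ?_
    rw [Finsupp.mem_supported]
    intro i hi
    exact h γ hγ i (Finsupp.mem_support_iff.1 hi)
  intro x hx i hi
  exact (Finsupp.mem_supported D x).1 (hle hx) (Finsupp.mem_support_iff.2 hi)

variable {E : Type w} {D₁ D₂ : Type w} [DivisionRing E] [DivisionRing D₁] [DivisionRing D₂]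
  [Module E D₁] [Module E D₂] [IsScalarTower E D₁ D₁] [IsScalarTower E D₂ D₂]

theorem hasRoom_of_torsionFree {I : Type w} [Infinite I]
    (hI : #(PairCode D₁ D₂) < #I) {Γ : Submodule E ((I →₀ D₁) × (I →₀ D₂))}
    {γ₀ : (I →₀ D₁) × (I →₀ D₂)} (hTF : TorsionFree D₁ D₂ Γ)
    (hAlg : IsAlgebraicOver D₁ D₂ γ₀ Γ) (h0 : γ₀ ≠ 0) :
    HasRoom D₁ (spanImg D₁ (LinearMap.fst E (I →₀ D₁) (I →₀ D₂)) Γ) ∧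
      HasRoom D₂ (spanImg D₂ (LinearMap.snd E (I →₀ D₁) (I →₀ D₂)) Γ) := by
  have hcard := mk_le_mk_pairCode hTF hAlg h0
  constructor
  · refine hasRoom_of_supports _ (⋃ γ : Γ, ((γ : (I →₀ D₁) × (I →₀ D₂)).1.support : Set I))
      ((mk_iUnion_support_le hcard _).trans_lt hI) (spanImg_support fun γ hγ i hi => ?_)
    exact Set.mem_iUnion.2 ⟨⟨γ, hγ⟩, Finsupp.mem_support_iff.2 hi⟩
  · refine hasRoom_of_supports _ (⋃ γ : Γ, ((γ : (I →₀ D₁) × (I →₀ D₂)).2.support : Set I))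
      ((mk_iUnion_support_le hcard _).trans_lt hI) (spanImg_support fun γ hγ i hi => ?_)
    exact Set.mem_iUnion.2 ⟨⟨γ, hγ⟩, Finsupp.mem_support_iff.2 hi⟩

end Room

end

end HughesFree

namespace HughesFree

section

open Module

universe w

lemma finrank_sup_span_singleton {D V : Type*} [DivisionRing D] [AddCommGroup V] [Module D V]
    {Q : Submodule D V} (hQ : Q.FG) {v : V} (hv : v ∉ Q) :
    finrank D (Q ⊔ Submodule.span D {v} : Submodule D V) = finrank D Q + 1 := by
  have : FiniteDimensional D Q := Module.Finite.iff_fg.2 hQ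
  have hv0 : v ≠ 0 := fun h => hv (h ▸ Q.zero_mem)
  have h := Submodule.finrank_sup_add_finrank_inf_eq Q (Submodule.span D {v})
  rw [finrank_span_singleton hv0] at h
  rw [← h, (disjoint_iff.1 ((Submodule.disjoint_span_singleton' hv0).2 hv)), finrank_bot, add_zero]

lemma spanImg_span_singleton {E M D V : Type*} [DivisionRing E] [DivisionRing D] [AddCommGroup M]
    [Module E M] [AddCommGroup V] [Module E V] [Module D V] [SMul E D] [IsScalarTower E D V]
    {p : M →ₗ[E] V} (x : M) : spanImg D p (Submodule.span E {x}) = Submodule.span D {p x} := by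
  rw [spanImg_span, Set.image_singleton]

variable {E : Type w} {D₁ D₂ : Type w} {V₁ V₂ : Type w} [DivisionRing E] [DivisionRing D₁]
  [DivisionRing D₂] [AddCommGroup V₁] [AddCommGroup V₂] [Module E V₁] [Module E V₂]
  [Module D₁ V₁] [Module D₂ V₂]

/-- A maximal torsion-free algebraic space of pairs with room around it. -/
structure IsMaximalSpace (D₁ D₂ : Type w) [DivisionRing D₁] [DivisionRing D₂]
    [Module D₁ V₁] [Module D₂ V₂] (γ₀ : V₁ × V₂) (Γ : Submodule E (V₁ × V₂)) : Prop where
  torsionFree : TorsionFree D₁ D₂ Γ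
  algebraic : IsAlgebraicOver D₁ D₂ γ₀ Γ
  maximal : ∀ Γ', Γ ≤ Γ' → TorsionFree D₁ D₂ Γ' → IsAlgebraicOver D₁ D₂ γ₀ Γ' → Γ' ≤ Γ
  room_fst : HasRoom D₁ (spanImg D₁ (LinearMap.fst E V₁ V₂) Γ)
  room_snd : HasRoom D₂ (spanImg D₂ (LinearMap.snd E V₁ V₂) Γ)

lemma HasRoom.exists_notMem {D V : Type*} [DivisionRing D] [AddCommGroup V] [Module D V]
    {Q : Submodule D V} (h : HasRoom D Q) {v : V} (hv : v ≠ 0) : ∃ u, u ∉ Q := by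
  obtain ⟨s, hs, hd⟩ := h
  refine ⟨s v, fun hu => hv (hs ?_)⟩
  rw [map_zero]
  exact Submodule.disjoint_def.1 hd _ ⟨v, rfl⟩ hu

namespace IsMaximalSpace

variable {γ₀ : V₁ × V₂} {Γ : Submodule E (V₁ × V₂)} (h : IsMaximalSpace D₁ D₂ γ₀ Γ)

include h

lemma base_mem : γ₀ ∈ Γ := by
  obtain ⟨W, hW, -, -, h0, -⟩ := h.algebraic ⊥ bot_le Submodule.fg_bot
  exact hW h0

lemma exists_closed_ge {W : Submodule E (V₁ × V₂)} (hWΓ : W ≤ Γ) (hW : W.FG) :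
    ∃ W' ≤ Γ, W'.FG ∧ coordDim D₁ D₂ W' ≤ finrank E W' + 1 ∧ W ≤ W' := by
  obtain ⟨W', h1, h2, h3, -, h4⟩ := h.algebraic W hWΓ hW
  exact ⟨W', h1, h2, h4, h3⟩

variable [SMul E D₁] [SMul E D₂] [IsScalarTower E D₁ V₁] [IsScalarTower E D₂ V₂]

lemma exists_smul_fst {γ : V₁ × V₂} (hγ : γ ∈ Γ) (d : D₁) : ∃ γ' ∈ Γ, γ'.1 = d • γ.1 := by
  by_cases h0 : γ = 0
  · exact ⟨0, Γ.zero_mem, by simp [h0]⟩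
  obtain ⟨u, hu⟩ := h.room_snd.exists_notMem (h.torsionFree.snd_ne_zero hγ h0)
  set W := Submodule.span E {γ} with hW
  have hWfg : W.FG := Submodule.fg_span_singleton γ
  have hγW : γ ∈ W := Submodule.mem_span_singleton_self γ
  have hWΓ : W ≤ Γ := (Submodule.span_singleton_le_iff_mem _ _).2 hγ
  have hu' : u ∉ spanImg D₂ (LinearMap.snd E V₁ V₂) W := fun hu' => hu (spanImg_mono hWΓ hu')
  have hy : (d • γ.1, u) ∉ W := fun hy => hu' (mem_spanImg hy)
  have e1 := finrank_sup_span_singleton hWfg hy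
  have e2 := finrank_sup_span_singleton (spanImg_fg hWfg) hu'
  have e3 : spanImg D₁ (LinearMap.fst E V₁ V₂) (W ⊔ Submodule.span E {(d • γ.1, u)}) =
      spanImg D₁ (LinearMap.fst E V₁ V₂) W := by
    rw [spanImg_sup, spanImg_span_singleton (d • γ.1, u), sup_eq_left,
      Submodule.span_singleton_le_iff_mem]
    exact Submodule.smul_mem _ d (mem_spanImg hγW)
  have e4 : spanImg D₂ (LinearMap.snd E V₁ V₂) (W ⊔ Submodule.span E {(d • γ.1, u)}) =
      spanImg D₂ (LinearMap.snd E V₁ V₂) W ⊔ Submodule.span D₂ {u} := by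
    rw [spanImg_sup, spanImg_span_singleton (d • γ.1, u)]
    rfl
  obtain ⟨g₁, g₂, hg, hgΓ⟩ := exists_extension h.torsionFree h.algebraic h.maximal h.room_fst
    h.room_snd (W := W) (W₂ := W ⊔ Submodule.span E {(d • γ.1, u)}) le_sup_left
    (hWfg.sup (Submodule.fg_span_singleton _)) LinearMap.id LinearMap.id (fun x hx => hWΓ hx)
    (by rw [coordDim, coordDim, e1, e3, e4, e2]; lia)
    (fun Y hY hY' => by
      have h1 := finrank_lt_of_lt_of_fg
        (fg_of_le (hWfg.sup (Submodule.fg_span_singleton _)) hY'.le) hY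
      have h2 := finrank_lt_of_lt_of_fg (hWfg.sup (Submodule.fg_span_singleton _)) hY'
      lia)
  refine ⟨_, hgΓ _ (Submodule.mem_sup_right (Submodule.mem_span_singleton_self _)), ?_⟩
  have := congrArg Prod.fst (hg γ hγW)
  simp only [pairMap_apply, LinearMap.id_apply] at this
  simp [this]

lemma exists_smul_snd {γ : V₁ × V₂} (hγ : γ ∈ Γ) (d : D₂) : ∃ γ' ∈ Γ, γ'.2 = d • γ.2 := by
  by_cases h0 : γ = 0
  · exact ⟨0, Γ.zero_mem, by simp [h0]⟩
  obtain ⟨u, hu⟩ := h.room_fst.exists_notMem (h.torsionFree.fst_ne_zero hγ h0)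
  set W := Submodule.span E {γ} with hW
  have hWfg : W.FG := Submodule.fg_span_singleton γ
  have hγW : γ ∈ W := Submodule.mem_span_singleton_self γ
  have hWΓ : W ≤ Γ := (Submodule.span_singleton_le_iff_mem _ _).2 hγ
  have hu' : u ∉ spanImg D₁ (LinearMap.fst E V₁ V₂) W := fun hu' => hu (spanImg_mono hWΓ hu')
  have hy : (u, d • γ.2) ∉ W := fun hy => hu' (mem_spanImg hy)
  have e1 := finrank_sup_span_singleton hWfg hy
  have e2 := finrank_sup_span_singleton (spanImg_fg hWfg) hu'
  have e3 : spanImg D₂ (LinearMap.snd E V₁ V₂) (W ⊔ Submodule.span E {(u, d • γ.2)}) =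
      spanImg D₂ (LinearMap.snd E V₁ V₂) W := by
    rw [spanImg_sup, spanImg_span_singleton (u, d • γ.2), sup_eq_left,
      Submodule.span_singleton_le_iff_mem]
    exact Submodule.smul_mem _ d (mem_spanImg hγW)
  have e4 : spanImg D₁ (LinearMap.fst E V₁ V₂) (W ⊔ Submodule.span E {(u, d • γ.2)}) =
      spanImg D₁ (LinearMap.fst E V₁ V₂) W ⊔ Submodule.span D₁ {u} := by
    rw [spanImg_sup, spanImg_span_singleton (u, d • γ.2)]
    rfl
  obtain ⟨g₁, g₂, hg, hgΓ⟩ := exists_extension h.torsionFree h.algebraic h.maximal h.room_fst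
    h.room_snd (W := W) (W₂ := W ⊔ Submodule.span E {(u, d • γ.2)}) le_sup_left
    (hWfg.sup (Submodule.fg_span_singleton _)) LinearMap.id LinearMap.id (fun x hx => hWΓ hx)
    (by rw [coordDim, coordDim, e1, e3, e4, e2]; lia)
    (fun Y hY hY' => by
      have h1 := finrank_lt_of_lt_of_fg
        (fg_of_le (hWfg.sup (Submodule.fg_span_singleton _)) hY'.le) hY
      have h2 := finrank_lt_of_lt_of_fg (hWfg.sup (Submodule.fg_span_singleton _)) hY'
      lia)
  refine ⟨_, hgΓ _ (Submodule.mem_sup_right (Submodule.mem_span_singleton_self _)), ?_⟩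
  have := congrArg Prod.snd (hg γ hγW)
  simp only [pairMap_apply, LinearMap.id_apply] at this
  simp [this]

/-- Closed subspaces carry pairs of maps moving a nonzero vector to any prescribed vector. -/
lemma exists_pairMap_apply_eq {x y : V₁ × V₂} (hx : x ≠ 0) (hy : y ∈ Γ) (W : Submodule E (V₁ × V₂))
    (hWΓ : W ≤ Γ) (hW : W.FG) (hcl : coordDim D₁ D₂ W ≤ finrank E W + 1) (hxW : x ∈ W) :
    ∃ (g₁ : V₁ →ₗ[D₁] V₁) (g₂ : V₂ →ₗ[D₂] V₂),
      (∀ z ∈ W, pairMap (E := E) g₁ g₂ z ∈ Γ) ∧ pairMap (E := E) g₁ g₂ x = y := by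
  classical
  induction hn : finrank E W using Nat.strong_induction_on generalizing W with
  | _ n ih =>
    set X := Submodule.span E {x} with hX
    have hXW : X ≤ W := (Submodule.span_singleton_le_iff_mem _ _).2 hxW
    by_cases hXeq : X = W
    · obtain ⟨g₁, hg₁⟩ := exists_linearMap_of_linearIndependent (D := D₁)
        (b := fun _ : Unit => x.1) (.of_subsingleton ()
          (h.torsionFree.fst_ne_zero (hWΓ hxW) hx)) fun _ => y.1
      obtain ⟨g₂, hg₂⟩ := exists_linearMap_of_linearIndependent (D := D₂)
        (b := fun _ : Unit => x.2) (.of_subsingleton ()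
          (h.torsionFree.snd_ne_zero (hWΓ hxW) hx)) fun _ => y.2
      have hgx : pairMap (E := E) g₁ g₂ x = y := Prod.ext (hg₁ ()) (hg₂ ())
      refine ⟨g₁, g₂, ?_, hgx⟩
      rw [← hXeq]
      change X ≤ Γ.comap (pairMap g₁ g₂)
      rw [hX, Submodule.span_singleton_le_iff_mem, Submodule.mem_comap, hgx]
      exact hy
    · let P : ℕ → Prop := fun m => ∃ Y : Submodule E (V₁ × V₂), X ≤ Y ∧ Y < W ∧
        coordDim D₁ D₂ Y ≤ finrank E Y + 1 ∧ finrank E Y = m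
      have hP1 : P 1 := ⟨X, le_rfl, lt_of_le_of_ne hXW hXeq,
        (coordDim_span_singleton_le x).trans (by rw [finrank_span_singleton hx]),
        finrank_span_singleton hx⟩
      have hPb : ∀ m, P m → m ≤ n := by
        rintro m ⟨Y, -, hYW, -, rfl⟩
        rw [← hn]
        exact (finrank_lt_of_lt_of_fg hW hYW).le
      obtain ⟨Y, hXY, hYW, hYcl, hYm⟩ := Nat.findGreatest_spec (hPb 1 hP1) hP1
      have hYmax : ∀ Z, X ≤ Z → Z < W → coordDim D₁ D₂ Z ≤ finrank E Z + 1 →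
          finrank E Z ≤ finrank E Y := fun Z h1 h2 h3 => by
        rw [hYm]
        exact Nat.le_findGreatest (hPb _ ⟨Z, h1, h2, h3, rfl⟩) ⟨Z, h1, h2, h3, rfl⟩
      have hYfg : Y.FG := fg_of_le hW hYW.le
      have hxY : x ∈ Y := hXY (Submodule.mem_span_singleton_self x)
      obtain ⟨f₁, f₂, hf, hfx⟩ := ih _ (hn ▸ finrank_lt_of_lt_of_fg hW hYW) Y (hYW.le.trans hWΓ)
        hYfg hYcl hxY rfl
      have hne : ∀ {Z : Submodule E (V₁ × V₂)}, x ∈ Z → Z ≠ ⊥ := fun hZ hZ0 => hx (by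
        rw [hZ0] at hZ
        exact (Submodule.mem_bot E).1 hZ)
      have t1 := h.torsionFree W hWΓ hW (hne hxW)
      have t2 := h.torsionFree Y (hYW.le.trans hWΓ) hYfg (hne hxY)
      obtain ⟨g₁, g₂, hg, hgΓ⟩ := exists_extension h.torsionFree h.algebraic h.maximal h.room_fst
        h.room_snd hYW.le hW f₁ f₂ hf (by lia) (fun Z hZ hZ' => by
          have h1 := finrank_lt_of_lt_of_fg (fg_of_le hW hZ'.le) hZ
          by_contra hcon
          have := hYmax Z (hXY.trans hZ.le) hZ' (by lia)
          lia)
      exact ⟨g₁, g₂, hgΓ, (hg x hxY).trans hfx⟩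

/-- The space is homogeneous under maps which are linear in both coordinates. -/
theorem exists_endomorphism {x y : V₁ × V₂} (hxΓ : x ∈ Γ) (hx : x ≠ 0) (hy : y ∈ Γ) :
    ∃ T : Γ → Γ, (T ⟨x, hxΓ⟩ : V₁ × V₂) = y ∧ ∀ s : Finset Γ,
      ∃ (g₁ : V₁ →ₗ[D₁] V₁) (g₂ : V₂ →ₗ[D₂] V₂), ∀ z ∈ s,
        (T z : V₁ × V₂) = pairMap (E := E) g₁ g₂ z := by
  classical
  let IsGood (W : Submodule E (V₁ × V₂)) (g₁ : V₁ →ₗ[D₁] V₁) (g₂ : V₂ →ₗ[D₂] V₂) : Prop :=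
    W ≤ Γ ∧ W.FG ∧ coordDim D₁ D₂ W ≤ finrank E W + 1 ∧ x ∈ W ∧
      (∀ z ∈ W, pairMap (E := E) g₁ g₂ z ∈ Γ) ∧ pairMap (E := E) g₁ g₂ x = y
  have hgood (W : Submodule E (V₁ × V₂)) (hWΓ : W ≤ Γ) (hW : W.FG) :
      ∃ W' g₁ g₂, IsGood W' g₁ g₂ ∧ W ≤ W' := by
    obtain ⟨W', h1, h2, h3, h4⟩ := h.exists_closed_ge
      (sup_le hWΓ ((Submodule.span_singleton_le_iff_mem x Γ).2 hxΓ))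
      (hW.sup (Submodule.fg_span_singleton x))
    have hxW : x ∈ W' := h4 (Submodule.mem_sup_right (Submodule.mem_span_singleton_self x))
    obtain ⟨g₁, g₂, h5, h6⟩ := h.exists_pairMap_apply_eq hx hy W' h1 h2 h3 hxW
    exact ⟨W', g₁, g₂, ⟨h1, h2, h3, hxW, h5, h6⟩, le_sup_left.trans h4⟩
  have huniq {W W' : Submodule E (V₁ × V₂)} {g₁ g₁' g₂ g₂'} (hg : IsGood W g₁ g₂)
      (hg' : IsGood W' g₁' g₂') (hWW' : W ≤ W') :
      ∀ z ∈ W, pairMap (E := E) g₁ g₂ z = pairMap (E := E) g₁' g₂' z := by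
    intro z hz
    have hsub (t : V₁ × V₂) : pairMap (E := E) (g₁ - g₁') (g₂ - g₂') t =
      pairMap (E := E) g₁ g₂ t - pairMap (E := E) g₁' g₂' t := rfl
    have := h.torsionFree.pairMap_eq_zero hg.1 hg.2.1 hg.2.2.1 (f₁ := g₁ - g₁') (f₂ := g₂ - g₂')
      (fun t ht => by
        rw [hsub]
        exact Γ.sub_mem (hg.2.2.2.2.1 t ht) (hg'.2.2.2.2.1 t (hWW' ht)))
      hg.2.2.2.1 hx (by rw [hsub, hg.2.2.2.2.2, hg'.2.2.2.2.2, sub_self]) z hz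
    exact sub_eq_zero.1 this
  have hpt : ∀ z : Γ, ∃ v : Γ, ∀ W g₁ g₂, IsGood W g₁ g₂ → (z : V₁ × V₂) ∈ W →
      (v : V₁ × V₂) = pairMap (E := E) g₁ g₂ z := by
    intro z
    obtain ⟨W, g₁, g₂, hg, hzW⟩ := hgood _ ((Submodule.span_singleton_le_iff_mem _ Γ).2 z.2)
      (Submodule.fg_span_singleton (z : V₁ × V₂))
    have hz : (z : V₁ × V₂) ∈ W := hzW (Submodule.mem_span_singleton_self _)
    refine ⟨⟨_, hg.2.2.2.2.1 z hz⟩, fun W' g₁' g₂' hg' hz' => ?_⟩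
    obtain ⟨W'', g₁'', g₂'', hg'', hle⟩ := hgood (W ⊔ W') (sup_le hg.1 hg'.1)
      (hg.2.1.sup hg'.2.1)
    exact (huniq hg hg'' (le_sup_left.trans hle) z hz).trans
      (huniq hg' hg'' (le_sup_right.trans hle) z hz').symm
  choose T hT using hpt
  have hfin : ∀ s : Finset Γ, ∃ W g₁ g₂, IsGood W g₁ g₂ ∧ ∀ z ∈ s, (z : V₁ × V₂) ∈ W := by
    intro s
    obtain ⟨W, g₁, g₂, hg, hle⟩ := hgood (Submodule.span E (Subtype.val '' (s : Set Γ)))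
      (Submodule.span_le.2 (by rintro _ ⟨z, -, rfl⟩; exact z.2))
      (Submodule.fg_span (s.finite_toSet.image _))
    exact ⟨W, g₁, g₂, hg, fun z hz => hle (Submodule.subset_span ⟨z, hz, rfl⟩)⟩
  refine ⟨T, ?_, fun s => ?_⟩
  · obtain ⟨W, g₁, g₂, hg, hz⟩ := hfin ∅
    rw [hT ⟨x, hxΓ⟩ W g₁ g₂ hg hg.2.2.2.1]
    exact hg.2.2.2.2.2
  · obtain ⟨W, g₁, g₂, hg, hz⟩ := hfin s
    exact ⟨g₁, g₂, fun z hzs => hT z W g₁ g₂ hg (hz z hzs)⟩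

end IsMaximalSpace

end

end HughesFree

namespace HughesFree

section

open Module

universe w

lemma exists_module_of_injective {D X V : Type*} [Ring D] [AddCommGroup X] [AddCommGroup V]
    [Module D V] (j : X →+ V) (hj : Function.Injective j) (h : ∀ (d : D) x, ∃ x', j x' = d • j x) :
    ∃ _ : Module D X, ∀ (d : D) x, j (d • x) = d • j x := by
  choose s hs using h
  let _ : SMul D X := ⟨s⟩
  exact ⟨hj.module D j hs, hs⟩

lemma finrank_span_eq_of_injective {E D X V : Type*} [DivisionRing E] [DivisionRing D]
    [AddCommGroup X] [AddCommGroup V] [Module E X] [Module D X] [Module E V] [Module D V]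
    {p : X →ₗ[E] V} {j : X →ₗ[D] V} (hj : Function.Injective j) (hp : ∀ x, p x = j x)
    (W : Submodule E X) :
    finrank D (Submodule.span D (W : Set X)) = finrank D (spanImg D p W) := by
  have : spanImg D p W = (Submodule.span D (W : Set X)).map j := by
    rw [Submodule.map_span, spanImg]
    simp only [hp]
  rw [this]
  exact (LinearEquiv.finrank_eq (Submodule.equivMapOfInjective j hj _))

theorem exists_homogeneous_module (E D₁ D₂ : Type w) [DivisionRing E] [DivisionRing D₁]
    [DivisionRing D₂] [Module E D₁] [Module E D₂] [IsScalarTower E D₁ D₁]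
    [IsScalarTower E D₂ D₂] :
    ∃ (V : Type w) (_ : AddCommGroup V) (_ : Module E V) (_ : Module D₁ V) (_ : Module D₂ V),
      IsScalarTower E D₁ V ∧ IsScalarTower E D₂ V ∧ Nontrivial V ∧
      (∀ W : Submodule E V, W.FG → W ≠ ⊥ → finrank E W + 1 ≤
        finrank D₁ (Submodule.span D₁ (W : Set V)) + finrank D₂ (Submodule.span D₂ (W : Set V))) ∧
      ∀ x y : V, x ≠ 0 → ∃ T : V →+ V, (∀ (d : D₁) v, T (d • v) = d • T v) ∧
        (∀ (d : D₂) v, T (d • v) = d • T v) ∧ T x = y := by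
  classical
  let I := Set (PairCode D₁ D₂)
  let γ₀ : (I →₀ D₁) × (I →₀ D₂) := (Finsupp.single ∅ 1, Finsupp.single ∅ 1)
  have h1 : γ₀.1 ≠ 0 := Finsupp.single_ne_zero.2 one_ne_zero
  have h2 : γ₀.2 ≠ 0 := Finsupp.single_ne_zero.2 one_ne_zero
  have h0 : γ₀ ≠ 0 := fun h => h1 (by rw [h]; rfl)
  obtain ⟨Γ, hTF, hAlg, hmax⟩ := exists_maximal_torsionFree (E := E) (D₁ := D₁) (D₂ := D₂) h1 h2
  have hroom := hasRoom_of_torsionFree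
    (by rw [Cardinal.mk_set]; exact Cardinal.cantor _) hTF hAlg h0
  have hΓ : IsMaximalSpace D₁ D₂ γ₀ Γ := ⟨hTF, hAlg, hmax, hroom.1, hroom.2⟩
  let j₁ : Γ →ₗ[E] (I →₀ D₁) := LinearMap.fst E _ _ ∘ₗ Γ.subtype
  let j₂ : Γ →ₗ[E] (I →₀ D₂) := LinearMap.snd E _ _ ∘ₗ Γ.subtype
  have hj₁ : Function.Injective j₁ := (injective_iff_map_eq_zero (G := Γ) j₁).2 fun x hx => by
    by_contra hne
    exact hTF.fst_ne_zero x.2 (fun h => hne (Subtype.ext h)) hx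
  have hj₂ : Function.Injective j₂ := (injective_iff_map_eq_zero (G := Γ) j₂).2 fun x hx => by
    by_contra hne
    exact hTF.snd_ne_zero x.2 (fun h => hne (Subtype.ext h)) hx
  obtain ⟨M₁, hM₁⟩ := exists_module_of_injective (D := D₁) j₁.toAddMonoidHom hj₁ fun (d : D₁)
    (x : Γ) => by
    obtain ⟨γ, hγ, h⟩ := hΓ.exists_smul_fst x.2 d
    exact ⟨⟨γ, hγ⟩, h⟩
  obtain ⟨M₂, hM₂⟩ := exists_module_of_injective (D := D₂) j₂.toAddMonoidHom hj₂ fun (d : D₂)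
    (x : Γ) => by
    obtain ⟨γ, hγ, h⟩ := hΓ.exists_smul_snd x.2 d
    exact ⟨⟨γ, hγ⟩, h⟩
  let l₁ : Γ →ₗ[D₁] (I →₀ D₁) := { j₁.toAddMonoidHom with map_smul' := hM₁ }
  let l₂ : Γ →ₗ[D₂] (I →₀ D₂) := { j₂.toAddMonoidHom with map_smul' := hM₂ }
  refine ⟨Γ, inferInstance, inferInstance, M₁, M₂, ⟨fun e d x => hj₁ ?_⟩, ⟨fun e d x => hj₂ ?_⟩,
    ⟨⟨γ₀, hΓ.base_mem⟩, 0, fun h => h0 (congrArg Subtype.val h)⟩, fun W hW hW0 => ?_,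
    fun x y hx => ?_⟩
  · exact (hM₁ _ _).trans ((smul_assoc e d (j₁ x)).trans
      ((congrArg (e • ·) (hM₁ d x).symm).trans (j₁.map_smul e (d • x)).symm))
  · exact (hM₂ _ _).trans ((smul_assoc e d (j₂ x)).trans
      ((congrArg (e • ·) (hM₂ d x).symm).trans (j₂.map_smul e (d • x)).symm))
  · rw [finrank_span_eq_of_injective (p := j₁) (j := l₁) hj₁ (fun _ => rfl),
      finrank_span_eq_of_injective (p := j₂) (j := l₂) hj₂ (fun _ => rfl)]
    have e1 : spanImg D₁ j₁ W = spanImg D₁ (LinearMap.fst E (I →₀ D₁) (I →₀ D₂))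
        (W.map Γ.subtype) := by
      rw [spanImg, spanImg, Submodule.map_coe, Set.image_image]
      rfl
    have e2 : spanImg D₂ j₂ W = spanImg D₂ (LinearMap.snd E (I →₀ D₁) (I →₀ D₂))
        (W.map Γ.subtype) := by
      rw [spanImg, spanImg, Submodule.map_coe, Set.image_image]
      rfl
    rw [e1, e2, ← Submodule.finrank_map_subtype_eq Γ W]
    refine hTF _ (Submodule.map_subtype_le Γ W) (hW.map _) fun h => hW0 ?_
    exact Submodule.map_injective_of_injective Γ.injective_subtype
      (h.trans (Submodule.map_bot _).symm)
  · obtain ⟨T, hTx, hT⟩ := hΓ.exists_endomorphism x.2 (fun h => hx (Subtype.ext h)) y.2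
    refine ⟨AddMonoidHom.mk' T fun a b => Subtype.ext ?_, fun d v => hj₁ ?_, fun d v => hj₂ ?_,
      Subtype.ext hTx⟩
    · obtain ⟨g₁, g₂, hg⟩ := hT {a, b, a + b}
      rw [Submodule.coe_add, hg a (by simp), hg b (by simp), hg (a + b) (by simp),
        Submodule.coe_add, map_add]
    · obtain ⟨g₁, g₂, hg⟩ := hT {v, d • v}
      have hv : j₁ (T v) = g₁ (j₁ v) := congrArg Prod.fst (hg v (by simp))
      have hdv : j₁ (T (d • v)) = g₁ (j₁ (d • v)) := congrArg Prod.fst (hg (d • v) (by simp))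
      refine hdv.trans (((congrArg g₁ (hM₁ d v)).trans (map_smul g₁ d _)).trans ?_)
      exact (congrArg (d • ·) hv.symm).trans (hM₁ d (T v)).symm
    · obtain ⟨g₁, g₂, hg⟩ := hT {v, d • v}
      have hv : j₂ (T v) = g₂ (j₂ v) := congrArg Prod.snd (hg v (by simp))
      have hdv : j₂ (T (d • v)) = g₂ (j₂ (d • v)) := congrArg Prod.snd (hg (d • v) (by simp))
      refine hdv.trans (((congrArg g₂ (hM₂ d v)).trans (map_smul g₂ d _)).trans ?_)
      exact (congrArg (d • ·) hv.symm).trans (hM₂ d (T v)).symm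

end

end HughesFree

namespace HughesFree

section

section CommonCoefficients

universe w

open RExpr

variable {k C : Type*} [DivisionRing k] [Group C] {D₁ D₂ : Type w} [DivisionRing D₁]
  [DivisionRing D₂]

/-- The pairs of values of the rational expressions under two coefficient representations. -/
def valuePairs (ρ₁ : CoeffRep k C D₁) (ρ₂ : CoeffRep k C D₂) : Subring (D₁ × D₂) where
  carrier := {p | ∃ e : RExpr k C, (eval ρ₁.val e, eval ρ₂.val e) = p}
  mul_mem' := by
    rintro _ _ ⟨e, rfl⟩ ⟨e', rfl⟩
    exact ⟨e.mul e', rfl⟩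
  add_mem' := by
    rintro _ _ ⟨e, rfl⟩ ⟨e', rfl⟩
    exact ⟨e.add e', rfl⟩
  one_mem' := ⟨atom 1 1, by simp [eval, CoeffRep.val]⟩
  zero_mem' := ⟨atom 0 1, by simp [eval, CoeffRep.val]⟩
  neg_mem' := by
    rintro _ ⟨e, rfl⟩
    exact ⟨(atom (-1) 1).mul e, by simp [eval, CoeffRep.val]⟩

theorem exists_common_coefficients (hC : LocallyIndicable C) (ρ₁ : CoeffRep k C D₁)
    (ρ₂ : CoeffRep k C D₂) (h₁ : HasExpansions ρ₁) (h₂ : HasExpansions ρ₂) :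
    ∃ (E : Type w) (_ : DivisionRing E) (i₁ : E →+* D₁) (i₂ : E →+* D₂),
      (∀ x : E, ∃ e, i₁ x = eval ρ₁.val e ∧ i₂ x = eval ρ₂.val e) ∧
      ∀ c g, ∃ x : E, i₁ x = ρ₁.val c g ∧ i₂ x = ρ₂.val c g := by
  have hunit : ∀ x : valuePairs ρ₁ ρ₂, IsUnit x ∨ x = 0 := by
    rintro ⟨_, e, rfl⟩
    have hiff := eval_eq_zero_iff hC ρ₁ ρ₂ h₁ h₂ e
    by_cases h : eval ρ₁.val e = 0
    · exact Or.inr (Subtype.ext (Prod.ext h (hiff.1 h)))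
    · have h' := mt hiff.2 h
      refine Or.inl (isUnit_iff_exists.2 ⟨⟨_, e.inv, rfl⟩, Subtype.ext (Prod.ext ?_ ?_),
        Subtype.ext (Prod.ext ?_ ?_)⟩)
      · simpa [eval] using mul_inv_cancel₀ h
      · simpa [eval] using mul_inv_cancel₀ h'
      · simpa [eval] using inv_mul_cancel₀ h
      · simpa [eval] using inv_mul_cancel₀ h'
  refine ⟨valuePairs ρ₁ ρ₂, DivisionRing.ofIsUnitOrEqZero hunit,
    (RingHom.fst D₁ D₂).comp (valuePairs ρ₁ ρ₂).subtype,
    (RingHom.snd D₁ D₂).comp (valuePairs ρ₁ ρ₂).subtype, ?_, fun c g =>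
    ⟨⟨_, atom c g, rfl⟩, rfl, rfl⟩⟩
  rintro ⟨_, e, rfl⟩
  exact ⟨e, rfl, rfl⟩

end CommonCoefficients

end

end HughesFree

namespace HughesFree

section

/-- The centralizer of a set of endomorphisms acting transitively is a division ring. -/
lemma isUnit_or_eq_zero_of_transitive {V : Type*} [AddCommGroup V] (F : Set (AddMonoid.End V))
    (hF : ∀ x y : V, x ≠ 0 → ∃ T ∈ F, T x = y) (s : Subring.centralizer F) :
    IsUnit s ∨ s = 0 := by
  by_cases h0 : s = 0
  · exact Or.inr h0
  left
  have hc : ∀ T ∈ F, ∀ v, s.1 (T v) = T (s.1 v) := fun T hT v =>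
    (DFunLike.congr_fun (Subring.mem_centralizer_iff.1 s.2 T hT) v).symm
  obtain ⟨v, hv⟩ : ∃ v, s.1 v ≠ 0 := by
    by_contra! h
    exact h0 (Subtype.ext (AddMonoidHom.ext h))
  have hinj : Function.Injective s.1 := (injective_iff_map_eq_zero s.1).2 fun x hx => by
    by_contra hne
    obtain ⟨T, hT, rfl⟩ := hF x v hne
    exact hv (by rw [hc T hT, hx, map_zero])
  have hsurj : Function.Surjective s.1 := fun y => by
    obtain ⟨T, hT, rfl⟩ := hF _ y hv
    exact ⟨T v, hc T hT v⟩
  let e := AddEquiv.ofBijective s.1 ⟨hinj, hsurj⟩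
  have he : ∀ v, s.1 (e.symm v) = v := e.apply_symm_apply
  refine isUnit_iff_exists.2 ⟨⟨e.symm.toAddMonoidHom, Subring.mem_centralizer_iff.2 fun T hT =>
    AddMonoidHom.ext fun v => hinj ?_⟩, Subtype.ext (AddMonoidHom.ext he),
    Subtype.ext (AddMonoidHom.ext e.symm_apply_apply)⟩
  change s.1 (T (e.symm v)) = s.1 (e.symm (T v))
  rw [hc T hT, he, he]

universe v

variable {A B C G : Type v} [Group A] [Group B] [Group C] [Group G] {f : C →* A} {g : C →* B}
  {jA : A →* G} {jB : B →* G}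

/-- The universal property of a pushout of groups, for groups in an arbitrary universe. -/
lemma exists_hom_of_pushout
    (huniv : ∀ (P : Type v) [Group P] (pA : A →* P) (pB : B →* P),
      pA.comp f = pB.comp g → ∃! h : G →* P, h.comp jA = pA ∧ h.comp jB = pB)
    {Q : Type*} [Group Q] (pA : A →* Q) (pB : B →* Q) (h : pA.comp f = pB.comp g) :
    ∃ h : G →* Q, h.comp jA = pA ∧ h.comp jB = pB := by
  let L := Monoid.Coprod.lift pA pB
  obtain ⟨h, ⟨h1, h2⟩, -⟩ := huniv (Monoid.Coprod A B ⧸ L.ker)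
    ((QuotientGroup.mk' L.ker).comp Monoid.Coprod.inl)
    ((QuotientGroup.mk' L.ker).comp Monoid.Coprod.inr) (by
      ext c
      refine QuotientGroup.eq.2 (L.mem_ker.2 ?_)
      have := DFunLike.congr_fun h c
      simpa [L, inv_mul_eq_one] using this)
  refine ⟨(QuotientGroup.kerLift L).comp h, ?_, ?_⟩
  · rw [MonoidHom.comp_assoc, h1]
    ext a
    simp [L]
  · rw [MonoidHom.comp_assoc, h2]
    ext a
    simp [L]

lemma range_sup_range_eq_top_of_pushout (hcomm : jA.comp f = jB.comp g)
    (huniv : ∀ (P : Type v) [Group P] (pA : A →* P) (pB : B →* P),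
      pA.comp f = pB.comp g → ∃! h : G →* P, h.comp jA = pA ∧ h.comp jB = pB) :
    jA.range ⊔ jB.range = ⊤ := by
  let N := jA.range ⊔ jB.range
  obtain ⟨h, ⟨h1, h2⟩, -⟩ := huniv N
    (jA.codRestrict N fun a => (le_sup_left : jA.range ≤ N) ⟨a, rfl⟩)
    (jB.codRestrict N fun b => (le_sup_right : jB.range ≤ N) ⟨b, rfl⟩)
    (MonoidHom.ext fun c => Subtype.ext (DFunLike.congr_fun hcomm c))
  have := (huniv G jA jB hcomm).unique (y₁ := N.subtype.comp h) (y₂ := MonoidHom.id G)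
    ⟨by rw [MonoidHom.comp_assoc, h1]; rfl, by rw [MonoidHom.comp_assoc, h2]; rfl⟩ ⟨rfl, rfl⟩
  exact eq_top_iff.2 fun x _ => by
    have hx := DFunLike.congr_fun this x
    rw [← show (h x : G) = x from hx]
    exact (h x).2

end

end HughesFree

namespace HughesFree

section

open Module

section Translates

variable {k A C D G V : Type*} [DivisionRing k] [Group A] [Group C] [DivisionRing D] [Group G]
  [AddCommGroup V] [Module D V]

lemma coeff_eq_zero_of_linearIndepOn (hA : LocallyIndicable A) (ρ : CoeffRep k A D)
    (hρ : HasExpansions ρ) (f : C →* A) (j : A →* G) (v : G → V)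
    (hv : ∀ a x, v (j a * x) = ρ.grp a • v x) {F R : Finset G}
    (hF : ∀ x ∈ F, ∀ y ∈ F, x * y⁻¹ ∈ (j.comp f).range → x = y)
    (hR : LinearIndepOn D v (R : Set G)) (hcov : ∀ x ∈ F, ∃ r ∈ R, x * r⁻¹ ∈ j.range)
    (e : G → D) (he : ∀ x, ∃ a, InK (ρ.comap f).val (ρ.comap f).val a (e x, e x))
    (hsum : ∑ x ∈ F, e x • v x = 0) : ∀ x ∈ F, e x = 0 := by
  classical
  have hcov' : ∀ x, ∃ r a, x ∈ F → r ∈ R ∧ j a * r = x := fun x => by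
    by_cases hx : x ∈ F
    · obtain ⟨r, hr, a, ha⟩ := hcov x hx
      exact ⟨r, a, fun _ => ⟨hr, by rw [ha, inv_mul_cancel_right]⟩⟩
    · exact ⟨1, 1, fun h => absurd h hx⟩
  choose r α hrα using hcov'
  choose θ hθ using he
  have hfib : ∑ s ∈ R, (∑ x ∈ F with r x = s, e x * ρ.grp (α x)) • v s = 0 := by
    rw [← hsum, ← Finset.sum_fiberwise_of_maps_to fun x hx => (hrα x hx).1]
    refine Finset.sum_congr rfl fun s _ => ?_
    rw [Finset.sum_smul]
    refine Finset.sum_congr rfl fun x hx => ?_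
    obtain ⟨hxF, rfl⟩ := Finset.mem_filter.1 hx
    rw [mul_smul, ← hv, (hrα x hxF).2]
  have hinner := linearIndepOn_finset_iff.1 hR _ hfib
  intro x hx
  refine eq_zero_of_sum_translates hA ρ hρ f (ι := {y // y ∈ F.filter (r · = r x)})
    (fun y => θ y) (fun y => e y) (fun y => α y) (fun y => hθ y) ?_ ?_
    ⟨x, Finset.mem_filter.2 ⟨hx, rfl⟩⟩
  · rintro ⟨y, hy⟩ ⟨z, hz⟩ hne ⟨c, hc⟩
    obtain ⟨hyF, hry⟩ := Finset.mem_filter.1 hy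
    obtain ⟨hzF, hrz⟩ := Finset.mem_filter.1 hz
    refine hne (Subtype.ext (hF y hyF z hzF ⟨c, ?_⟩))
    rw [← (hrα y hyF).2, ← (hrα z hzF).2, hry, hrz, MonoidHom.comp_apply, hc, map_mul, map_inv]
    group
  · exact (Finset.sum_coe_sort (F.filter (r · = r x)) fun y => e y * ρ.grp (α y)).trans
      (hinner _ (hrα x hx).1)

end Translates

section TreeFamily

variable {E D₁ D₂ G V : Type*} [DivisionRing E] [DivisionRing D₁] [DivisionRing D₂] [Group G]
  [AddCommGroup V] [Module E V] [Module D₁ V] [Module D₂ V]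

lemma finrank_span_le_of_cover {D : Type*} [DivisionRing D] [Module D V] [SMul E D]
    [IsScalarTower E D V] {v : G → V} {H : Subgroup G}
    (hv : ∀ h ∈ H, ∀ x, ∃ d : D, v (h * x) = d • v x) {F R : Finset G}
    (hcov : ∀ x ∈ F, ∃ r ∈ R, x * r⁻¹ ∈ H) :
    finrank D (Submodule.span D (Submodule.span E (v '' F) : Set V)) ≤
      finrank D (Submodule.span D (v '' R)) := by
  refine finrank_mono_of_fg (Submodule.fg_span (R.finite_toSet.image v)) ?_
  rw [Submodule.span_span_of_tower, Submodule.span_le]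
  rintro _ ⟨x, hx, rfl⟩
  obtain ⟨r, hr, h⟩ := hcov x hx
  obtain ⟨d, hd⟩ := hv _ h r
  rw [inv_mul_cancel_right] at hd
  rw [hd]
  exact Submodule.smul_mem _ _ (Submodule.subset_span ⟨r, hr, rfl⟩)

/-- A finite family of coset representatives whose images under the two subgroups form a tree. -/
structure IsTreeFamily (E : Type*) [DivisionRing E] [Module E V] (v : G → V)
    (N H₁ H₂ : Subgroup G) (F : Finset G) : Prop where
  one_mem : 1 ∈ F
  eq_of_mem : ∀ x ∈ F, ∀ y ∈ F, x * y⁻¹ ∈ N → x = y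
  linearIndepOn : LinearIndepOn E v (F : Set G)
  exists_cover : ∃ R₁ R₂ : Finset G, (∀ x ∈ F, ∃ r ∈ R₁, x * r⁻¹ ∈ H₁) ∧
    (∀ x ∈ F, ∃ r ∈ R₂, x * r⁻¹ ∈ H₂) ∧ R₁.card + R₂.card ≤ F.card + 1

namespace IsTreeFamily

variable {v : G → V} {N H₁ H₂ : Subgroup G} {F : Finset G}

lemma symm (hF : IsTreeFamily E v N H₁ H₂ F) : IsTreeFamily E v N H₂ H₁ F := by
  obtain ⟨R₁, R₂, h1, h2, h3⟩ := hF.exists_cover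
  exact ⟨hF.one_mem, hF.eq_of_mem, hF.linearIndepOn, R₂, R₁, h2, h1, by lia⟩

lemma singleton_one (h : v 1 ≠ 0) : IsTreeFamily E v N H₁ H₂ {1} := by
  refine ⟨by simp, by simp, ?_, {1}, {1}, by simp, by simp, by simp⟩
  rw [Finset.coe_singleton]
  exact LinearIndepOn.singleton h

lemma linearIndepOn_cover [SMul E D₁] [SMul E D₂] [IsScalarTower E D₁ V] [IsScalarTower E D₂ V]
    (hdim : ∀ W : Submodule E V, W.FG → W ≠ ⊥ → finrank E W + 1 ≤
      finrank D₁ (Submodule.span D₁ (W : Set V)) + finrank D₂ (Submodule.span D₂ (W : Set V)))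
    (hv₁ : ∀ h ∈ H₁, ∀ x, ∃ d : D₁, v (h * x) = d • v x)
    (hv₂ : ∀ h ∈ H₂, ∀ x, ∃ d : D₂, v (h * x) = d • v x)
    (hF : IsTreeFamily E v N H₁ H₂ F) {R₁ R₂ : Finset G}
    (h₁ : ∀ x ∈ F, ∃ r ∈ R₁, x * r⁻¹ ∈ H₁) (h₂ : ∀ x ∈ F, ∃ r ∈ R₂, x * r⁻¹ ∈ H₂)
    (hcard : R₁.card + R₂.card ≤ F.card + 1) : LinearIndepOn D₁ v (R₁ : Set G) := by
  classical
  have hrank : finrank E (Submodule.span E (v '' F)) = F.card := by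
    have := finrank_span_eq_card hF.linearIndepOn
    rw [Set.range_comp', Subtype.range_coe] at this
    rw [this]
    simp
  have hW := hdim (Submodule.span E (v '' F)) (Submodule.fg_span (F.finite_toSet.image v))
    fun h => by
      rw [h, finrank_bot] at hrank
      exact Finset.ne_empty_of_mem hF.one_mem (Finset.card_eq_zero.1 hrank.symm)
  have hle₁ := finrank_span_le_of_cover (E := E) hv₁ h₁
  have hle₂ := finrank_span_le_of_cover (E := E) hv₂ h₂
  have hR₂ : finrank D₂ (Submodule.span D₂ (v '' R₂)) ≤ R₂.card := by
    rw [← Finset.coe_image]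
    exact (finrank_span_finset_le_card (R := D₂) _).trans Finset.card_image_le
  refine linearIndependent_iff_card_le_finrank_span.2 ?_
  rw [Set.finrank, Set.range_comp', Subtype.range_coe]
  have : Fintype.card (R₁ : Set G) = R₁.card := by simp
  lia

variable {k A C : Type*} [DivisionRing k] [Group A] [Group C]

lemma insert_mul [DecidableEq G] [Module E D₁] [SMul E D₂] [IsScalarTower E D₁ V]
    [IsScalarTower E D₂ V]
    (hdim : ∀ W : Submodule E V, W.FG → W ≠ ⊥ → finrank E W + 1 ≤
      finrank D₁ (Submodule.span D₁ (W : Set V)) + finrank D₂ (Submodule.span D₂ (W : Set V)))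
    (hA : LocallyIndicable A) (ρ : CoeffRep k A D₁) (hρ : HasExpansions ρ) (f : C →* A)
    (hE : ∀ x : E, ∃ e, x • (1 : D₁) = RExpr.eval (ρ.comap f).val e)
    (j : A →* G) (hN : (j.comp f).range = N) (hH : j.range = H₁)
    (hv₁ : ∀ a x, v (j a * x) = ρ.grp a • v x)
    (hv₂ : ∀ h ∈ H₂, ∀ x, ∃ d : D₂, v (h * x) = d • v x)
    (hF : IsTreeFamily E v N H₁ H₂ F) {a h : G} (ha : a ∈ H₁) (hh : h ∈ F)
    (hnew : ∀ x ∈ F, a * h * x⁻¹ ∉ N) : IsTreeFamily E v N H₁ H₂ (insert (a * h) F) := by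
  subst hN hH
  obtain ⟨R₁, R₂, h₁, h₂, hcard⟩ := hF.exists_cover
  have hind := hF.linearIndepOn_cover hdim (by
    rintro _ ⟨a, rfl⟩ x
    exact ⟨_, hv₁ a x⟩) hv₂ h₁ h₂ hcard
  have hmem : a * h ∉ F := fun hm => hnew _ hm (by rw [mul_inv_cancel]; exact Subgroup.one_mem _)
  have heq : ∀ x ∈ insert (a * h) F, ∀ y ∈ insert (a * h) F,
      x * y⁻¹ ∈ (j.comp f).range → x = y := by
    intro x hx y hy hxy
    rcases Finset.mem_insert.1 hx with rfl | hx <;> rcases Finset.mem_insert.1 hy with rfl | hy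
    · rfl
    · exact absurd hxy (hnew y hy)
    · refine absurd (inv_mem hxy) ?_
      rw [mul_inv_rev, inv_inv]
      exact hnew x hx
    · exact hF.eq_of_mem x hx y hy hxy
  have hcov : ∀ x ∈ insert (a * h) F, ∃ r ∈ R₁, x * r⁻¹ ∈ j.range := by
    intro x hx
    rcases Finset.mem_insert.1 hx with rfl | hx
    · obtain ⟨r, hr, hr'⟩ := h₁ h hh
      exact ⟨r, hr, by rw [mul_assoc]; exact mul_mem ha hr'⟩
    · exact h₁ x hx
  refine ⟨Finset.mem_insert_of_mem hF.one_mem, heq, linearIndepOn_finset_iff.2 fun e he x hx => ?_,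
    R₁, insert (a * h) R₂, hcov, ?_, ?_⟩
  · have h0 := coeff_eq_zero_of_linearIndepOn hA ρ hρ f j v hv₁ heq hind hcov
      (fun x => e x • (1 : D₁)) (fun x => by
        obtain ⟨e', he'⟩ := hE (e x)
        exact ⟨_, Or.inr ⟨e', Order.lt_succ _, by rw [he']⟩⟩)
      (by simpa only [smul_assoc, one_smul] using he) x hx
    exact (smul_eq_zero.1 h0).resolve_right one_ne_zero
  · intro x hx
    rcases Finset.mem_insert.1 hx with rfl | hx
    · exact ⟨_, Finset.mem_insert_self _ _, by rw [mul_inv_cancel]; exact Subgroup.one_mem _⟩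
    · obtain ⟨r, hr, hr'⟩ := h₂ x hx
      exact ⟨r, Finset.mem_insert_of_mem hr, hr'⟩
  · have := Finset.card_insert_le (a * h) R₂
    rw [Finset.card_insert_of_notMem hmem]
    lia

end IsTreeFamily

end TreeFamily

end

end HughesFree

namespace HughesFree

section

open Module

section Cover

variable {G : Type*} [Group G] {H₁ H₂ N : Subgroup G}

@[elab_as_elim]
lemma induction_of_sup_eq_top (h : H₁ ⊔ H₂ = ⊤) {p : G → Prop} (one : p 1)
    (mul₁ : ∀ a ∈ H₁, ∀ x, p x → p (a * x)) (mul₂ : ∀ a ∈ H₂, ∀ x, p x → p (a * x)) (x : G) :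
    p x := by
  have hx : x ∈ Subgroup.closure ((H₁ : Set G) ∪ H₂) := by
    rw [← Subgroup.sup_eq_closure, h]
    exact Subgroup.mem_top x
  induction hx using Subgroup.closure_induction_left with
  | one => exact one
  | mul_left a ha y _ hy => exact ha.elim (fun h => mul₁ a h y hy) fun h => mul₂ a h y hy
  | inv_mul_cancel a ha y _ hy =>
    exact ha.elim (fun h => mul₁ _ (inv_mem h) y hy) fun h => mul₂ _ (inv_mem h) y hy

lemma exists_cover_step [DecidableEq G] {P : Finset G → Prop} {H : Subgroup G} (hN : N ≤ H)
    (step : ∀ F a h, P F → a ∈ H → h ∈ F → (∀ x ∈ F, a * h * x⁻¹ ∉ N) → P (insert (a * h) F))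
    {F : Finset G} {y : G} (hF : ∃ F', F ⊆ F' ∧ P F' ∧ ∃ x ∈ F', y * x⁻¹ ∈ N) {a : G} (ha : a ∈ H) :
    ∃ F', F ⊆ F' ∧ P F' ∧ ∃ x ∈ F', a * y * x⁻¹ ∈ N := by
  obtain ⟨F', hFF', hF', x, hx, hxN⟩ := hF
  by_cases hold : ∃ x ∈ F', a * y * x⁻¹ ∈ N
  · exact ⟨F', hFF', hF', hold⟩
  push Not at hold
  have hay : a * (y * x⁻¹) * x = a * y := by group
  refine ⟨insert (a * (y * x⁻¹) * x) F', hFF'.trans (Finset.subset_insert _ _),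
    step F' _ x hF' (mul_mem ha (hN hxN)) hx (by rwa [hay]), _, Finset.mem_insert_self _ _, ?_⟩
  rw [hay, mul_inv_cancel]
  exact one_mem _

lemma exists_cover [DecidableEq G] {P : Finset G → Prop} (h : H₁ ⊔ H₂ = ⊤) (hN₁ : N ≤ H₁)
    (hN₂ : N ≤ H₂) (hP : P {1}) (hP1 : ∀ F, P F → 1 ∈ F)
    (step₁ : ∀ F a h, P F → a ∈ H₁ → h ∈ F → (∀ x ∈ F, a * h * x⁻¹ ∉ N) → P (insert (a * h) F))
    (step₂ : ∀ F a h, P F → a ∈ H₂ → h ∈ F → (∀ x ∈ F, a * h * x⁻¹ ∉ N) → P (insert (a * h) F))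
    (T : Finset G) : ∃ F, P F ∧ ∀ t ∈ T, ∃ x ∈ F, t * x⁻¹ ∈ N := by
  induction T using Finset.induction_on with
  | empty => exact ⟨{1}, hP, by simp⟩
  | insert t T _ ih =>
    obtain ⟨F, hF, hTF⟩ := ih
    obtain ⟨F', hFF', hF', htF'⟩ : ∃ F', F ⊆ F' ∧ P F' ∧ ∃ x ∈ F', t * x⁻¹ ∈ N :=
      induction_of_sup_eq_top h
        (p := fun t => ∃ F', F ⊆ F' ∧ P F' ∧ ∃ x ∈ F', t * x⁻¹ ∈ N)
        ⟨F, subset_rfl, hF, 1, hP1 F hF, by simp⟩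
        (fun _ ha _ hy => exists_cover_step hN₁ step₁ hy ha)
        (fun _ ha _ hy => exists_cover_step hN₂ step₂ hy ha) t
    refine ⟨F', hF', fun s hs => ?_⟩
    rcases Finset.mem_insert.1 hs with rfl | hs
    · exact htF'
    · obtain ⟨x, hx, hxN⟩ := hTF s hs
      exact ⟨x, hFF' hx, hxN⟩

end Cover

lemma coeff_eq_zero_of_sum_smul {k A C D E G V : Type*} [DivisionRing k] [Group A] [Group C]
    [DivisionRing D] [DivisionRing E] [Group G] [AddCommGroup V] [Module D V] [Module E V]
    {φ : MonoidAlgebra k A →+* D} (hφ : Function.Injective φ) {f : C →* A}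
    (hf : Function.Injective f) (q : C →* G) (i : E →+* D) (y : k → C → E)
    (hy : ∀ l c, i (y l c) = φ (MonoidAlgebra.single (f c) l)) (v : G → V)
    (hv : ∀ l c x, (algRep φ).scalar l • v (q c * x) = y l c • v x) {T F : Finset G}
    (hF : LinearIndepOn E v (F : Set G)) (hcov : ∀ t ∈ T, ∃ x ∈ F, t * x⁻¹ ∈ q.range) (r : G → k)
    (hsum : ∑ t ∈ T, (algRep φ).scalar (r t) • v t = 0) : ∀ t ∈ T, r t = 0 := by
  classical
  have hcov' : ∀ t, ∃ x c, t ∈ T → x ∈ F ∧ q c * x = t := fun t => by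
    by_cases ht : t ∈ T
    · obtain ⟨x, hx, c, hc⟩ := hcov t ht
      exact ⟨x, c, fun _ => ⟨hx, by rw [hc, inv_mul_cancel_right]⟩⟩
    · exact ⟨1, 1, fun h => absurd h ht⟩
  choose s c hsc using hcov'
  have hfib : ∑ x ∈ F, (∑ t ∈ T with s t = x, y (r t) (c t)) • v x = 0 := by
    rw [← hsum, ← Finset.sum_fiberwise_of_maps_to fun t ht => (hsc t ht).1]
    refine Finset.sum_congr rfl fun x _ => ?_
    rw [Finset.sum_smul]
    refine Finset.sum_congr rfl fun t ht => ?_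
    obtain ⟨htT, rfl⟩ := Finset.mem_filter.1 ht
    rw [← hv, (hsc t htT).2]
  intro t ht
  have h0 := congrArg i (linearIndepOn_finset_iff.1 hF _ hfib _ (hsc t ht).1)
  simp only [map_sum, hy, map_zero] at h0
  rw [← map_sum, map_eq_zero_iff φ hφ] at h0
  have h1 := DFunLike.congr_fun (congrArg MonoidAlgebra.coeff h0) (f (c t))
  rw [MonoidAlgebra.coeff_sum, Finset.sum_apply', Finset.sum_eq_single t] at h1
  · simpa using h1
  · intro u hu hne
    obtain ⟨huT, hus⟩ := Finset.mem_filter.1 hu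
    refine Finsupp.single_eq_of_ne fun h => hne ?_
    rw [← (hsc u huT).2, ← (hsc t ht).2, hus, hf h.symm]
  · exact fun h => absurd (Finset.mem_filter.2 ⟨ht, rfl⟩ : t ∈ T.filter (s · = s t)) h

universe u v

theorem exists_embedding_of_pushout {k : Type u} [DivisionRing k]
    {A B C G : Type v} [Group A] [Group B] [Group C] [Group G]
    {f : C →* A} {g : C →* B} (hf : Function.Injective f) (hg : Function.Injective g)
    (hA : LocallyIndicable A) (hB : LocallyIndicable B) {jA : A →* G} {jB : B →* G}
    (hcomm : jA.comp f = jB.comp g)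
    (huniv : ∀ (P : Type v) [Group P] (pA : A →* P) (pB : B →* P),
      pA.comp f = pB.comp g → ∃! h : G →* P, h.comp jA = pA ∧ h.comp jB = pB)
    {DA DB : Type (max u v)} [DivisionRing DA] [DivisionRing DB] {φA : MonoidAlgebra k A →+* DA}
    {φB : MonoidAlgebra k B →+* DB} (hφA : IsHughesFreeEmbedding φA)
    (hφB : IsHughesFreeEmbedding φB) :
    ∃ (D : Type (max u v)) (_ : DivisionRing D) (φ : MonoidAlgebra k G →+* D),
      Function.Injective φ := by
  classical
  have hρA := hasExpansions_algRep hφA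
  have hρB := hasExpansions_algRep hφB
  set ρA := algRep φA
  set ρB := algRep φB
  obtain ⟨E, _, i₁, i₂, hE, hatom⟩ :=
    exists_common_coefficients (LocallyIndicable.of_injective hA f hf)
    (ρA.comap f) (ρB.comap g) (hρA.comap f hf) (hρB.comap g hg)
  let _ : Module E DA := Module.compHom DA i₁
  let _ : Module E DB := Module.compHom DB i₂
  have _ : IsScalarTower E DA DA := ⟨fun e d d' => mul_assoc (i₁ e) d d'⟩
  have _ : IsScalarTower E DB DB := ⟨fun e d d' => mul_assoc (i₂ e) d d'⟩
  obtain ⟨V, _, _, _, _, _, _, _, hdim, htrans⟩ := exists_homogeneous_module E DA DB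
  have hi₁ : ∀ (e : E) (x : V), i₁ e • x = e • x := fun e x => by
    rw [← smul_one_smul DA e x]
    exact congrArg (· • x) (mul_one (i₁ e)).symm
  have hi₂ : ∀ (e : E) (x : V), i₂ e • x = e • x := fun e x => by
    rw [← smul_one_smul DB e x]
    exact congrArg (· • x) (mul_one (i₂ e)).symm
  have hval : ∀ l c (x : V), (ρA.comap f).val l c • x = (ρB.comap g).val l c • x := fun l c x => by
    obtain ⟨e, h1, h2⟩ := hatom l c
    rw [← h1, ← h2, hi₁, hi₂]
  have hscalar : ∀ l (x : V), ρA.scalar l • x = ρB.scalar l • x := fun l x => by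
    simpa [CoeffRep.val, CoeffRep.comap] using hval l 1 x
  obtain ⟨h, hhA, hhB⟩ := exists_hom_of_pushout huniv
    ((toAddMonoidEnd DA V).toMonoidHom.comp ρA.grp).toHomUnits
    ((toAddMonoidEnd DB V).toMonoidHom.comp ρB.grp).toHomUnits (by
      ext c x
      change ρA.grp (f c) • x = ρB.grp (g c) • x
      simpa [CoeffRep.val, CoeffRep.comap] using hval 1 c x)
  let act : G →* AddMonoid.End V := (Units.coeHom _).comp h
  have hactA : ∀ a x, act (jA a) x = ρA.grp a • x := fun a x =>
    congrArg (fun u : (AddMonoid.End V)ˣ => u.1 x) (DFunLike.congr_fun hhA a)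
  have hactB : ∀ b x, act (jB b) x = ρB.grp b • x := fun b x =>
    congrArg (fun u : (AddMonoid.End V)ˣ => u.1 x) (DFunLike.congr_fun hhB b)
  have hact_mul : ∀ a b x, act (a * b) x = act a (act b x) := fun a b x => by
    rw [map_mul]; rfl
  have htop := range_sup_range_eq_top_of_pushout hcomm huniv
  let σ : k →+* AddMonoid.End V := (toAddMonoidEnd DA V).comp ρA.scalar
  have hσ : ∀ l x, σ l x = ρA.scalar l • x := fun l x => rfl
  have hcommute : ∀ l γ, Commute (σ l) (act γ) := fun l γ => by
    refine induction_of_sup_eq_top (p := fun γ => Commute (σ l) (act γ)) htop ?_ ?_ ?_ γ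
    · rw [map_one]
      exact Commute.one_right _
    · rintro _ ⟨a, rfl⟩ x hx
      rw [map_mul]
      refine Commute.mul_right (AddMonoidHom.ext fun w => ?_) hx
      change σ l (act (jA a) w) = act (jA a) (σ l w)
      rw [hactA, hactA, hσ, hσ, smul_smul, smul_smul, ρA.comm]
    · rintro _ ⟨b, rfl⟩ x hx
      rw [map_mul]
      refine Commute.mul_right (AddMonoidHom.ext fun w => ?_) hx
      change σ l (act (jB b) w) = act (jB b) (σ l w)
      rw [hactB, hactB, hσ, hσ, hscalar, hscalar, smul_smul, smul_smul, ρB.comm]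
  let φ : MonoidAlgebra k G →+* AddMonoid.End V := MonoidAlgebra.liftNCRingHom σ act hcommute
  have hφ : ∀ γ l x, φ (MonoidAlgebra.single γ l) x = ρA.scalar l • act γ x := fun γ l x => by
    rw [show φ (MonoidAlgebra.single γ l) = σ l * act γ from
      MonoidAlgebra.liftNCRingHom_single _ _ _ _ _]
    rfl
  let Φ : Set (AddMonoid.End V) := {T | (∀ (d : DA) x, T (d • x) = d • T x) ∧
    ∀ (d : DB) x, T (d • x) = d • T x}
  let S := Subring.centralizer Φ
  have hactS : ∀ γ, ∀ T ∈ Φ, ∀ x, T (act γ x) = act γ (T x) := fun γ T hT => by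
    refine induction_of_sup_eq_top (p := fun γ => ∀ x, T (act γ x) = act γ (T x)) htop ?_ ?_ ?_ γ
    · simp
    · rintro _ ⟨a, rfl⟩ γ hγ x
      rw [hact_mul, hact_mul, hactA, hactA, hT.1, hγ]
    · rintro _ ⟨b, rfl⟩ γ hγ x
      rw [hact_mul, hact_mul, hactB, hactB, hT.2, hγ]
  have hφS : ∀ r, φ r ∈ S := fun r => by
    induction r using MonoidAlgebra.induction_linear with
    | zero => rw [map_zero]; exact zero_mem _
    | add r s hr hs => rw [map_add]; exact add_mem hr hs
    | single γ l =>
      refine Subring.mem_centralizer_iff.2 fun T hT => AddMonoidHom.ext fun x => ?_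
      change T (φ _ x) = φ _ (T x)
      rw [hφ, hφ, hT.1, hactS γ T hT]
  obtain ⟨x₀, hx₀⟩ := exists_ne (0 : V)
  have _ : Nontrivial S := ⟨1, 0, fun h => hx₀ (congrArg (fun s : S => s.1 x₀) h)⟩
  refine ⟨S, DivisionRing.ofIsUnitOrEqZero (isUnit_or_eq_zero_of_transitive Φ fun x y hx => ?_),
    φ.codRestrict S hφS, ?_⟩
  · obtain ⟨T, h1, h2, h3⟩ := htrans x y hx
    exact ⟨T, ⟨h1, h2⟩, h3⟩
  refine (injective_iff_map_eq_zero (φ.codRestrict S hφS)).2 fun r hr => ?_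
  let v : G → V := fun γ => act γ x₀
  have hvA : ∀ a γ, v (jA a * γ) = ρA.grp a • v γ := fun a γ => by
    rw [← hactA, ← hact_mul]
  have hvB : ∀ b γ, v (jB b * γ) = ρB.grp b • v γ := fun b γ => by
    rw [← hactB, ← hact_mul]
  obtain ⟨F, hF, hcov⟩ := exists_cover
    (P := IsTreeFamily E v (jA.comp f).range jA.range jB.range) htop
    (by rintro _ ⟨c, rfl⟩; exact ⟨f c, rfl⟩) (by rw [hcomm]; rintro _ ⟨c, rfl⟩; exact ⟨g c, rfl⟩)
    (IsTreeFamily.singleton_one (by simpa [v] using hx₀)) (fun _ h => h.one_mem)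
    (fun F a h hF ha hh hnew => hF.insert_mul hdim hA ρA hρA f
      (fun x => (hE x).imp fun e he => (mul_one (i₁ x)).trans he.1) jA rfl rfl hvA
      (by rintro _ ⟨b, rfl⟩ γ; exact ⟨_, hvB b γ⟩) ha hh hnew)
    (fun F a h hF ha hh hnew => (hF.symm.insert_mul
      (fun W hW hW0 => (hdim W hW hW0).trans_eq (add_comm _ _)) hB ρB hρB g
      (fun x => (hE x).imp fun e he => (mul_one (i₂ x)).trans he.2) jB (hcomm ▸ rfl) rfl hvB
      (by rintro _ ⟨a, rfl⟩ γ; exact ⟨_, hvA a γ⟩) ha hh hnew).symm)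
    r.coeff.support
  choose y hy₁ hy₂ using hatom
  have hzero := coeff_eq_zero_of_sum_smul hφA.1 hf (jA.comp f) i₁ y
    (fun l c => (hy₁ l c).trans (algRep_val φA l (f c))) v (fun l c γ => by
      rw [MonoidHom.comp_apply, hvA, ← hi₁, hy₁, smul_smul]; rfl) hF.linearIndepOn hcov r.coeff (by
      have h0 : φ r x₀ = 0 := congrArg (fun s : S => s.1 x₀) hr
      rw [← MonoidAlgebra.sum_coeff_single r, Finsupp.sum, map_sum] at h0
      exact (Finset.sum_congr rfl fun γ _ => (hφ γ _ x₀).symm).trans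
        ((AddMonoidHom.finsetSum_apply _ _ _).symm.trans h0))
  refine MonoidAlgebra.ext (Finsupp.ext fun γ => ?_)
  by_contra hne
  exact hne (hzero γ (Finsupp.mem_support_iff.2 hne))

end

end HughesFree

/-- Let `A`, `B` be locally indicable groups and `C` a group with injective homomorphisms
`f : C → A`, `g : C → B`, and let `G = A ∗_C B` be the amalgamated free product, i.e. the
pushout of `A ← C → B` in the category of groups (expressed by its universal property via
`jA : A → G`, `jB : B → G`).  If both `kA` and `kB` admit Hughes-free embeddings into
division rings, then `kG` embeds into a division ring. -/
theorem monoidAlgebra_amalgam_embeds_divisionRing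
    {k : Type u} [DivisionRing k]
    {A B C G : Type v} [Group A] [Group B] [Group C] [Group G]
    (f : C →* A) (g : C →* B)
    (hf : Function.Injective f) (hg : Function.Injective g)
    (hA : LocallyIndicable A) (hB : LocallyIndicable B)
    (jA : A →* G) (jB : B →* G)
    (hcomm : jA.comp f = jB.comp g)
    (huniv : ∀ (P : Type v) [Group P] (pA : A →* P) (pB : B →* P),
      pA.comp f = pB.comp g →
        ∃! h : G →* P, h.comp jA = pA ∧ h.comp jB = pB)
    (hDA : ∃ (DA : Type (max u v)) (_ : DivisionRing DA)
      (φA : MonoidAlgebra k A →+* DA), IsHughesFreeEmbedding φA)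
    (hDB : ∃ (DB : Type (max u v)) (_ : DivisionRing DB)
      (φB : MonoidAlgebra k B →+* DB), IsHughesFreeEmbedding φB) :
    ∃ (D : Type (max u v)) (_ : DivisionRing D)
      (φ : MonoidAlgebra k G →+* D), Function.Injective φ := by
  obtain ⟨DA, _, φA, hφA⟩ := hDA
  obtain ⟨DB, _, φB, hφB⟩ := hDB
  exact HughesFree.exists_embedding_of_pushout hf hg hA hB hcomm huniv hφA hφB
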